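/- Let f(z) = az² + bz + c be a quadratic polynomial over ℂ (a ≠ 0), and let z₀ ∈ ℂ be a periodic point of exact period n ≥ 1 (f^n(z₀) = z₀ and f^k(z₀) ≠ z₀ for 1 ≤ k < n) whose multiplier satisfies (f^n)'(z₀) = e^{2πiα} for some irrational real α. If the n-th iterate f^n is linearizable at z₀, then α satisfies the Brjuno condition. -/

import Mathlib

open Metric Set Function

/-- The denominators `q n` of the continued fraction expansion of `α`. -/
noncomputable def contFracDen (α : ℝ) (n : ℕ) : ℝ :=
  (GenContFract.of α).dens n

/-- The Brjuno condition: `∑ (log q_{n+1}) / q_n < ∞`. -/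
def BrjunoCondition (α : ℝ) : Prop :=
  Summable (fun n : ℕ => Real.log (contFracDen α (n + 1)) / contFracDen α n)

/-- `f` is linearizable at the fixed point `z₀` with multiplier `lam`. -/
def LinearizableAt (f : ℂ → ℂ) (z₀ lam : ℂ) : Prop :=
  ∃ r > (0 : ℝ), ∃ h : ℂ → ℂ,
    DifferentiableOn ℂ h (ball (0 : ℂ) r) ∧ InjOn h (ball (0 : ℂ) r) ∧ h 0 = z₀ ∧
    ∀ z ∈ ball (0 : ℂ) r, f (h z) = h (lam * z)

namespace SQB

/-- `e(x) = exp(2 π i x)` -/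
noncomputable def ee (x : ℂ) : ℂ := Complex.exp (2 * Real.pi * Complex.I * x)

/-- the class -/
structure Cls (α : ℝ) (G : ℂ → ℂ) : Prop where
  diff : DifferentiableOn ℂ G (ball 0 1)
  bd : ∀ z ∈ ball (0 : ℂ) 1, ‖G z‖ ≤ 200
  zero : G 0 = 0
  der : deriv G 0 = ee α

/-- uniform linearizability -/
def Lin (α r : ℝ) : Prop :=
  ∀ G : ℂ → ℂ, Cls α G → ∃ φ : ℂ → ℂ, DifferentiableOn ℂ φ (ball 0 r) ∧ φ 0 = 0 ∧
    deriv φ 0 = 1 ∧ (∀ z ∈ ball (0 : ℂ) r, ‖φ z - z‖ ≤ ‖z‖ / 2) ∧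
    ∀ᶠ z in nhds (0 : ℂ), φ (G z) = ee α * φ z

end SQB

namespace SQB

noncomputable def gm (x : ℝ) : ℝ := Int.fract x⁻¹

noncomputable def bt (n : ℕ) (x : ℝ) : ℝ := ∏ i ∈ Finset.range n, gm^[i] x

lemma gm_mem {x : ℝ} (h : Irrational x) : Irrational (gm x) ∧ 0 < gm x ∧ gm x < 1 := by
  have h1 : Irrational (gm x) := by
    have : Irrational x⁻¹ := h.inv
    unfold gm Int.fract
    exact this.sub_intCast _
  refine ⟨h1, lt_of_le_of_ne (Int.fract_nonneg _) ?_, Int.fract_lt_one _⟩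
  intro h0
  apply h1.ne_zero
  exact h0.symm

lemma gm_it {x : ℝ} (h : Irrational x) (h0 : 0 < x) (h1 : x < 1) (n : ℕ) :
    Irrational (gm^[n] x) ∧ 0 < gm^[n] x ∧ gm^[n] x < 1 := by
  induction n with
  | zero => exact ⟨h, h0, h1⟩
  | succ n ih =>
    rw [Function.iterate_succ_apply']
    exact gm_mem ih.1

lemma gm_lt_one_it {x : ℝ} (h : Irrational x) (n : ℕ) :
    Irrational (gm^[n] x) := by
  induction n with
  | zero => exact h
  | succ n ih =>
    rw [Function.iterate_succ_apply']
    exact (gm_mem ih).1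

lemma bt_zero (x : ℝ) : bt 0 x = 1 := by simp [bt]

lemma bt_succ (n : ℕ) (x : ℝ) : bt (n+1) x = bt n x * gm^[n] x := by
  simp [bt, Finset.prod_range_succ]

lemma bt_succ' (n : ℕ) (x : ℝ) : bt (n+1) x = x * bt n (gm x) := by
  simp [bt, Finset.prod_range_succ', mul_comm]

lemma bt_pos {x : ℝ} (h : Irrational x) (h0 : 0 < x) (h1 : x < 1) (n : ℕ) : 0 < bt n x :=
  Finset.prod_pos fun i _ => (gm_it h h0 h1 i).2.1

lemma gm_prod {x : ℝ} (h : Irrational x) (h0 : 0 < x) (h1 : x < 1) : x * gm x ≤ 1 / 2 := by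
  have h2 : (1:ℤ) ≤ ⌊x⁻¹⌋ := by
    rw [Int.le_floor]
    push_cast
    exact (one_le_inv₀ h0).2 h1.le
  have h3 : (1:ℝ) ≤ ⌊x⁻¹⌋ := by exact_mod_cast h2
  have h4 : gm x = x⁻¹ - ⌊x⁻¹⌋ := by
    unfold gm Int.fract; rfl
  have h5 := (gm_mem h).2.2
  have h6 : x * gm x = 1 - x * ⌊x⁻¹⌋ := by
    rw [h4, mul_sub, mul_inv_cancel₀ h0.ne']
  nlinarith

lemma bt_two {x : ℝ} (h : Irrational x) (h0 : 0 < x) (h1 : x < 1) (n : ℕ) :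
    bt (n+2) x ≤ bt n x / 2 := by
  rw [bt_succ, bt_succ, Function.iterate_succ_apply', mul_assoc]
  have := gm_it h h0 h1 n
  have h3 := gm_prod this.1 this.2.1 this.2.2
  have := bt_pos h h0 h1 n
  nlinarith

lemma bt_le_one {x : ℝ} (h : Irrational x) (h0 : 0 < x) (h1 : x < 1) (n : ℕ) : bt n x ≤ 1 :=
  Finset.prod_le_one (fun i _ => (gm_it h h0 h1 i).2.1.le) (fun i _ => (gm_it h h0 h1 i).2.2.le)

lemma bt_geom {x : ℝ} (h : Irrational x) (h0 : 0 < x) (h1 : x < 1) (n : ℕ) :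
    bt n x ≤ 2 * (3/4 : ℝ) ^ n ∧ bt (n+1) x ≤ 2 * (3/4 : ℝ) ^ (n+1) := by
  induction n with
  | zero => exact ⟨by simp [bt_zero], by have := bt_le_one h h0 h1 1; norm_num; linarith⟩
  | succ n ih =>
    refine ⟨ih.2, ?_⟩
    have := bt_two h h0 h1 n
    have h2 : (0:ℝ) < (3/4)^n := by positivity
    rw [pow_succ, pow_succ]
    nlinarith [ih.1]

/-- denominators -/
noncomputable def qd (x : ℝ) : ℕ → ℝ × ℝ
  | 0 => (1, ⌊x⁻¹⌋)
  | n+1 => ((qd x n).2, ⌊(gm^[n+1] x)⁻¹⌋ * (qd x n).2 + (qd x n).1)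

lemma stream_eq {α : ℝ} (h : Irrational α) (n : ℕ) :
    ∃ b : ℤ, GenContFract.IntFractPair.stream α n = some ⟨b, gm^[n] (Int.fract α)⟩ ∧
      (n ≠ 0 → b = ⌊(gm^[n-1] (Int.fract α))⁻¹⌋) := by
  have hfr : Irrational (Int.fract α) := by
    unfold Int.fract
    exact h.sub_intCast _
  induction n with
  | zero => exact ⟨⌊α⌋, rfl, by simp⟩
  | succ n ih =>
    obtain ⟨b, hb, -⟩ := ih
    refine ⟨⌊(gm^[n] (Int.fract α))⁻¹⌋, ?_, by simp⟩
    have : gm^[n] (Int.fract α) ≠ 0 := (gm_lt_one_it hfr n).ne_zero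
    rw [GenContFract.IntFractPair.stream, hb]
    simp only [Option.bind_some, this, if_false]
    rw [Function.iterate_succ_apply']
    rfl

lemma get_eq {α : ℝ} (h : Irrational α) (n : ℕ) :
    (GenContFract.of α).s.get? n = some ⟨1, (⌊(gm^[n] (Int.fract α))⁻¹⌋ : ℝ)⟩ := by
  obtain ⟨b, hb, hb2⟩ := stream_eq h (n+1)
  have := GenContFract.get?_of_eq_some_of_succ_get?_intFractPair_stream hb
  rw [this]
  simp at hb2
  rw [hb2]

lemma dens_eq {α : ℝ} (h : Irrational α) (n : ℕ) :
    contFracDen α n = (qd (Int.fract α) n).1 ∧ contFracDen α (n+1) = (qd (Int.fract α) n).2 := by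
  unfold contFracDen
  induction n with
  | zero =>
    refine ⟨by simp [qd], ?_⟩
    rw [zero_add, GenContFract.first_den_eq (get_eq h 0)]
    simp [qd]
  | succ n ih =>
    refine ⟨ih.2, ?_⟩
    rw [GenContFract.dens_recurrence (get_eq h (n+1)) ih.1 ih.2]
    simp [qd]

lemma qd_facts {x : ℝ} (h : Irrational x) (h0 : 0 < x) (h1 : x < 1) (n : ℕ) :
    (qd x n).2 * bt (n+1) x + (qd x n).1 * bt (n+2) x = 1 ∧ 1 ≤ (qd x n).1 ∧
      (qd x n).1 ≤ (qd x n).2 := by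
  have hfl : ∀ n, (1:ℝ) ≤ ⌊(gm^[n] x)⁻¹⌋ := by
    intro n
    have := gm_it h h0 h1 n
    have h2 : (1:ℤ) ≤ ⌊(gm^[n] x)⁻¹⌋ := by
      rw [Int.le_floor]
      push_cast
      exact (one_le_inv₀ this.2.1).2 this.2.2.le
    exact_mod_cast h2
  have hg : ∀ n, gm^[n] x * (⌊(gm^[n] x)⁻¹⌋ + gm^[n+1] x) = 1 := by
    intro n
    have := gm_it h h0 h1 n
    rw [Function.iterate_succ_apply']
    unfold gm
    rw [Int.floor_add_fract]
    exact mul_inv_cancel₀ this.2.1.ne'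
  induction n with
  | zero =>
    simp only [qd]
    have := hg 0
    have h2 := hfl 0
    simp only [bt_succ, bt_zero] at *
    simp only [Function.iterate_zero, id] at *
    exact ⟨by linarith, le_refl _, h2⟩
  | succ n ih =>
    obtain ⟨i1, i2, i3⟩ := ih
    simp only [qd]
    refine ⟨?_, by linarith, ?_⟩
    · have h3 := hg (n+1)
      rw [bt_succ (n+2)]
      rw [bt_succ (n+1)] at i1 ⊢
      linear_combination i1 + (qd x n).2 * bt (n+1) x * h3
    · have := hfl (n+1)
      nlinarith

lemma qd_bt {x : ℝ} (h : Irrational x) (h0 : 0 < x) (h1 : x < 1) (n : ℕ) :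
    (qd x n).2 * bt (n+1) x ≤ 1 ∧ 1/2 ≤ (qd x n).1 * bt n x := by
  obtain ⟨i1, i2, i3⟩ := qd_facts h h0 h1 n
  have p1 := bt_pos h h0 h1 (n+2)
  refine ⟨by nlinarith, ?_⟩
  cases n with
  | zero => simp [qd, bt_zero]; norm_num
  | succ n =>
    obtain ⟨i1, i2, i3⟩ := qd_facts h h0 h1 n
    simp only [qd]
    have p2 := bt_pos h h0 h1 (n+1)
    have p3 := (gm_it h h0 h1 (n+1)).2.2
    have p4 : bt (n+2) x ≤ bt (n+1) x := by rw [bt_succ]; nlinarith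
    have p5 := bt_pos h h0 h1 (n+2)
    have : (qd x n).1 * bt (n+2) x ≤ (qd x n).2 * bt (n+1) x :=
      mul_le_mul i3 p4 p5.le (by linarith)
    linarith

lemma nlog_le {y : ℝ} (h : 0 < y) : y * Real.log (1/y) ≤ 2 * Real.sqrt y := by
  have h1 : Real.log (1/y) = 2 * Real.log (1 / Real.sqrt y) := by
    rw [one_div, one_div, Real.log_inv, Real.log_inv, Real.log_sqrt h.le]; ring
  have h2 : Real.log (1 / Real.sqrt y) ≤ 1 / Real.sqrt y :=
    (Real.log_le_self (by positivity))
  have hs : 0 < Real.sqrt y := Real.sqrt_pos.2 h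
  have h3 : y * (1 / Real.sqrt y) = Real.sqrt y := by
    field_simp
    exact (Real.sq_sqrt h.le).symm
  rw [h1]
  nlinarith

theorem brjuno_of_bound {α : ℝ} (h : Irrational α) (B : ℝ)
    (hB : ∀ N, ∑ n ∈ Finset.range N, bt n (Int.fract α) *
      Real.log (1 / gm^[n] (Int.fract α)) ≤ B) : BrjunoCondition α := by
  have hfr : Irrational (Int.fract α) := by
    unfold Int.fract
    exact h.sub_intCast _
  have h0 : 0 < Int.fract α := lt_of_le_of_ne (Int.fract_nonneg _) hfr.ne_zero.symm
  have h1 := Int.fract_lt_one α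
  set x := Int.fract α with hx
  unfold BrjunoCondition
  have hs1 : Summable fun n => bt n x * Real.log (1 / gm^[n] x) := by
    refine summable_of_sum_range_le (c := B) (fun n => ?_) hB
    refine mul_nonneg (bt_pos hfr h0 h1 n).le (Real.log_nonneg ?_)
    have := gm_it hfr h0 h1 n
    exact (one_le_div this.2.1).2 this.2.2.le
  have hs2 : Summable fun n => bt n x * Real.log (1 / bt n x) := by
    have hg : Summable fun n : ℕ => 4 * (Real.sqrt (3/4)) ^ n := by
      refine (summable_geometric_of_lt_one (Real.sqrt_nonneg _) ?_).mul_left 4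
      rw [Real.sqrt_lt' (by norm_num)]
      norm_num
    refine Summable.of_nonneg_of_le (fun n => ?_) (fun n => ?_) hg
    · refine mul_nonneg (bt_pos hfr h0 h1 n).le (Real.log_nonneg ?_)
      exact (one_le_div (bt_pos hfr h0 h1 n)).2 (bt_le_one hfr h0 h1 n)
    · refine (nlog_le (bt_pos hfr h0 h1 n)).trans ?_
      have : Real.sqrt (bt n x) ≤ 2 * (Real.sqrt (3/4)) ^ n := by
        apply Real.sqrt_le_iff.2
        refine ⟨by positivity, (bt_geom hfr h0 h1 n).1.trans ?_⟩
        rw [mul_pow, ← pow_mul, mul_comm n 2, pow_mul, Real.sq_sqrt (by norm_num)]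
        have : (0:ℝ) ≤ (3/4)^n := by positivity
        linarith
      linarith
  refine Summable.of_nonneg_of_le (fun n => ?_) (fun n => ?_) ((hs1.add hs2).mul_left 2)
  · rw [(dens_eq h n).1, (dens_eq h n).2]
    obtain ⟨i1, i2, i3⟩ := qd_facts hfr h0 h1 n
    exact div_nonneg (Real.log_nonneg (by linarith)) (by linarith)
  · rw [(dens_eq h n).1, (dens_eq h n).2]
    obtain ⟨i1, i2, i3⟩ := qd_facts hfr h0 h1 n
    obtain ⟨j1, j2⟩ := qd_bt hfr h0 h1 n
    have hp := bt_pos hfr h0 h1 n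
    have hp1 := bt_pos hfr h0 h1 (n+1)
    have hgp := gm_it hfr h0 h1 n
    have e1 : Real.log (qd x n).2 ≤ Real.log (1 / gm^[n] x) + Real.log (1 / bt n x) := by
      rw [← Real.log_mul (by have := hgp.2.1; positivity) (by positivity)]
      apply Real.log_le_log (by linarith)
      rw [bt_succ] at j1
      rw [one_div_mul_one_div, mul_comm, le_div_iff₀ (by have := hgp.2.1; positivity)]
      linarith
    have e2 : 0 ≤ Real.log (qd x n).2 := Real.log_nonneg (by linarith)
    rw [div_le_iff₀ (by linarith)]
    nlinarith [mul_le_mul_of_nonneg_right j2 e2, mul_nonneg (by linarith : 0 ≤ (qd x n).1) hp.le]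

/-- The recursion argument, for an abstract predicate. -/
theorem recursion (P : ℝ → ℝ → Prop) (C : ℝ) (hC : 0 ≤ C)
    (hadd : ∀ x K, P x K ↔ P (x+1) K) (hneg : ∀ x K, P x K → P (-x) K)
    (hcr : ∀ x K, 0 < x → x < 1/2 → P x K → Real.log (1/x) - C ≤ K)
    (hst : ∀ x K, 0 < x → x < 1/2 → P x K → P (1/x) ((K - Real.log (1/x) + C) / x))
    (α : ℝ) (h : Irrational α) (K : ℝ) (hP : P α K) : BrjunoCondition α := by
  have haddn : ∀ (n : ℕ) x K, P x K ↔ P (x+n) K := by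
    intro n
    induction n with
    | zero => simp
    | succ n ih => intro x K; rw [ih, hadd]; push_cast; rw [add_assoc]
  have haddz : ∀ (n : ℤ) x K, P x K ↔ P (x+n) K := by
    intro n x K
    obtain ⟨m, rfl | rfl⟩ := n.eq_nat_or_neg
    · exact_mod_cast haddn m x K
    · rw [haddn m (x + _)]; push_cast; rw [neg_add_cancel_right]
  have hfract : ∀ x K, P x K → P (Int.fract x) K := by
    intro x K hp
    have := (haddz (-⌊x⌋) x K).1 hp
    rw [Int.fract]; push_cast at this; exact this
  set S : ℕ → ℝ → ℝ := fun N x => ∑ n ∈ Finset.range N, bt n x *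
    (Real.log (1 / gm^[n] x) - (C+1)) with hS
  have hS0 : ∀ x, S 0 x = 0 := by intro x; simp [hS]
  have hSs : ∀ N x, S (N+1) x = Real.log (1/x) - (C+1) + x * S N (gm x) := by
    intro N x
    simp only [hS, Finset.sum_range_succ', bt_succ', Function.iterate_succ_apply, bt_zero,
      Function.iterate_zero, id, Finset.mul_sum]
    rw [add_comm]
    congr 1
    · ring
    · exact Finset.sum_congr rfl fun i _ => by ring
  have l2 : Real.log 2 ≤ 1 := by have := Real.log_two_lt_d9; linarith
  set D := C + 2 with hD
  have lowK : ∀ x K, Irrational x → 0 < x → x < 1 → P x K → -C ≤ K := by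
    intro x K hi h0 h1 hp
    rcases lt_or_ge x (1/2) with hlt | hge
    · have := hcr x K h0 hlt hp
      have : 0 ≤ Real.log (1/x) := Real.log_nonneg ((one_le_div h0).2 h1.le)
      linarith
    · have hne : x ≠ 1/2 := by
        intro h2
        apply hi
        exact ⟨1/2, by rw [h2]; norm_num⟩
      have hgt : 1/2 < x := lt_of_le_of_ne hge hne.symm
      have hp2 : P (1-x) K := by
        rw [sub_eq_neg_add]; exact (hadd _ _).1 (hneg _ _ hp)
      have := hcr (1-x) K (by linarith) (by linarith) hp2
      have : 0 ≤ Real.log (1/(1-x)) :=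
        Real.log_nonneg ((one_le_div (by linarith)).2 (by linarith))
      linarith
  have main : ∀ N, (∀ x K, Irrational x → 0 < x → x < 1 → P x K → S N x ≤ K + D) ∧
      (∀ x K, Irrational x → 0 < x → x < 1 → P x K → S (N+1) x ≤ K + D) := by
    have stp1 : ∀ N, (∀ x K, Irrational x → 0 < x → x < 1 → P x K → S N x ≤ K + D) →
        ∀ x K, Irrational x → 0 < x → x < 1/2 → P x K → S (N+1) x ≤ K + D := by
      intro N ih x K hi h0 h2 hp
      have hp1 := hst x K h0 h2 hp
      have hg := gm_mem hi
      have hp2 : P (gm x) ((K - Real.log (1/x) + C) / x) := by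
        unfold gm; rw [← one_div]; exact hfract _ _ hp1
      have := ih _ _ hg.1 hg.2.1 hg.2.2 hp2
      rw [hSs]
      have h3 := mul_le_mul_of_nonneg_left this h0.le
      rw [mul_add, mul_div_cancel₀ _ h0.ne'] at h3
      nlinarith
    intro N
    induction N with
    | zero =>
      have z0 : ∀ x K, Irrational x → 0 < x → x < 1 → P x K → S 0 x ≤ K + D := by
        intro x K hi h0 h1 hp
        rw [hS0]
        have := lowK x K hi h0 h1 hp
        linarith
      refine ⟨z0, ?_⟩
      intro x K hi h0 h1 hp
      rcases lt_or_ge x (1/2) with hlt | hge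
      · exact stp1 0 z0 x K hi h0 hlt hp
      · rw [hSs, hS0]
        have := lowK x K hi h0 h1 hp
        have h5 : Real.log (1/x) ≤ Real.log 2 := by
          apply Real.log_le_log (by positivity)
          rw [div_le_iff₀ h0]; linarith
        linarith
    | succ N ih =>
      refine ⟨ih.2, ?_⟩
      intro x K hi h0 h1 hp
      rcases lt_or_ge x (1/2) with hlt | hge
      · exact stp1 _ ih.2 x K hi h0 hlt hp
      · have hne : x ≠ 1/2 := by
          intro h2
          apply hi
          exact ⟨1/2, by rw [h2]; norm_num⟩
        have hgt : 1/2 < x := lt_of_le_of_ne hge hne.symm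
        have hp2 : P (1-x) K := by
          rw [sub_eq_neg_add]; exact (hadd _ _).1 (hneg _ _ hp)
        have hp3 := hst (1-x) K (by linarith) (by linarith) hp2
        have hg := gm_mem hi
        have hgm : gm x = x⁻¹ - 1 := by
          unfold gm
          rw [Int.fract]
          have : ⌊x⁻¹⌋ = 1 := by
            rw [Int.floor_eq_iff]
            push_cast
            refine ⟨(one_le_inv₀ h0).2 h1.le, ?_⟩
            rw [inv_lt_iff_one_lt_mul₀ h0]
            linarith
          rw [this]; simp
        have hy : 0 < 1 - x := by linarith
        have hxg : x * gm x = 1 - x := by rw [hgm, mul_sub, mul_inv_cancel₀ h0.ne']; ring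
        have hinv : 1/(1-x) = 1/gm x + 1 := by
          rw [← hxg]
          have := hg.2.1
          field_simp
          linarith
        have hg2 := gm_mem hg.1
        rw [hinv] at hp3
        have hp4 : P (gm (gm x)) ((K - Real.log (1/gm x + 1) + C) / (1-x)) := by
          have := hfract _ _ ((hadd _ _).2 hp3)
          rw [one_div] at this
          rw [one_div]; exact this
        have h6 := ih.1 _ _ hg2.1 hg2.2.1 hg2.2.2 hp4
        rw [hSs, hSs]
        have h7 := mul_le_mul_of_nonneg_left h6 hy.le
        rw [mul_add, mul_div_cancel₀ _ hy.ne', ← hinv] at h7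
        have h8 : Real.log (1/x) ≤ Real.log 2 := by
          apply Real.log_le_log (by positivity)
          rw [div_le_iff₀ h0]; linarith
        have h9 : Real.log (1/gm x) ≤ Real.log (1/(1-x)) := by
          have := hg.2.1
          apply Real.log_le_log (by positivity)
          rw [hinv]; linarith
        have h10 : 0 ≤ Real.log (1/gm x) := by
          have := hg.2.1
          apply Real.log_nonneg
          rw [le_div_iff₀ this]; linarith [hg.2.2]
        have h11 : x * (gm x * S N (gm (gm x))) = (1-x) * S N (gm (gm x)) := by
          rw [← mul_assoc, hxg]
        rw [mul_add, h11]
        nlinarith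
  have hfr : Irrational (Int.fract α) := by
    unfold Int.fract
    exact h.sub_intCast _
  have h0 : 0 < Int.fract α := lt_of_le_of_ne (Int.fract_nonneg _) hfr.ne_zero.symm
  have h1 := Int.fract_lt_one α
  set x := Int.fract α with hx
  have hPx : P x K := hfract _ _ hP
  refine brjuno_of_bound h (K + D + (C+1) * ∑' n : ℕ, 2 * (3/4 : ℝ)^n) fun N => ?_
  have hm := (main N).1 x K hfr h0 h1 hPx
  have hb : ∑ n ∈ Finset.range N, bt n x ≤ ∑' n : ℕ, 2 * (3/4 : ℝ)^n := by
    refine (Finset.sum_le_sum fun n _ => (bt_geom hfr h0 h1 n).1).trans ?_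
    refine Summable.sum_le_tsum _ (fun i _ => by positivity) ?_
    exact (summable_geometric_of_lt_one (by norm_num) (by norm_num)).mul_left 2
  have hS' : S N x = ∑ n ∈ Finset.range N, bt n x * Real.log (1 / gm^[n] x)
      - (C+1) * ∑ n ∈ Finset.range N, bt n x := by
    simp only [hS]
    rw [Finset.mul_sum, ← Finset.sum_sub_distrib]
    exact Finset.sum_congr rfl fun i _ => by ring
  nlinarith

end SQB

namespace SQB

lemma ee_add (x y : ℂ) : ee (x + y) = ee x * ee y := by
  unfold ee; rw [← Complex.exp_add]; congr 1; ring

lemma ee_one : ee 1 = 1 := by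
  unfold ee; rw [mul_one]; exact Complex.exp_two_pi_mul_I

lemma ee_zero : ee 0 = 1 := by
  unfold ee; simp

lemma ee_ne (x : ℂ) : ee x ≠ 0 := Complex.exp_ne_zero _

lemma ee_norm (x : ℂ) : ‖ee x‖ = Real.exp (-(2 * Real.pi * x.im)) := by
  unfold ee; rw [Complex.norm_exp]; congr 1; simp

lemma ee_norm_real (x : ℝ) : ‖ee x‖ = 1 := by
  rw [ee_norm]; simp

lemma ee_neg (x : ℂ) : ee (-x) = (ee x)⁻¹ := by
  unfold ee; rw [← Complex.exp_neg]; congr 1; ring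

lemma ee_conj (x : ℝ) : (starRingEnd ℂ) (ee x) = ee (-x) := by
  unfold ee; rw [← Complex.exp_conj]; congr 1; simp [Complex.conj_ofNat]

lemma ee_int (n : ℤ) : ee n = 1 := by
  unfold ee
  rw [Complex.exp_eq_one_iff]
  exact ⟨n, by ring⟩

lemma ee_eq_one {x : ℂ} (h : ee x = 1) : ∃ n : ℤ, x = n := by
  unfold ee at h
  rw [Complex.exp_eq_one_iff] at h
  obtain ⟨n, hn⟩ := h
  refine ⟨n, ?_⟩
  have : (2 * (Real.pi : ℂ) * Complex.I) ≠ 0 := Complex.two_pi_I_ne_zero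
  have h2 : (2 * (Real.pi : ℂ) * Complex.I) * x = (2 * (Real.pi : ℂ) * Complex.I) * n := by
    rw [hn]; ring
  exact mul_left_cancel₀ this h2

lemma ee_eq {x y : ℂ} (h : ee x = ee y) : ∃ n : ℤ, x = y + n := by
  have : ee (x - y) = 1 := by
    rw [sub_eq_add_neg, ee_add, ee_neg, h, mul_inv_cancel₀ (ee_ne _)]
  obtain ⟨n, hn⟩ := ee_eq_one this
  exact ⟨n, by rw [← hn]; ring⟩

lemma ee_add_int (x : ℂ) (n : ℤ) : ee (x + n) = ee x := by rw [ee_add, ee_int, mul_one]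

lemma Lin_add (α r : ℝ) : Lin α r ↔ Lin (α+1) r := by
  have : ee ((α+1 : ℝ) : ℂ) = ee α := by push_cast; rw [ee_add, ee_one, mul_one]
  have h2 : ∀ G, Cls α G ↔ Cls (α+1) G := by
    intro G
    constructor
    · rintro ⟨a, b, c, d⟩; exact ⟨a, b, c, by rw [this]; exact d⟩
    · rintro ⟨a, b, c, d⟩; exact ⟨a, b, c, by rw [← this]; exact d⟩
  unfold Lin
  simp only [← h2, this]

lemma Lin_neg (α r : ℝ) (h : Lin α r) : Lin (-α) r := by
  intro G hG
  set c := starRingEnd ℂ with hc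
  have hball : ∀ s : ℝ, ∀ z : ℂ, z ∈ ball (0:ℂ) s → c z ∈ ball (0:ℂ) s := by
    intro s z hz; simp only [mem_ball_zero_iff] at *; rwa [hc, RCLike.norm_conj]
  have hdiff : ∀ (s : ℝ) (f : ℂ → ℂ), DifferentiableOn ℂ f (ball 0 s) →
      DifferentiableOn ℂ (c ∘ f ∘ c) (ball 0 s) := by
    intro s f hf z hz
    have := (hf.differentiableAt (isOpen_ball.mem_nhds (hball s z hz)))
    have h2 := this.conj_conj
    rw [hc, Complex.conj_conj] at h2
    exact h2.differentiableWithinAt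
  have hcls : Cls α (c ∘ G ∘ c) := by
    refine ⟨hdiff 1 G hG.diff, ?_, by simp [hG.zero], ?_⟩
    · intro z hz
      have := hG.bd _ (hball 1 z hz)
      simp only [comp_apply]; rwa [hc, RCLike.norm_conj]
    · rw [hc, deriv_conj_conj, comp_apply, comp_apply, map_zero, hG.der, ee_conj, Complex.ofReal_neg, neg_neg]
  obtain ⟨φ, h1, h2, h3, h4, h5⟩ := h _ hcls
  refine ⟨c ∘ φ ∘ c, hdiff r φ h1, by simp [h2], ?_, ?_, ?_⟩
  · rw [hc, deriv_conj_conj]; simp [h3]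
  · intro z hz
    have := h4 _ (hball r z hz)
    have e : (c ∘ φ ∘ c) z - z = c (φ (c z) - c z) := by simp [hc]
    rw [e, hc, RCLike.norm_conj]
    rwa [hc, RCLike.norm_conj] at this
  · have ht : Filter.Tendsto c (nhds 0) (nhds 0) := by
      have := (Complex.continuous_conj.tendsto 0); simpa using this
    filter_upwards [ht.eventually h5] with z hz
    simp only [comp_apply, hc, Complex.conj_conj] at hz ⊢
    rw [hz, map_mul, ee_conj, Complex.ofReal_neg]

lemma Lin_cremer (α r : ℝ) (h0 : 0 < α) (h1 : α < 1/2) (h : Lin α r) : r ≤ α := by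
  by_contra hr
  push Not at hr
  set lam := ee α with hlam
  have hl1 : ‖lam‖ = 1 := ee_norm_real α
  have hne : lam ≠ 1 := by
    intro h2
    obtain ⟨n, hn⟩ := ee_eq_one h2
    have h3 : α = n := by exact_mod_cast hn
    have h4 : (0:ℝ) < n := by rw [← h3]; exact h0
    have h5 : (n:ℝ) < 1 := by rw [← h3]; linarith
    have h6 : (0:ℤ) < n := by exact_mod_cast h4
    have h7 : (n:ℤ) < 1 := by exact_mod_cast h5
    omega
  have hsub : ‖lam - 1‖ ≤ 2 * Real.pi * α := by
    have := Real.norm_exp_I_mul_ofReal_sub_one_le (x := 2 * Real.pi * α)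
    rw [Real.norm_of_nonneg (by positivity)] at this
    refine le_trans (le_of_eq ?_) this
    rw [hlam, ee]; congr 3; push_cast; ring
  set z1 := (1 - lam) / 100 with hz1
  have hz1n : ‖z1‖ ≤ α / 10 := by
    rw [hz1, norm_div, norm_sub_rev]
    have := Real.pi_lt_four
    simp only [Complex.norm_ofNat]
    nlinarith
  have hz1n2 : ‖z1‖ ≤ 1/50 := by
    rw [hz1, norm_div]
    have := norm_sub_le (1:ℂ) lam
    rw [hl1] at this
    simp only [Complex.norm_ofNat, norm_one] at *
    linarith
  have hz1p : 0 < ‖z1‖ := by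
    rw [norm_pos_iff, hz1]
    exact div_ne_zero (sub_ne_zero.2 hne.symm) (by norm_num)
  set G : ℂ → ℂ := fun z => lam * z + 100 * z^2 with hG
  have hGd : Differentiable ℂ G := by intro z; simp only [hG]; fun_prop
  have hGb : ∀ z, ‖G z‖ ≤ ‖z‖ + 100 * ‖z‖^2 := by
    intro z
    refine (norm_add_le _ _).trans ?_
    simp [hl1]
  have hcls : Cls α G := by
    refine ⟨hGd.differentiableOn, ?_, by simp [hG], ?_⟩
    · intro z hz
      rw [mem_ball_zero_iff] at hz
      refine (hGb z).trans ?_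
      nlinarith [norm_nonneg z]
    · have : HasDerivAt G (lam * 1 + 100 * (2 * (0:ℂ)^1 * 1)) 0 := by
        simp only [hG]
        exact ((hasDerivAt_id (0:ℂ)).const_mul lam).add
          ((((hasDerivAt_id (0:ℂ)).pow 2).const_mul 100).congr_deriv (by simp))
      rw [this.deriv]; simp [hlam]
  obtain ⟨φ, f1, f2, f3, f4, f5⟩ := h G hcls
  have hU : ∀ z ∈ ball (0:ℂ) (2 * ‖z1‖), G z ∈ ball (0:ℂ) r := by
    intro z hz
    rw [mem_ball_zero_iff] at *
    refine (hGb z).trans_lt ?_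
    nlinarith [norm_nonneg z]
  have hU2 : ball (0:ℂ) (2 * ‖z1‖) ⊆ ball (0:ℂ) r := ball_subset_ball (by linarith)
  have a1 : AnalyticOnNhd ℂ (φ ∘ G) (ball (0:ℂ) (2 * ‖z1‖)) :=
    (f1.comp hGd.differentiableOn hU).analyticOnNhd isOpen_ball
  have a2 : AnalyticOnNhd ℂ (fun z => lam * φ z) (ball (0:ℂ) (2 * ‖z1‖)) :=
    ((f1.mono hU2).const_mul lam).analyticOnNhd isOpen_ball
  have := a1.eqOn_of_preconnected_of_eventuallyEq a2
    (convex_ball _ _).isPreconnected (z₀ := 0) (by simpa using hz1p) f5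
  have hz1m : z1 ∈ ball (0:ℂ) (2 * ‖z1‖) := by rw [mem_ball_zero_iff]; linarith
  have h8 := this hz1m
  have h9 : G z1 = z1 := by simp only [hG, hz1]; ring
  simp only [comp_apply, h9] at h8
  have h10 : φ z1 = 0 := by
    have : (1 - lam) * φ z1 = 0 := by rw [sub_mul, ← h8]; ring
    exact (mul_eq_zero.1 this).resolve_left (sub_ne_zero.2 hne.symm)
  have h11 := f4 z1 (hU2 hz1m)
  rw [h10, zero_sub, norm_neg] at h11
  linarith

end SQB

namespace SQB
set_option linter.unusedVariables false
open MeasureTheory Filter Topology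

/-- weight -/
noncomputable def wt (s : ℝ) : ℝ := (1 + s^2)⁻¹

lemma wt_pos (s : ℝ) : 0 < wt s := by unfold wt; positivity
lemma wt_le (s : ℝ) : wt s ≤ 1 := by
  unfold wt; exact inv_le_one_of_one_le₀ (by nlinarith)
lemma wt_neg (s : ℝ) : wt (-s) = wt s := by unfold wt; simp
lemma wt_cont : Continuous wt := by
  unfold wt; exact Continuous.inv₀ (by fun_prop) (fun s => by positivity)

noncomputable def uI (κ : ℝ) (f : ℝ → ℂ) (Y : ℝ) : ℂ :=
  ∫ s in Iic Y, (Real.exp (-κ * (Y - s)) : ℂ) * f s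

section
variable {κ : ℝ} {f : ℝ → ℂ} {M : ℝ}

lemma uI_int (hκ : 0 ≤ κ) (hf : Continuous f) (hM : ∀ s, ‖f s‖ ≤ M * wt s) (Y : ℝ) :
    IntegrableOn (fun s => (Real.exp (-κ * (Y - s)) : ℂ) * f s) (Iic Y) := by
  have h1 : IntegrableOn (fun s => M * wt s) (Iic Y) :=
    (integrable_inv_one_add_sq.const_mul M).integrableOn
  refine h1.mono' (by fun_prop) ?_
  rw [ae_restrict_iff' measurableSet_Iic]
  refine Eventually.of_forall fun s hs => ?_
  rw [norm_mul, Complex.norm_real, Real.norm_of_nonneg (Real.exp_pos _).le]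
  have : Real.exp (-κ * (Y - s)) ≤ 1 := by
    rw [Real.exp_le_one_iff]
    simp only [mem_Iic] at hs
    nlinarith
  have h2 := hM s
  have h3 := norm_nonneg (f s)
  nlinarith

lemma uI_norm (hκ : 0 ≤ κ) (hf : Continuous f) (hM0 : 0 ≤ M) (hM : ∀ s, ‖f s‖ ≤ M * wt s)
    (Y : ℝ) : ‖uI κ f Y‖ ≤ Real.pi * M := by
  have h1 : Integrable (fun s => M * wt s) := integrable_inv_one_add_sq.const_mul M
  have h3 : ∫ s, M * wt s = M * Real.pi := by
    rw [integral_const_mul]; unfold wt; rw [integral_univ_inv_one_add_sq]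
  calc ‖uI κ f Y‖ ≤ ∫ s in Iic Y, M * wt s := by
        refine norm_integral_le_of_norm_le h1.integrableOn ?_
        rw [ae_restrict_iff' measurableSet_Iic]
        refine Eventually.of_forall fun s hs => ?_
        rw [norm_mul, Complex.norm_real, Real.norm_of_nonneg (Real.exp_pos _).le]
        have : Real.exp (-κ * (Y - s)) ≤ 1 := by
          rw [Real.exp_le_one_iff]
          simp only [mem_Iic] at hs
          nlinarith
        have h2 := hM s
        have h3 := norm_nonneg (f s)
        nlinarith
    _ ≤ ∫ s, M * wt s := by
        refine setIntegral_le_integral h1 (Eventually.of_forall fun s => ?_)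
        exact mul_nonneg hM0 (wt_pos s).le
    _ = Real.pi * M := by rw [h3]; ring

lemma uI_norm2 (hκ : 0 ≤ κ) (hM0 : 0 ≤ M) (hM : ∀ s, ‖f s‖ ≤ M * wt s)
    (Y : ℝ) : κ * ‖uI κ f Y‖ ≤ M := by
  rcases hκ.eq_or_lt with h | h
  · rw [← h]; simpa using hM0
  have hi : IntegrableOn (fun s => M * Real.exp (-κ * Y) * Real.exp (κ * s)) (Iic Y) :=
    (integrableOn_exp_mul_Iic h Y).const_mul _
  have : ‖uI κ f Y‖ ≤ ∫ s in Iic Y, M * Real.exp (-κ * Y) * Real.exp (κ * s) := by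
    refine norm_integral_le_of_norm_le hi (Eventually.of_forall fun s => ?_)
    rw [norm_mul, Complex.norm_real, Real.norm_of_nonneg (Real.exp_pos _).le, mul_assoc M,
      ← Real.exp_add, mul_comm M]
    rw [show -κ * (Y - s) = -κ * Y + κ * s by ring]
    refine mul_le_mul_of_nonneg_left ?_ (Real.exp_pos _).le
    have := hM s
    have h2 := wt_le s
    nlinarith
  rw [integral_const_mul, integral_exp_mul_Iic h] at this
  have h2 : M * Real.exp (-κ * Y) * (Real.exp (κ * Y) / κ) = M / κ := by
    rw [mul_assoc, ← mul_div_assoc, ← Real.exp_add]; simp [div_eq_mul_inv]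
  rw [h2, le_div_iff₀ h] at this
  linarith

lemma uI_deriv (hκ : 0 ≤ κ) (hf : Continuous f) (hM : ∀ s, ‖f s‖ ≤ M * wt s) (Y : ℝ) :
    HasDerivAt (uI κ f) (f Y - κ * uI κ f Y) Y := by
  set h : ℝ → ℂ := fun s => (Real.exp (κ * s) : ℂ) * f s with hh
  have hcont : Continuous h := by simp only [hh]; fun_prop
  have e1 : ∀ Y s, (Real.exp (-κ * (Y - s)) : ℂ) * f s = (Real.exp (-κ * Y) : ℂ) * h s := by
    intro Y s
    simp only [hh]
    rw [← mul_assoc, ← Complex.ofReal_mul, ← Real.exp_add]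
    congr 4; ring
  have hint : ∀ Y, IntegrableOn h (Iic Y) := by
    intro Y
    have := (uI_int hκ hf hM Y).const_mul (Real.exp (κ * Y) : ℂ)
    refine this.congr (Eventually.of_forall fun s => ?_)
    simp only [e1]
    rw [← mul_assoc, ← Complex.ofReal_mul, ← Real.exp_add]
    simp
  have e2 : ∀ Y, uI κ f Y = (Real.exp (-κ * Y) : ℂ) *
      ((∫ s in Iic 0, h s) + ∫ s in (0:ℝ)..Y, h s) := by
    intro Y
    rw [← intervalIntegral.integral_Iic_sub_Iic (hint 0) (hint Y)]
    unfold uI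
    simp only [e1]
    rw [integral_const_mul]
    congr 1; ring
  have d1 : HasDerivAt (fun Y => ∫ s in (0:ℝ)..Y, h s) (h Y) Y :=
    (hcont.integral_hasStrictDerivAt 0 Y).hasDerivAt
  have d2 : HasDerivAt (fun Y : ℝ => (Real.exp (-κ * Y) : ℂ)) ((Real.exp (-κ * Y) * (-κ) : ℝ) : ℂ) Y := by
    have : HasDerivAt (fun Y : ℝ => -κ * Y) (-κ) Y := by
      simpa using (hasDerivAt_id Y).const_mul (-κ)
    exact (this.exp).ofReal_comp
  have d3 := d2.mul (d1.const_add (∫ s in Iic 0, h s))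
  have e3 : uI κ f = fun Y => (Real.exp (-κ * Y) : ℂ) *
      ((∫ s in Iic 0, h s) + ∫ s in (0:ℝ)..Y, h s) := funext e2
  rw [e2 Y, e3]
  refine d3.congr_deriv ?_
  have e4 : (Real.exp (-κ * Y) : ℂ) * h Y = f Y := by
    rw [← e1]; simp
  rw [e4]
  push_cast
  ring

lemma uI_top (hκ : 0 < κ) (hf : Continuous f) (hM0 : 0 ≤ M) (hM : ∀ s, ‖f s‖ ≤ M * wt s) :
    Tendsto (uI κ f) atTop (𝓝 0) := by
  have h1 : Integrable (fun s => M * wt s) := integrable_inv_one_add_sq.const_mul M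
  have e : uI κ f = fun Y => ∫ s, (Iic Y).indicator
      (fun s => (Real.exp (-κ * (Y - s)) : ℂ) * f s) s := by
    funext Y; rw [integral_indicator measurableSet_Iic]; rfl
  rw [e, show (0:ℂ) = ∫ _ : ℝ, (0:ℂ) by simp]
  refine tendsto_integral_filter_of_dominated_convergence (fun s => M * wt s) ?_ ?_ h1 ?_
  · refine Eventually.of_forall fun Y => ?_
    exact (Continuous.aestronglyMeasurable (by fun_prop)).indicator measurableSet_Iic
  · refine Eventually.of_forall fun Y => Eventually.of_forall fun s => ?_
    by_cases hs : s ∈ Iic Y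
    · rw [indicator_of_mem hs, norm_mul, Complex.norm_real, Real.norm_of_nonneg (Real.exp_pos _).le]
      have : Real.exp (-κ * (Y - s)) ≤ 1 := by
        rw [Real.exp_le_one_iff]
        simp only [mem_Iic] at hs
        nlinarith
      have h2 := hM s
      have h3 := norm_nonneg (f s)
      nlinarith
    · rw [indicator_of_notMem hs, norm_zero]
      exact mul_nonneg hM0 (wt_pos s).le
  · refine Eventually.of_forall fun s => ?_
    have ht : Tendsto (fun Y : ℝ => (Real.exp (-κ * (Y - s)) : ℂ) * f s) atTop (𝓝 0) := by
      have t1 : Tendsto (fun Y : ℝ => Real.exp (-κ * (Y - s))) atTop (𝓝 0) := by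
        refine Real.tendsto_exp_atBot.comp ?_
        have : Tendsto (fun Y : ℝ => Y - s) atTop atTop := tendsto_atTop_add_const_right _ _ tendsto_id
        exact this.const_mul_atTop_of_neg (by linarith)
      have t2 := (Complex.continuous_ofReal.tendsto 0).comp t1
      have t3 := t2.mul_const (f s)
      simpa [Function.comp_def] using t3
    refine ht.congr' ?_
    filter_upwards [eventually_ge_atTop s] with Y hY
    rw [indicator_of_mem (by exact hY)]

lemma uI_bot (hκ : 0 ≤ κ) (hM0 : 0 ≤ M) (hf : Continuous f) (hM : ∀ s, ‖f s‖ ≤ M * wt s) :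
    Tendsto (uI κ f) atBot (𝓝 0) := by
  have h1 : Integrable (fun s => M * wt s) := integrable_inv_one_add_sq.const_mul M
  have e : uI κ f = fun Y => ∫ s, (Iic Y).indicator
      (fun s => (Real.exp (-κ * (Y - s)) : ℂ) * f s) s := by
    funext Y; rw [integral_indicator measurableSet_Iic]; rfl
  rw [e, show (0:ℂ) = ∫ _ : ℝ, (0:ℂ) by simp]
  refine tendsto_integral_filter_of_dominated_convergence (fun s => M * wt s) ?_ ?_ h1 ?_
  · refine Eventually.of_forall fun Y => ?_
    exact (Continuous.aestronglyMeasurable (by fun_prop)).indicator measurableSet_Iic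
  · refine Eventually.of_forall fun Y => Eventually.of_forall fun s => ?_
    by_cases hs : s ∈ Iic Y
    · rw [indicator_of_mem hs, norm_mul, Complex.norm_real, Real.norm_of_nonneg (Real.exp_pos _).le]
      have : Real.exp (-κ * (Y - s)) ≤ 1 := by
        rw [Real.exp_le_one_iff]
        simp only [mem_Iic] at hs
        nlinarith
      have h2 := hM s
      have h3 := norm_nonneg (f s)
      nlinarith
    · rw [indicator_of_notMem hs, norm_zero]
      exact mul_nonneg hM0 (wt_pos s).le
  · refine Eventually.of_forall fun s => ?_
    refine tendsto_const_nhds.congr' ?_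
    filter_upwards [eventually_lt_atBot s] with Y hY
    rw [indicator_of_notMem (by simpa using hY)]

/-- bounded solution of `w' = -κ w - 2 i f`. -/
noncomputable def wK (κ : ℝ) (f : ℝ → ℂ) (Y : ℝ) : ℂ :=
  if 0 < κ then -2 * Complex.I * uI κ f Y else 2 * Complex.I * uI (-κ) (fun s => f (-s)) (-Y)

lemma hMneg (hM : ∀ s, ‖f s‖ ≤ M * wt s) : ∀ s, ‖f (-s)‖ ≤ M * wt s := by
  intro s; rw [← wt_neg]; exact hM _

lemma wK_norm (hf : Continuous f) (hM0 : 0 ≤ M) (hM : ∀ s, ‖f s‖ ≤ M * wt s)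
    (Y : ℝ) : ‖wK κ f Y‖ ≤ 2 * Real.pi * M := by
  unfold wK
  split_ifs with h
  · have := uI_norm h.le hf hM0 hM Y
    simp only [norm_mul, norm_neg, Complex.norm_I, Complex.norm_ofNat]
    linarith
  · have := uI_norm (κ := -κ) (by linarith) (hf.comp continuous_neg) hM0 (hMneg hM) (-Y)
    simp only [norm_mul, Complex.norm_I, Complex.norm_ofNat]
    simp only [comp_def] at this
    linarith

lemma wK_norm2 (hM0 : 0 ≤ M) (hM : ∀ s, ‖f s‖ ≤ M * wt s)
    (Y : ℝ) : |κ| * ‖wK κ f Y‖ ≤ 2 * M := by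
  unfold wK
  split_ifs with h
  · have := uI_norm2 h.le hM0 hM Y
    simp only [norm_mul, norm_neg, Complex.norm_I, Complex.norm_ofNat]
    rw [abs_of_pos h]
    linarith
  · have := uI_norm2 (κ := -κ) (by linarith) hM0 (hMneg hM) (-Y)
    simp only [norm_mul, Complex.norm_I, Complex.norm_ofNat]
    rw [abs_of_nonpos (by linarith)]
    linarith

lemma wK_deriv (hf : Continuous f) (hM : ∀ s, ‖f s‖ ≤ M * wt s) (Y : ℝ) :
    HasDerivAt (wK κ f) (-κ * wK κ f Y - 2 * Complex.I * f Y) Y := by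
  by_cases h : 0 < κ
  · have e : wK κ f = fun Y => -2 * Complex.I * uI κ f Y := by
      funext Y; unfold wK; rw [if_pos h]
    rw [e]
    refine ((uI_deriv h.le hf hM Y).const_mul (-2 * Complex.I)).congr_deriv ?_
    ring
  · have e : wK κ f = fun Y => 2 * Complex.I * uI (-κ) (fun s => f (-s)) (-Y) := by
      funext Y; unfold wK; rw [if_neg h]
    rw [e]
    have d := uI_deriv (κ := -κ) (by linarith) (hf.comp continuous_neg) (hMneg hM) (-Y)
    have d2 := HasDerivAt.scomp Y d (hasDerivAt_neg Y)
    refine (d2.const_mul (2 * Complex.I)).congr_deriv ?_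
    simp only [comp_apply, neg_neg, comp_def]
    push_cast
    rw [neg_smul, one_smul]
    ring

lemma wK_top (hf : Continuous f) (hM0 : 0 ≤ M) (hM : ∀ s, ‖f s‖ ≤ M * wt s) :
    Tendsto (wK κ f) atTop (𝓝 0) := by
  by_cases h : 0 < κ
  · have e : wK κ f = fun Y => -2 * Complex.I * uI κ f Y := by
      funext Y; unfold wK; rw [if_pos h]
    rw [e]
    simpa using (uI_top h hf hM0 hM).const_mul (-2 * Complex.I)
  · have e : wK κ f = fun Y => 2 * Complex.I * uI (-κ) (fun s => f (-s)) (-Y) := by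
      funext Y; unfold wK; rw [if_neg h]
    rw [e]
    have := (uI_bot (κ := -κ) (by linarith) hM0 (hf.comp continuous_neg) (hMneg hM)).comp
      tendsto_neg_atTop_atBot
    simpa [comp_def] using this.const_mul (2 * Complex.I)

lemma uI_add {g : ℝ → ℂ} {N : ℝ} (hκ : 0 ≤ κ) (hf : Continuous f) (hM : ∀ s, ‖f s‖ ≤ M * wt s)
    (hg : Continuous g) (hN : ∀ s, ‖g s‖ ≤ N * wt s) (Y : ℝ) :
    uI κ (fun s => f s + g s) Y = uI κ f Y + uI κ g Y := by
  unfold uI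
  rw [← integral_add (uI_int hκ hf hM Y) (uI_int hκ hg hN Y)]
  simp only [mul_add]

lemma uI_smul (c : ℂ) (Y : ℝ) : uI κ (fun s => c * f s) Y = c * uI κ f Y := by
  unfold uI
  rw [← integral_const_mul]
  congr 1; ext s; ring

lemma wK_add {g : ℝ → ℂ} {N : ℝ} (hf : Continuous f) (hM : ∀ s, ‖f s‖ ≤ M * wt s)
    (hg : Continuous g) (hN : ∀ s, ‖g s‖ ≤ N * wt s) (Y : ℝ) :
    wK κ (fun s => f s + g s) Y = wK κ f Y + wK κ g Y := by
  unfold wK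
  split_ifs with h
  · rw [uI_add h.le hf hM hg hN]; ring
  · have := uI_add (κ := -κ) (by linarith) (hf.comp continuous_neg) (hMneg hM)
      (hg.comp continuous_neg) (hMneg hN) (-Y)
    simp only [comp_def] at this ⊢
    rw [this]; ring

lemma wK_smul (c : ℂ) (Y : ℝ) : wK κ (fun s => c * f s) Y = c * wK κ f Y := by
  unfold wK
  split_ifs with h
  · rw [uI_smul]; ring
  · rw [uI_smul (f := fun s => f (-s))]; ring

end
end SQB

namespace SQB
open MeasureTheory Filter Topology

noncomputable abbrev Cb := BoundedContinuousFunction ℝ ℂ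
noncomputable abbrev E1 := lp (fun _ : ℤ => Cb) 1

lemma E1_hasSum (g : E1) : HasSum (fun k => ‖g k‖) ‖g‖ := by
  have := lp.hasSum_norm (p := 1) (by simp) g
  simpa using this

lemma E1_mem {f : ℤ → Cb} (h : Summable fun k => ‖f k‖) : Memℓp f 1 :=
  memℓp_gen (by simpa using h)

noncomputable def permOp (σ : ℤ ≃ ℤ) (T : ℤ → Cb →L[ℂ] Cb) (C : ℝ) (hT : ∀ k, ‖T k‖ ≤ C) :
    E1 →L[ℂ] E1 :=
  LinearMap.mkContinuous
    { toFun := fun g => ⟨fun k => T k (g (σ k)), E1_mem (by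
        have h1 : Summable fun k => C * ‖g (σ k)‖ :=
          ((σ.summable_iff (f := fun k => ‖g k‖)).2 (E1_hasSum g).summable).mul_left C
        refine Summable.of_nonneg_of_le (fun _ => norm_nonneg _) (fun k => ?_) h1
        exact (T k).le_of_opNorm_le (hT k) _)⟩
      map_add' := fun f g => Subtype.ext (funext fun k => (T k).map_add _ _)
      map_smul' := fun c g => Subtype.ext (funext fun k => (T k).map_smul c _) } C (fun g => by
        have h1 := ((σ.hasSum_iff (f := fun k => ‖g k‖)).2 (E1_hasSum g)).mul_left C
        refine hasSum_le (fun k => ?_) (E1_hasSum _) h1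
        exact (T k).le_of_opNorm_le (hT k) _)

lemma permOp_apply (σ : ℤ ≃ ℤ) (T : ℤ → Cb →L[ℂ] Cb) (C : ℝ) (hT : ∀ k, ‖T k‖ ≤ C) (g : E1)
    (k : ℤ) : permOp σ T C hT g k = T k (g (σ k)) := rfl

lemma permOp_norm (σ : ℤ ≃ ℤ) (T : ℤ → Cb →L[ℂ] Cb) (C : ℝ) (hC : 0 ≤ C) (hT : ∀ k, ‖T k‖ ≤ C) :
    ‖permOp σ T C hT‖ ≤ C := LinearMap.mkContinuous_norm_le _ hC _

lemma Ev_summable (α : ℝ) (τ : ℂ) {a : ℤ → Cb} (h : Summable fun k => ‖a k‖) :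
    Summable fun k : ℤ => a k τ.im * ee ((k * α * τ.re : ℝ)) := by
  refine Summable.of_norm_bounded h (fun k => ?_)
  rw [norm_mul, ee_norm_real, mul_one]
  exact BoundedContinuousFunction.norm_coe_le_norm _ _

/-- evaluation functional -/
noncomputable def Ev (α : ℝ) (τ : ℂ) : E1 →L[ℂ] ℂ :=
  LinearMap.mkContinuous
    { toFun := fun g => ∑' k : ℤ, g k τ.im * ee ((k * α * τ.re : ℝ))
      map_add' := fun f g => by
        rw [← Summable.tsum_add (Ev_summable α τ (E1_hasSum f).summable)
          (Ev_summable α τ (E1_hasSum g).summable)]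
        congr 1; ext k; simp [add_mul]
      map_smul' := fun c g => by
        rw [RingHom.id_apply, smul_eq_mul, ← tsum_mul_left]
        congr 1; ext k; simp [mul_assoc] } 1 (fun g => by
        rw [one_mul]
        refine tsum_of_norm_bounded (E1_hasSum g) (fun k => ?_)
        rw [norm_mul, ee_norm_real, mul_one]
        exact BoundedContinuousFunction.norm_coe_le_norm _ _)

lemma Ev_apply (α : ℝ) (τ : ℂ) (g : E1) :
    Ev α τ g = ∑' k : ℤ, g k τ.im * ee ((k * α * τ.re : ℝ)) := rfl

lemma Ev_norm (α : ℝ) (τ : ℂ) (g : E1) : ‖Ev α τ g‖ ≤ ‖g‖ := by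
  have := (Ev α τ).le_of_opNorm_le (LinearMap.mkContinuous_norm_le _ zero_le_one _) g
  simpa using this

noncomputable def msOp (a : Cb) (i : ℤ) : E1 →L[ℂ] E1 :=
  permOp (Equiv.subRight i) (fun _ => ContinuousLinearMap.mul ℂ Cb a) ‖a‖
    (fun _ => ContinuousLinearMap.opNorm_mul_apply_le ℂ Cb a)

lemma msOp_norm (a : Cb) (i : ℤ) : ‖msOp a i‖ ≤ ‖a‖ := permOp_norm _ _ _ (norm_nonneg _) _

lemma Ev_msOp (α : ℝ) (τ : ℂ) (a : Cb) (i : ℤ) (g : E1) :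
    Ev α τ (msOp a i g) = a τ.im * ee ((i * α * τ.re : ℝ)) * Ev α τ g := by
  rw [Ev_apply, Ev_apply, ← tsum_mul_left]
  rw [← (Equiv.addRight i).tsum_eq]
  congr 1; ext k
  rw [msOp, permOp_apply]
  simp only [Equiv.coe_addRight, Equiv.subRight_apply, add_sub_cancel_right,
    ContinuousLinearMap.mul_apply', BoundedContinuousFunction.coe_mul, Pi.mul_apply]
  have : (((k + i : ℤ) * α * τ.re : ℝ) : ℂ) = (i * α * τ.re : ℝ) + (k * α * τ.re : ℝ) := by
    push_cast; ring
  rw [this, ee_add]; ring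

lemma abs_conv {E : Type*} [NormedAddCommGroup E] [NormedSpace ℂ E] [CompleteSpace E]
    (m : ℤ → E →L[ℂ] E) (n : ℤ → ℝ) (h : Summable n) (hm : ∀ i, ‖m i‖ ≤ n i) :
    ‖∑' i, m i‖ ≤ ∑' i, n i ∧ ∀ g, HasSum (fun i => m i g) ((∑' i, m i) g) := by
  have hs : Summable m := Summable.of_norm_bounded h hm
  exact ⟨tsum_of_norm_bounded h.hasSum hm,
    fun g => (ContinuousLinearMap.apply ℂ E g).hasSum hs.hasSum⟩

lemma abs_neumann {E : Type*} [NormedAddCommGroup E] [NormedSpace ℂ E] [CompleteSpace E]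
    (N : E →L[ℂ] E) (hN : ‖N‖ ≤ 1/2) (b0 : E) : ∃ g, g = b0 + N g := by
  set U := Units.oneSub N (by linarith) with hU
  refine ⟨(↑U⁻¹ : E →L[ℂ] E) b0, ?_⟩
  have h1 : (U : E →L[ℂ] E) * (↑U⁻¹ : E →L[ℂ] E) = 1 := U.mul_inv
  have h2 := congrArg (fun T : E →L[ℂ] E => T b0) h1
  have h3 : (U : E →L[ℂ] E) = 1 - N := rfl
  rw [h3] at h2
  exact sub_eq_iff_eq_add.1 h2

lemma abs_comb {E : Type*} [NormedAddCommGroup E] [NormedSpace ℂ E] (B S A : E →L[ℂ] E)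
    (hB : ‖B‖ ≤ 1/1000) (hS : ‖S‖ ≤ 3) (hA : ‖A‖ ≤ 1/1000) : ‖B ∘L S - A‖ ≤ 1/2 := by
  refine (norm_sub_le _ _).trans ?_
  have h1 := ContinuousLinearMap.opNorm_comp_le B S
  have h4 : ‖B‖ * ‖S‖ ≤ (1/1000) * 3 := mul_le_mul hB hS (norm_nonneg _) (by norm_num)
  linarith

noncomputable def convOp (a : ℤ → Cb) : E1 →L[ℂ] E1 := ∑' i, msOp (a i) i

lemma conv_abs {a : ℤ → Cb} (h : Summable fun k => ‖a k‖) :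
    ‖convOp a‖ ≤ ∑' i, ‖a i‖ ∧ ∀ g : E1, HasSum (fun i => msOp (a i) i g) (convOp a g) :=
  abs_conv (E := E1) (fun i => msOp (a i) i) _ h (fun i => msOp_norm (a i) i)

lemma convOp_norm {a : ℤ → Cb} (h : Summable fun k => ‖a k‖) :
    ‖convOp a‖ ≤ ∑' k, ‖a k‖ := (conv_abs h).1

lemma Ev_conv (α : ℝ) (τ : ℂ) {a : ℤ → Cb} (h : Summable fun k => ‖a k‖) (g : E1) :
    Ev α τ (convOp a g) = (∑' i : ℤ, a i τ.im * ee ((i * α * τ.re : ℝ))) * Ev α τ g := by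
  have h2 := (Ev α τ).hasSum ((conv_abs h).2 g)
  rw [← h2.tsum_eq, ← tsum_mul_right]
  congr 1; ext i
  exact Ev_msOp α τ (a i) i g

lemma wtg_bd (g : Cb) (s : ℝ) : ‖(wt s : ℂ) * g s‖ ≤ ‖g‖ * wt s := by
  rw [norm_mul, Complex.norm_real, Real.norm_of_nonneg (wt_pos s).le, mul_comm]
  exact mul_le_mul_of_nonneg_right (BoundedContinuousFunction.norm_coe_le_norm _ _) (wt_pos s).le

lemma wtg_cont (g : Cb) : Continuous fun s => (wt s : ℂ) * g s :=
  (Complex.continuous_ofReal.comp wt_cont).mul g.continuous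

noncomputable def wg (κ : ℝ) (g : Cb) : ℝ → ℂ := wK κ (fun s => (wt s : ℂ) * g s)

noncomputable def sg (κ : ℝ) (g : Cb) (Y : ℝ) : ℂ := Complex.I * κ * wg κ g Y - (wt Y : ℂ) * g Y

lemma wg_cont (κ : ℝ) (g : Cb) : Continuous (wg κ g) :=
  continuous_iff_continuousAt.2 fun Y => (wK_deriv (wtg_cont g) (wtg_bd g) Y).continuousAt

lemma sg_cont (κ : ℝ) (g : Cb) : Continuous (sg κ g) := by
  have := wg_cont κ g
  have := wtg_cont g
  unfold sg; fun_prop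

lemma sg_norm (κ : ℝ) (g : Cb) (Y : ℝ) : ‖sg κ g Y‖ ≤ 3 * ‖g‖ := by
  have h1 := wK_norm2 (κ := κ) (norm_nonneg g) (wtg_bd g) Y
  have h2 := wtg_bd g Y
  have h3 := wt_le Y
  have h4 := norm_nonneg g
  unfold sg
  refine (norm_sub_le _ _).trans ?_
  rw [norm_mul, norm_mul, Complex.norm_I, one_mul, Complex.norm_real, Real.norm_eq_abs]
  unfold wg
  nlinarith

noncomputable def SOp (κ : ℝ) : Cb →L[ℂ] Cb :=
  LinearMap.mkContinuous
    { toFun := fun g => BoundedContinuousFunction.ofNormedAddCommGroup (sg κ g) (sg_cont κ g)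
        (3 * ‖g‖) (sg_norm κ g)
      map_add' := fun f g => by
        ext Y
        simp only [BoundedContinuousFunction.coe_ofNormedAddCommGroup,
          BoundedContinuousFunction.coe_add, Pi.add_apply, sg, wg]
        have : (fun s => (wt s : ℂ) * (f s + g s)) =
          fun s => (wt s : ℂ) * f s + (wt s : ℂ) * g s := by ext s; ring
        rw [this, wK_add (wtg_cont f) (wtg_bd f) (wtg_cont g) (wtg_bd g)]
        ring
      map_smul' := fun c g => by
        ext Y
        simp only [BoundedContinuousFunction.coe_ofNormedAddCommGroup,
          BoundedContinuousFunction.coe_smul, smul_eq_mul, sg, wg, RingHom.id_apply]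
        have : (fun s => (wt s : ℂ) * (c * g s)) =
          fun s => c * ((wt s : ℂ) * g s) := by ext s; ring
        rw [this, wK_smul]
        ring } 3 (fun g => by
          refine BoundedContinuousFunction.norm_ofNormedAddCommGroup_le _ (by positivity) (sg_norm κ g))

lemma SOp_apply (κ : ℝ) (g : Cb) (Y : ℝ) : SOp κ g Y = sg κ g Y := rfl

lemma SOp_norm (κ : ℝ) : ‖SOp κ‖ ≤ 3 := LinearMap.mkContinuous_norm_le _ (by norm_num) _

noncomputable def SS (α : ℝ) : E1 →L[ℂ] E1 :=
  permOp (Equiv.refl ℤ) (fun k => SOp (2 * Real.pi * k * α)) 3 (fun _ => SOp_norm _)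

lemma term_deriv (α : ℝ) (k : ℤ) (g : Cb) (τ : ℂ) :
    HasFDerivAt (𝕜 := ℝ) (fun τ : ℂ => wg (2 * Real.pi * k * α) g τ.im * ee ((k * α * τ.re : ℝ)))
      ((sg (2 * Real.pi * k * α) g τ.im * ee ((k * α * τ.re : ℝ))) • (1 : ℂ →L[ℝ] ℂ) +
        ((wt τ.im : ℂ) * g τ.im * ee ((k * α * τ.re : ℝ))) • (Complex.conjCLE : ℂ →L[ℝ] ℂ)) τ := by
  set κ := 2 * Real.pi * k * α with hκ
  have d1 := (wK_deriv (κ := κ) (wtg_cont g) (wtg_bd g) τ.im).hasFDerivAt.comp τ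
    Complex.imCLM.hasFDerivAt
  have d2 : HasDerivAt (fun x : ℝ => ee ((k * α * x : ℝ)))
      (Complex.I * κ * ee ((k * α * τ.re : ℝ))) τ.re := by
    have h1 : HasDerivAt (fun x : ℝ => 2 * Real.pi * Complex.I * ((k * α * x : ℝ) : ℂ))
        (2 * Real.pi * Complex.I * ((k * α * 1 : ℝ) : ℂ)) τ.re :=
      (((hasDerivAt_id τ.re).const_mul (k * α : ℝ)).ofReal_comp).const_mul _
    refine h1.cexp.congr_deriv ?_
    unfold ee
    rw [hκ]; push_cast; ring
  have d3 := d2.hasFDerivAt.comp τ Complex.reCLM.hasFDerivAt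
  have d4 := d1.mul d3
  refine d4.congr_fderiv ?_
  ext v
  simp only [sg, wg, add_apply, smul_apply,
    ContinuousLinearMap.comp_apply, comp_apply, Complex.imCLM_apply, Complex.reCLM_apply,
    ContinuousLinearMap.toSpanSingleton_apply, smul_eq_mul, one_apply_eq_self,
    ContinuousLinearEquiv.coe_coe, Complex.conjCLE_apply, Complex.real_smul]
  have hv : v = v.re + v.im * Complex.I := (Complex.re_add_im v).symm
  have hv2 : (starRingEnd ℂ) v = v.re - v.im * Complex.I := by
    apply Complex.ext <;> simp
  rw [hv2]
  generalize v.re = x at *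
  generalize v.im = y at *
  subst hv
  linear_combination (-(κ:ℂ) * y * ee ((k * α * τ.re : ℝ)) * wK κ (fun s => ↑(wt s) * g s) τ.im) * Complex.I_sq

theorem beltrami (α : ℝ) (hα : α ≠ 0) (a b : ℤ → Cb) (ha : Summable fun k => ‖a k‖)
    (hb : Summable fun k => ‖b k‖) (hA : ∑' k, ‖a k‖ ≤ 1/1000) (hB : ∑' k, ‖b k‖ ≤ 1/1000) :
    ∃ w P Q : ℂ → ℂ,
      (∀ τ, HasFDerivAt (𝕜 := ℝ) w (P τ • (1 : ℂ →L[ℝ] ℂ) + Q τ • (Complex.conjCLE : ℂ →L[ℝ] ℂ)) τ) ∧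
      (∀ τ, (1 + ∑' k : ℤ, a k τ.im * ee ((k * α * τ.re : ℝ))) * Q τ =
        wt τ.im * (∑' k : ℤ, b k τ.im * ee ((k * α * τ.re : ℝ))) * P τ) ∧
      (∀ τ, ‖P τ - 1‖ ≤ 1/50) ∧ (∀ τ, ‖Q τ‖ ≤ 1/50) ∧ (∀ τ, ‖w τ - τ‖ ≤ 1/50) ∧
      (∀ τ, w (τ + (1/α : ℝ)) = w τ + (1/α : ℝ)) ∧
      Tendsto (fun τ => w τ - τ) (comap Complex.im atTop) (𝓝 0) := by
  set N : E1 →L[ℂ] E1 := convOp b ∘L SS α - convOp a with hN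
  have hSS : ‖SS α‖ ≤ 3 := permOp_norm _ _ _ (by norm_num) _
  have hNn : ‖N‖ ≤ 1/2 := abs_comb _ _ _ ((convOp_norm hb).trans hB) hSS ((convOp_norm ha).trans hA)
  set b0 : E1 := ⟨b, E1_mem hb⟩ with hb0
  have hb0k : ∀ k, b0 k = b k := fun k => rfl
  have hb0n : ‖b0‖ ≤ 1/1000 := by
    rw [← (E1_hasSum b0).tsum_eq]; exact hB
  obtain ⟨g, hg⟩ : ∃ g : E1, g = b0 + N g := abs_neumann N hNn b0
  have hgn : ‖g‖ ≤ 1/500 := by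
    have h1 : ‖g‖ ≤ ‖b0‖ + ‖N g‖ := by
      conv_lhs => rw [hg]
      exact norm_add_le _ _
    have h2 := N.le_of_opNorm_le hNn g
    linarith
  have hgs := E1_hasSum g
  set P : ℂ → ℂ := fun τ => 1 + Ev α τ (SS α g) with hP
  set Q : ℂ → ℂ := fun τ => wt τ.im * Ev α τ g with hQ
  set W : ℤ → ℂ → ℂ := fun k τ => wg (2 * Real.pi * k * α) (g k) τ.im * ee ((k * α * τ.re : ℝ)) with hW
  have hWn : ∀ k τ, ‖W k τ‖ ≤ 2 * Real.pi * ‖g k‖ := by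
    intro k τ
    simp only [hW]
    rw [norm_mul, ee_norm_real, mul_one]
    exact wK_norm (wtg_cont (g k)) (norm_nonneg _) (wtg_bd (g k)) _
  have hsum : Summable fun k => 2 * Real.pi * ‖g k‖ := hgs.summable.mul_left _
  set w : ℂ → ℂ := fun τ => τ + ∑' k, W k τ with hw
  have hSk : ∀ k, SS α g k = SOp (2 * Real.pi * k * α) (g k) := fun k => rfl
  refine ⟨w, P, Q, ?_, ?_, ?_, ?_, ?_, ?_, ?_⟩
  · intro τ
    set p : ℤ → ℂ := fun k => sg (2 * Real.pi * k * α) (g k) τ.im * ee ((k * α * τ.re : ℝ)) with hp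
    set q : ℤ → ℂ := fun k => (wt τ.im : ℂ) * g k τ.im * ee ((k * α * τ.re : ℝ)) with hq
    have hps : Summable p := by
      have := Ev_summable α τ (E1_hasSum (SS α g)).summable
      exact this
    have hqs : Summable q := by
      have := (Ev_summable α τ (E1_hasSum g).summable).mul_left (wt τ.im : ℂ)
      refine this.congr fun k => ?_
      simp only [hq]; ring
    have d := hasFDerivAt_tsum (𝕜 := ℝ) (f := W) (x₀ := 0) (hgs.summable.mul_left 4)
      (fun k τ => term_deriv α k (g k) τ) ?_ ?_ τ
    · have d2 := (hasFDerivAt_id (𝕜 := ℝ) τ).add d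
      refine d2.congr_fderiv ?_
      rw [Summable.tsum_add (hps.smul_const _) (hqs.smul_const _), hps.tsum_smul_const,
        hqs.tsum_smul_const]
      have e1 : P τ = 1 + ∑' k, p k := by
        simp only [hP, hp, Ev_apply]; rfl
      have e2 : Q τ = ∑' k, q k := by
        simp only [hQ, hq, Ev_apply]
        rw [← tsum_mul_left]
        congr 1; ext k; ring
      rw [e1, e2]
      ext v
      simp only [add_apply, smul_apply, smul_eq_mul]
      change v + _ = (1 + _) * v + _
      rw [add_mul, one_mul, add_assoc]
      rfl
    · intro k τ
      have n1 : ‖(1 : ℂ →L[ℝ] ℂ)‖ ≤ 1 := ContinuousLinearMap.norm_id_le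
      have n2 : ‖(Complex.conjCLE : ℂ →L[ℝ] ℂ)‖ ≤ 1 := by rw [Complex.conjCLE_norm]
      refine (norm_add_le _ _).trans ?_
      rw [norm_smul, norm_smul, norm_mul, norm_mul (_ * _), ee_norm_real, mul_one, mul_one]
      have h1 := sg_norm (2 * Real.pi * k * α) (g k) τ.im
      have h2 := wtg_bd (g k) τ.im
      have h3 := wt_le τ.im
      have h4 := norm_nonneg (g k)
      have h5 := mul_le_mul h1 n1 (norm_nonneg _) (by positivity)
      have h6 := mul_le_mul h2 n2 (norm_nonneg _) (mul_nonneg h4 (wt_pos _).le)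
      nlinarith
    · exact Summable.of_norm_bounded hsum (fun k => hWn k 0)
  · intro τ
    have h1 : Ev α τ g = Ev α τ b0 + ((∑' k : ℤ, b k τ.im * ee ((k * α * τ.re : ℝ))) *
        Ev α τ (SS α g) - (∑' k : ℤ, a k τ.im * ee ((k * α * τ.re : ℝ))) * Ev α τ g) := by
      conv_lhs => rw [hg]
      rw [map_add, hN, sub_apply, map_sub, ContinuousLinearMap.comp_apply,
        Ev_conv α τ hb, Ev_conv α τ ha]
    have h2 : Ev α τ b0 = ∑' k : ℤ, b k τ.im * ee ((k * α * τ.re : ℝ)) := rfl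
    rw [h2] at h1
    simp only [hP, hQ]
    linear_combination (wt τ.im : ℂ) * h1
  · intro τ
    simp only [hP]
    rw [add_sub_cancel_left]
    have h1 := Ev_norm α τ (SS α g)
    have h2 := (SS α).le_of_opNorm_le hSS g
    linarith
  · intro τ
    simp only [hQ]
    rw [norm_mul, Complex.norm_real, Real.norm_of_nonneg (wt_pos _).le]
    have h1 := Ev_norm α τ g
    have h2 := wt_le τ.im
    have h3 := wt_pos τ.im
    have h4 := norm_nonneg (Ev α τ g)
    nlinarith
  · intro τ
    simp only [hw]
    rw [add_sub_cancel_left]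
    have h1 := tsum_of_norm_bounded (hgs.mul_left (2 * Real.pi)) (fun k => hWn k τ)
    have := Real.pi_lt_d2
    have := Real.pi_pos
    have h4 := norm_nonneg g
    nlinarith
  · intro τ
    simp only [hw]
    have : ∀ k, W k (τ + (1/α : ℝ)) = W k τ := by
      intro k
      simp only [hW]
      congr 1
      · simp
      · have : ((k * α * (τ + (1/α : ℝ)).re : ℝ) : ℂ) = ((k * α * τ.re : ℝ) : ℂ) + k := by
          have e : (k * α * (τ + (1/α : ℝ)).re : ℝ) = k * α * τ.re + k := by
            rw [Complex.add_re, Complex.ofReal_re]; field_simp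
          rw [e]; push_cast; ring
        rw [this, ee_add_int]
    simp only [this]; ring
  · have e : (fun τ => w τ - τ) = fun τ => ∑' k, W k τ := by
      funext τ; simp only [hw]; ring
    rw [e, show (0:ℂ) = ∑' _ : ℤ, (0:ℂ) by simp]
    refine tendsto_tsum_of_dominated_convergence hsum (fun k => ?_)
      (Eventually.of_forall fun τ k => hWn k τ)
    rw [tendsto_zero_iff_norm_tendsto_zero]
    have h1 := ((wK_top (κ := 2 * Real.pi * k * α) (wtg_cont (g k)) (norm_nonneg _)
      (wtg_bd (g k))).comp (tendsto_comap (f := Complex.im) (x := atTop))).norm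
    rw [norm_zero] at h1
    refine h1.congr fun τ => ?_
    simp only [hW]
    rw [norm_mul, ee_norm_real, mul_one]; rfl

end SQB

namespace SQB
open MeasureTheory Filter Topology

lemma sum_sq_bd (ω : ℝ) (hω : 2 < ω) (N : ℕ) :
    ∑ n ∈ Finset.range N, 1 / (ω + n) ^ 2 ≤ 1 / (ω - 1) := by
  have : ∑ n ∈ Finset.range N, 1 / (ω + n) ^ 2 ≤ 1 / (ω - 1) - 1 / (ω + N - 1) := by
    induction N with
    | zero => simp
    | succ N ih =>
      rw [Finset.sum_range_succ]
      have h1 : (0:ℝ) ≤ N := Nat.cast_nonneg N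
      have : 1 / (ω + N) ^ 2 ≤ 1 / (ω + N - 1) - 1 / (ω + (N + 1 : ℕ) - 1) := by
        push_cast
        have e : 1 / (ω + N - 1) - 1 / (ω + (N + 1) - 1) = 1 / ((ω + N - 1) * (ω + N)) := by
          have : ω + N - 1 ≠ 0 := by linarith
          have : ω + N ≠ 0 := by linarith
          have : ω + (N + 1) - 1 ≠ 0 := by linarith
          field_simp; ring
        rw [e]
        apply one_div_le_one_div_of_le
        · apply mul_pos <;> linarith
        · nlinarith
      linarith
  refine this.trans ?_
  have : 0 ≤ 1 / (ω + N - 1) := by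
    have h1 : (0:ℝ) ≤ N := Nat.cast_nonneg N
    apply div_nonneg <;> linarith
  linarith

lemma sum_int_bd (ω M : ℝ) (hω : 2 < ω) (hM : 0 ≤ M) (f : ℤ → ℝ) (h0 : ∀ k, 0 ≤ f k)
    (hf : ∀ k, f k ≤ 4 * M * ω / (ω + |(k:ℝ)|) ^ 2) : Summable f ∧ ∑' k, f k ≤ 16 * M := by
  have key : ∀ g : ℕ → ℝ, (∀ n, 0 ≤ g n) → (∀ n, g n ≤ 4 * M * ω / (ω + n)^2) →
      Summable g ∧ ∑' n, g n ≤ 8 * M := by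
    intro g g0 hg
    have hb : ∀ N, ∑ n ∈ Finset.range N, g n ≤ 8 * M := by
      intro N
      have h1 : ∑ n ∈ Finset.range N, g n ≤ ∑ n ∈ Finset.range N, 4 * M * ω * (1 / (ω + n)^2) :=
        Finset.sum_le_sum fun n _ => by rw [mul_one_div]; exact hg n
      rw [← Finset.mul_sum] at h1
      have h2 := sum_sq_bd ω hω N
      have h3 : 4 * M * ω * ∑ n ∈ Finset.range N, 1 / (ω + n) ^ 2 ≤ 4 * M * ω * (1 / (ω - 1)) :=
        mul_le_mul_of_nonneg_left h2 (by positivity)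
      have h4 : ω * (1 / (ω - 1)) ≤ 2 := by
        rw [mul_one_div, div_le_iff₀ (by linarith)]; linarith
      have h5 := mul_le_mul_of_nonneg_left h4 (show 0 ≤ 4 * M by linarith)
      linarith
    exact ⟨summable_of_sum_range_le g0 hb, Real.tsum_le_of_sum_range_le g0 hb⟩
  obtain ⟨s1, b1⟩ := key (fun n => f n) (fun n => h0 _) (fun n => by
    have := hf n
    simpa using this)
  obtain ⟨s2, b2⟩ := key (fun n => f (-(n + 1))) (fun n => h0 _) (fun n => by
    refine (hf _).trans ?_
    have : |((-((n:ℤ) + 1) : ℤ) : ℝ)| = n + 1 := by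
      push_cast; rw [abs_neg, abs_of_nonneg (by positivity)]
    rw [this]
    gcongr
    linarith)
  have := s1.hasSum.of_nat_of_neg_add_one s2.hasSum
  refine ⟨this.summable, ?_⟩
  rw [this.tsum_eq]; linarith

lemma ibp_two (κ : ℂ) (f f1 f2 : ℝ → ℂ) (h1 : ∀ x, HasDerivAt f (f1 x) x)
    (h2 : ∀ x, HasDerivAt f1 (f2 x) x) (hc : Continuous f2) (a : f 0 = 0) (b : f 1 = 0)
    (a' : f1 0 = 0) (b' : f1 1 = 0) :
    ∫ x in (0:ℝ)..1, f2 x * Complex.exp (κ * x) = κ ^ 2 * ∫ x in (0:ℝ)..1, f x * Complex.exp (κ * x) := by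
  have he : ∀ x : ℝ, HasDerivAt (fun x : ℝ => Complex.exp (κ * x)) (κ * Complex.exp (κ * x)) x := by
    intro x
    have : HasDerivAt (fun x : ℝ => κ * (x : ℂ)) (κ * 1) x :=
      (Complex.ofRealCLM.hasDerivAt (x := x)).const_mul κ
    refine this.cexp.congr_deriv ?_
    ring
  have ce : Continuous fun x : ℝ => Complex.exp (κ * x) := by fun_prop
  have cf : Continuous f := continuous_iff_continuousAt.2 fun x => (h1 x).continuousAt
  have cf1 : Continuous f1 := continuous_iff_continuousAt.2 fun x => (h2 x).continuousAt
  have step : ∀ g g' : ℝ → ℂ, (∀ x, HasDerivAt g (g' x) x) → Continuous g' → g 0 = 0 → g 1 = 0 →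
      ∫ x in (0:ℝ)..1, g' x * Complex.exp (κ * x) = -κ * ∫ x in (0:ℝ)..1, g x * Complex.exp (κ * x) := by
    intro g g' hg cg' g0 g1
    have := intervalIntegral.integral_mul_deriv_eq_deriv_mul (a := 0) (b := 1) (u := g) (u' := g')
      (v := fun x : ℝ => Complex.exp (κ * x)) (v' := fun x : ℝ => κ * Complex.exp (κ * x))
      (fun x _ => hg x) (fun x _ => he x)
      (cg'.intervalIntegrable _ _) ((continuous_const.mul ce).intervalIntegrable _ _)
    rw [g0, g1] at this
    have e : ∫ x in (0:ℝ)..1, g x * (κ * Complex.exp (κ * x)) =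
        κ * ∫ x in (0:ℝ)..1, g x * Complex.exp (κ * x) := by
      rw [← intervalIntegral.integral_const_mul]
      congr 1; ext x; ring
    rw [e] at this
    linear_combination this
  rw [step f1 f2 h2 hc a' b', step f f1 h1 cf1 a b]
  ring

noncomputable def fc (α : ℝ) (F : ℝ → ℝ → ℂ) (k : ℤ) (Y : ℝ) : ℂ :=
  α * ∫ x in (0:ℝ)..1, F Y x * Complex.exp ((-(2 * Real.pi * Complex.I * k * α)) * x)

lemma fc_bd (α : ℝ) (h0 : 0 < α) (F : ℝ → ℝ → ℂ) (F1 F2 : ℝ → ℂ) (k : ℤ) (Y M : ℝ)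
    (h1 : ∀ x, HasDerivAt (F Y) (F1 x) x)
    (h2 : ∀ x, HasDerivAt F1 (F2 x) x) (hc : Continuous F2) (a : F Y 0 = 0) (b : F Y 1 = 0)
    (a' : F1 0 = 0) (b' : F1 1 = 0) (hM : ∀ x, ‖F Y x‖ ≤ M) (hM2 : ∀ x, ‖F2 x‖ ≤ M) :
    ‖fc α F k Y‖ ≤ 4 * M * (1/α) / (1/α + |(k:ℝ)|) ^ 2 := by
  have hM0 : 0 ≤ M := (norm_nonneg _).trans (hM 0)
  set κ : ℂ := -(2 * Real.pi * Complex.I * k * α) with hκ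
  have ne : ∀ x : ℝ, ‖Complex.exp (κ * x)‖ = 1 := by
    intro x
    have : κ * x = ((-(2 * Real.pi * k * α * x) : ℝ) : ℂ) * Complex.I := by
      rw [hκ]; push_cast; ring
    rw [this, Complex.norm_exp_ofReal_mul_I]
  have bI : ∀ g : ℝ → ℂ, (∀ x, ‖g x‖ ≤ M) → ‖∫ x in (0:ℝ)..1, g x * Complex.exp (κ * x)‖ ≤ M := by
    intro g hg
    have := intervalIntegral.norm_integral_le_of_norm_le_const (a := 0) (b := 1) (C := M)
      (f := fun x => g x * Complex.exp (κ * x)) (fun x _ => by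
        rw [norm_mul, ne, mul_one]; exact hg x)
    simpa using this
  set J := ∫ x in (0:ℝ)..1, F Y x * Complex.exp (κ * x) with hJ
  have e1 : ‖fc α F k Y‖ = α * ‖J‖ := by
    unfold fc; rw [norm_mul, Complex.norm_real, Real.norm_of_nonneg h0.le]
  rw [e1]
  have b1 : ‖J‖ ≤ M := bI _ hM
  have b2 := bI _ hM2
  rw [ibp_two κ (F Y) F1 F2 h1 h2 hc a b a' b', norm_mul, norm_pow] at b2
  have nk : ‖κ‖ = 2 * Real.pi * |(k:ℝ)| * α := by
    rw [hκ, norm_neg]; simp [abs_of_pos Real.pi_pos, abs_of_pos h0]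
  rw [nk] at b2
  change (2 * Real.pi * |(k:ℝ)| * α)^2 * ‖J‖ ≤ M at b2
  set m := |(k:ℝ)| with hm
  have hm0 : 0 ≤ m := abs_nonneg _
  have e2 : 4 * M * (1/α) / (1/α + m)^2 = 4 * M * α / (1 + m * α)^2 := by
    field_simp
  rw [e2, le_div_iff₀ (by positivity)]
  have hJ0 := norm_nonneg J
  have hpi := Real.pi_gt_three
  have b3 : (m * α)^2 * ‖J‖ ≤ M := by
    refine le_trans ?_ b2
    apply mul_le_mul_of_nonneg_right _ hJ0
    apply pow_le_pow_left₀ (by positivity)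
    have : 0 ≤ m * α := by positivity
    nlinarith
  have : ‖J‖ * (1 + m * α)^2 ≤ 4 * M := by
    nlinarith [mul_nonneg hJ0 (sq_nonneg (1 - m * α))]
  nlinarith

lemma fc_cont (α : ℝ) (F : ℝ → ℝ → ℂ) (k : ℤ) (hF : Continuous (uncurry F)) :
    Continuous (fc α F k) := by
  unfold fc
  refine continuous_const.mul ?_
  apply intervalIntegral.continuous_parametric_intervalIntegral_of_continuous'
  have : Continuous fun p : ℝ × ℝ => uncurry F p * Complex.exp ((-(2 * Real.pi * Complex.I * k * α)) * p.2) := by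
    fun_prop
  exact this

lemma fc_inv (α : ℝ) (h0 : 0 < α) (h2 : α < 1/2) (f : ℝ → ℂ) (hf : Continuous f)
    (z0 : ∀ x, x ≤ 0 → f x = 0) (z1 : ∀ x, 1 ≤ x → f x = 0)
    (hs : Summable fun k => ‖fc α (fun _ => f) k 0‖) (X : ℝ) (hX0 : 0 ≤ X) (hX : X < 1/α) :
    ∑' k : ℤ, fc α (fun _ => f) k 0 * ee ((k * α * X : ℝ)) = f X := by
  have hω : 1 < 1/α := by rw [lt_div_iff₀ h0]; linarith
  have : Fact (0 < 1/α) := ⟨by linarith⟩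
  set g : C(AddCircle (1/α), ℂ) := ⟨AddCircle.liftIco (1/α) 0 f,
    AddCircle.liftIco_continuous (by rw [z0 0 le_rfl, zero_add, z1 _ hω.le]) hf.continuousOn⟩ with hg
  have hc : ∀ k, fourierCoeff g k = fc α (fun _ => f) k 0 := by
    intro k
    change fourierCoeff (AddCircle.liftIco (1/α) 0 f) k = _
    rw [fourierCoeff_liftIco_eq, fourierCoeffOn_eq_integral]
    unfold fc
    have e : ∀ x : ℝ, fourier (-k) (x : AddCircle (0 + 1/α - 0)) • f x =
        f x * Complex.exp ((-(2 * Real.pi * Complex.I * k * α)) * x) := by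
      intro x
      rw [fourier_coe_apply, smul_eq_mul, mul_comm]
      congr 2
      push_cast
      have : (α:ℂ) ≠ 0 := by exact_mod_cast h0.ne'
      field_simp
      ring
    simp only [e]
    have hi : ∀ a b : ℝ, IntervalIntegrable (fun x : ℝ =>
        f x * Complex.exp ((-(2 * Real.pi * Complex.I * k * α)) * x)) volume a b := by
      intro a b
      apply Continuous.intervalIntegrable; fun_prop
    rw [← intervalIntegral.integral_add_adjacent_intervals (hi 0 1) (hi 1 (0 + 1/α))]
    have : ∫ x in (1:ℝ)..(0 + 1/α), f x * Complex.exp ((-(2 * Real.pi * Complex.I * k * α)) * x) = 0 := by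
      rw [intervalIntegral.integral_congr (g := fun _ => 0)]
      · simp
      · intro x hx
        rw [uIcc_of_le (by linarith)] at hx
        simp only
        rw [z1 x hx.1, zero_mul]
    rw [this, add_zero, Complex.real_smul]
    congr 1
    push_cast
    simp
  have hsum : Summable (fourierCoeff g) := by
    have : fourierCoeff g = fun k => fc α (fun _ => f) k 0 := funext hc
    rw [this]
    exact hs.of_norm
  have h := has_pointwise_sum_fourier_series_of_summable hsum (X : AddCircle (1/α))
  have e : g (X : AddCircle (1/α)) = f X :=
    AddCircle.liftIco_coe_apply ⟨hX0, by rw [zero_add]; exact hX⟩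
  rw [e] at h
  rw [← h.tsum_eq]
  congr 1; ext k
  rw [hc, smul_eq_mul, fourier_coe_apply]
  congr 1
  unfold ee
  congr 1
  push_cast
  have : (α:ℂ) ≠ 0 := by exact_mod_cast h0.ne'
  field_simp

theorem fourier_data (α : ℝ) (h0 : 0 < α) (h2 : α < 1/2) (F F1 F2 : ℝ → ℝ → ℂ) (M : ℝ)
    (hF : Continuous (uncurry F)) (d1 : ∀ Y x, HasDerivAt (F Y) (F1 Y x) x)
    (d2 : ∀ Y x, HasDerivAt (F1 Y) (F2 Y x) x) (hc : ∀ Y, Continuous (F2 Y))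
    (z : ∀ Y x, x ≤ 0 ∨ 1 ≤ x → F Y x = 0) (z1 : ∀ Y x, x ≤ 0 ∨ 1 ≤ x → F1 Y x = 0)
    (hM : ∀ Y x, ‖F Y x‖ ≤ M) (hM2 : ∀ Y x, ‖F2 Y x‖ ≤ M) :
    ∃ c : ℤ → Cb, (Summable fun k => ‖c k‖) ∧ ∑' k, ‖c k‖ ≤ 16 * M ∧
      ∀ Y X, 0 ≤ X → X < 1/α → ∑' k : ℤ, c k Y * ee ((k * α * X : ℝ)) = F Y X := by
  have hM0 : 0 ≤ M := (norm_nonneg _).trans (hM 0 0)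
  have hω : 2 < 1/α := by rw [lt_div_iff₀ h0]; linarith
  have bd : ∀ k Y, ‖fc α F k Y‖ ≤ 4 * M * (1/α) / (1/α + |(k:ℝ)|) ^ 2 := fun k Y =>
    fc_bd α h0 F (F1 Y) (F2 Y) k Y M (d1 Y) (d2 Y) (hc Y) (z Y 0 (by simp)) (z Y 1 (by simp))
      (z1 Y 0 (by simp)) (z1 Y 1 (by simp)) (hM Y) (hM2 Y)
  set c : ℤ → Cb := fun k => BoundedContinuousFunction.ofNormedAddCommGroup (fc α F k)
    (fc_cont α F k hF) _ (bd k) with hcdef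
  have hck : ∀ k Y, c k Y = fc α F k Y := fun _ _ => rfl
  have bdc : ∀ k, ‖c k‖ ≤ 4 * M * (1/α) / (1/α + |(k:ℝ)|) ^ 2 := fun k =>
    BoundedContinuousFunction.norm_ofNormedAddCommGroup_le _ (by positivity) (bd k)
  obtain ⟨s, b⟩ := sum_int_bd (1/α) M hω hM0 (fun k => ‖c k‖) (fun _ => norm_nonneg _) bdc
  refine ⟨c, s, b, fun Y X hX0 hX => ?_⟩
  have e : ∀ k, fc α (fun _ => F Y) k 0 = c k Y := fun _ => rfl
  have := fc_inv α h0 h2 (F Y) (continuous_iff_continuousAt.2 fun x => (d1 Y x).continuousAt)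
    (fun x hx => z Y x (Or.inl hx)) (fun x hx => z Y x (Or.inr hx)) (by
      refine Summable.of_nonneg_of_le (fun _ => norm_nonneg _) (fun k => ?_) s
      rw [e]
      exact BoundedContinuousFunction.norm_coe_le_norm _ _) X hX0 hX
  simpa only [e] using this

end SQB

namespace SQB
open MeasureTheory Filter Topology

noncomputable def rho (x : ℝ) : ℝ := Real.smoothTransition (2 * x)
noncomputable def rho1 : ℝ → ℝ := deriv rho
noncomputable def rho2 : ℝ → ℝ := deriv rho1
noncomputable def rho3 : ℝ → ℝ := deriv rho2

lemma rho_smooth : ContDiff ℝ 4 rho := by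
  unfold rho
  have := Real.smoothTransition.contDiff (n := 4)
  exact this.comp (contDiff_const.mul contDiff_id)

lemma rho1_smooth : ContDiff ℝ 3 rho1 :=
  (contDiff_succ_iff_deriv (n := 3).1 (by exact_mod_cast rho_smooth)).2.2

lemma rho2_smooth : ContDiff ℝ 2 rho2 :=
  (contDiff_succ_iff_deriv (n := 2).1 (by exact_mod_cast rho1_smooth)).2.2

lemma rho3_smooth : ContDiff ℝ 1 rho3 :=
  (contDiff_succ_iff_deriv (n := 1).1 (by exact_mod_cast rho2_smooth)).2.2

lemma rho_d (x : ℝ) : HasDerivAt rho (rho1 x) x :=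
  (rho_smooth.differentiable (by simp) x).hasDerivAt
lemma rho1_d (x : ℝ) : HasDerivAt rho1 (rho2 x) x :=
  (rho1_smooth.differentiable (by simp) x).hasDerivAt
lemma rho2_d (x : ℝ) : HasDerivAt rho2 (rho3 x) x :=
  (rho2_smooth.differentiable (by simp) x).hasDerivAt

lemma rho_zero {x : ℝ} (h : x ≤ 0) : rho x = 0 :=
  Real.smoothTransition.zero_of_nonpos (by linarith)
lemma rho_one {x : ℝ} (h : 1/2 ≤ x) : rho x = 1 :=
  Real.smoothTransition.one_of_one_le (by linarith)
lemma rho_nonneg (x : ℝ) : 0 ≤ rho x := Real.smoothTransition.nonneg _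
lemma rho_le (x : ℝ) : rho x ≤ 1 := Real.smoothTransition.le_one _

lemma deriv_vanish {f f' : ℝ → ℝ} {c d : ℝ} (hd : ∀ x, HasDerivAt f (f' x) x) (hc : Continuous f')
    (h0 : ∀ x, x ≤ 0 → f x = c) (h1 : ∀ x, 1/2 ≤ x → f x = d) :
    (∀ x, x ≤ 0 ∨ 1/2 ≤ x → f' x = 0) := by
  have cl : IsClosed {x | f' x = 0} := isClosed_eq hc continuous_const
  rintro x (hx | hx)
  · have : Iio (0:ℝ) ⊆ {x | f' x = 0} := by
      intro u hu
      have h : f =ᶠ[𝓝 u] fun _ => c := by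
        filter_upwards [Iio_mem_nhds hu] with v hv using h0 v hv.le
      exact (hd u).unique ((hasDerivAt_const u c).congr_of_eventuallyEq h)
    have := closure_minimal this cl
    rw [closure_Iio] at this
    exact this hx
  · have : Ioi (1/2:ℝ) ⊆ {x | f' x = 0} := by
      intro u hu
      have h : f =ᶠ[𝓝 u] fun _ => d := by
        filter_upwards [Ioi_mem_nhds hu] with v hv using h1 v (le_of_lt hv)
      exact (hd u).unique ((hasDerivAt_const u d).congr_of_eventuallyEq h)
    have := closure_minimal this cl
    rw [closure_Ioi] at this
    exact this hx

lemma rho1_zero : ∀ x, x ≤ 0 ∨ 1/2 ≤ x → rho1 x = 0 :=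
  deriv_vanish rho_d rho1_smooth.continuous (fun _ => rho_zero) (fun _ => rho_one)
lemma rho2_zero : ∀ x, x ≤ 0 ∨ 1/2 ≤ x → rho2 x = 0 :=
  deriv_vanish rho1_d rho2_smooth.continuous (fun x h => rho1_zero x (Or.inl h))
    (fun x h => rho1_zero x (Or.inr h))
lemma rho3_zero : ∀ x, x ≤ 0 ∨ 1/2 ≤ x → rho3 x = 0 :=
  deriv_vanish rho2_d rho3_smooth.continuous (fun x h => rho2_zero x (Or.inl h))
    (fun x h => rho2_zero x (Or.inr h))

lemma bdd_of_vanish {f : ℝ → ℝ} (hc : Continuous f) (h : ∀ x, x ≤ 0 ∨ 1/2 ≤ x → f x = 0) :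
    ∃ R : ℝ, ∀ x, |f x| ≤ R := by
  obtain ⟨R, hR⟩ := isCompact_Icc.exists_bound_of_continuousOn (s := Icc (0:ℝ) (1/2)) hc.continuousOn
  refine ⟨R, fun x => ?_⟩
  by_cases hx : x ∈ Icc (0:ℝ) (1/2)
  · exact hR x hx
  · rw [h x, abs_zero]
    · exact (norm_nonneg _).trans (hR 0 (by norm_num))
    · rw [mem_Icc, not_and_or] at hx
      rcases hx with hx | hx
      · left; linarith
      · right; linarith

lemma rho_bd_ex : ∃ R : ℝ, 1 ≤ R ∧ ∀ x, |rho1 x| ≤ R ∧ |rho2 x| ≤ R ∧ |rho3 x| ≤ R := by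
  obtain ⟨a, ha⟩ := bdd_of_vanish rho1_smooth.continuous rho1_zero
  obtain ⟨b, hb⟩ := bdd_of_vanish rho2_smooth.continuous rho2_zero
  obtain ⟨c, hc⟩ := bdd_of_vanish rho3_smooth.continuous rho3_zero
  refine ⟨max 1 (max a (max b c)), le_max_left _ _, fun x => ⟨(ha x).trans ?_, (hb x).trans ?_, (hc x).trans ?_⟩⟩ <;> simp

noncomputable def RR : ℝ := rho_bd_ex.choose
lemma RR_one : 1 ≤ RR := rho_bd_ex.choose_spec.1
lemma rho1_bd (x : ℝ) : |rho1 x| ≤ RR := (rho_bd_ex.choose_spec.2 x).1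
lemma rho2_bd (x : ℝ) : |rho2 x| ≤ RR := (rho_bd_ex.choose_spec.2 x).2.1
lemma rho3_bd (x : ℝ) : |rho3 x| ≤ RR := (rho_bd_ex.choose_spec.2 x).2.2

/-- the smallness constant -/
noncomputable def del : ℝ := 1 / (1000000 * RR)
lemma del_pos : 0 < del := by unfold del; have := RR_one; positivity
lemma del_RR : del * RR = 1 / 1000000 := by
  unfold del; have := RR_one; field_simp
lemma del_le : del ≤ 1 / 1000000 := by
  rw [← del_RR]; have := del_pos; have := RR_one; nlinarith

structure YD (y y1 y2 y3 : ℂ → ℂ) : Prop where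
  d0 : ∀ τ : ℂ, -1 < τ.im → HasDerivAt y (y1 τ) τ
  d1 : ∀ τ : ℂ, -1 < τ.im → HasDerivAt y1 (y2 τ) τ
  d2 : ∀ τ : ℂ, -1 < τ.im → HasDerivAt y2 (y3 τ) τ
  c3 : ContinuousOn y3 {τ | -1 < τ.im}
  per : ∀ τ, y (τ + 1) = y τ
  b0 : ∀ τ : ℂ, 0 ≤ τ.im → ‖y τ‖ ≤ del * wt τ.im
  b1 : ∀ τ : ℂ, 0 ≤ τ.im → ‖y1 τ‖ ≤ del * wt τ.im
  b2 : ∀ τ : ℂ, 0 ≤ τ.im → ‖y2 τ‖ ≤ del * wt τ.im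
  b3 : ∀ τ : ℂ, 0 ≤ τ.im → ‖y3 τ‖ ≤ del * wt τ.im

/-- the point `X + i max(Y,0)` -/
noncomputable def pt (Y X : ℝ) : ℂ := X + (max Y 0 : ℝ) * Complex.I
lemma pt_im (Y X : ℝ) : (pt Y X).im = max Y 0 := by simp [pt]
lemma pt_re (Y X : ℝ) : (pt Y X).re = X := by simp [pt]
lemma pt_cont : Continuous fun p : ℝ × ℝ => pt p.1 p.2 := by unfold pt; fun_prop
lemma pt_cont' (Y : ℝ) : Continuous (pt Y) := by unfold pt; fun_prop
lemma pt_im_nonneg (Y X : ℝ) : 0 ≤ (pt Y X).im := by rw [pt_im]; exact le_max_right _ _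
lemma pt_im_gt (Y X : ℝ) : -1 < (pt Y X).im := by linarith [pt_im_nonneg Y X]
lemma pt_self {τ : ℂ} (h : 0 ≤ τ.im) : pt τ.im τ.re = τ := by
  unfold pt; rw [max_eq_left h, Complex.re_add_im]

noncomputable def chi (Y : ℝ) : ℝ := max 0 (min Y 1)
lemma chi_cont : Continuous chi := by unfold chi; fun_prop
lemma chi_nonneg (Y : ℝ) : 0 ≤ chi Y := le_max_left _ _
lemma chi_le (Y : ℝ) : chi Y ≤ 1 := max_le zero_le_one (min_le_right _ _)
lemma chi_zero {Y : ℝ} (h : Y ≤ 0) : chi Y = 0 := by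
  unfold chi; exact max_eq_left ((min_le_left _ _).trans h)
lemma chi_one {Y : ℝ} (h : 1 ≤ Y) : chi Y = 1 := by
  unfold chi; rw [min_eq_right h]; norm_num

lemma pt_comp {f f' : ℂ → ℂ} (h : ∀ τ : ℂ, -1 < τ.im → HasDerivAt f (f' τ) τ) (Y x : ℝ) :
    HasDerivAt (fun x => f (pt Y x)) (f' (pt Y x)) x := by
  have h1 : HasDerivAt (fun x : ℝ => pt Y x) 1 x := by
    unfold pt
    exact (Complex.ofRealCLM.hasDerivAt (x := x)).add_const _
  have := (h (pt Y x) (pt_im_gt Y x)).comp_of_eq x h1 rfl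
  rw [mul_one] at this
  exact this

lemma pt_c {f : ℂ → ℂ} (h : ContinuousOn f {τ | -1 < τ.im}) :
    Continuous fun p : ℝ × ℝ => f (pt p.1 p.2) :=
  continuous_iff_continuousAt.2 fun p =>
    ContinuousAt.comp (f := fun p : ℝ × ℝ => pt p.1 p.2) (h.continuousAt
      ((isOpen_lt continuous_const Complex.continuous_im).mem_nhds (pt_im_gt p.1 p.2)))
      pt_cont.continuousAt

variable {y y1 y2 y3 : ℂ → ℂ}

lemma YD.c0 (h : YD y y1 y2 y3) : ContinuousOn y {τ | -1 < τ.im} := fun τ hτ =>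
  (h.d0 τ hτ).continuousAt.continuousWithinAt
lemma YD.c1 (h : YD y y1 y2 y3) : ContinuousOn y1 {τ | -1 < τ.im} := fun τ hτ =>
  (h.d1 τ hτ).continuousAt.continuousWithinAt
lemma YD.c2 (h : YD y y1 y2 y3) : ContinuousOn y2 {τ | -1 < τ.im} := fun τ hτ =>
  (h.d2 τ hτ).continuousAt.continuousWithinAt

lemma wt_mono {a b : ℝ} (h0 : 0 ≤ a) (h : a ≤ b) : wt b ≤ wt a := by
  unfold wt
  gcongr

/-- bound of chi/wt against wt -/
lemma chi_wt (Y : ℝ) {z : ℂ} (h : ‖z‖ ≤ del * wt (max Y 0)) :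
    ‖((chi Y / wt Y : ℝ) : ℂ) * z‖ ≤ del := by
  rw [norm_mul, Complex.norm_real, Real.norm_of_nonneg (div_nonneg (chi_nonneg Y) (wt_pos Y).le)]
  have hp := wt_pos Y
  have hd := del_pos
  rcases le_total Y 0 with hY | hY
  · rw [chi_zero hY]; simp; exact hd.le
  · rw [max_eq_left hY] at h
    have h2 := chi_le Y
    have h3 := chi_nonneg Y
    calc chi Y / wt Y * ‖z‖ ≤ 1 / wt Y * (del * wt Y) := by gcongr
      _ = del := by field_simp

lemma chi_b (Y : ℝ) {z : ℂ} (h : ‖z‖ ≤ del * wt (max Y 0)) :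
    ‖((chi Y : ℝ) : ℂ) * z‖ ≤ del := by
  rw [norm_mul, Complex.norm_real, Real.norm_of_nonneg (chi_nonneg Y)]
  have hd := del_pos
  have := wt_le (max Y 0)
  have h2 := chi_le Y
  have h3 := chi_nonneg Y
  have : ‖z‖ ≤ del := h.trans (by nlinarith)
  calc chi Y * ‖z‖ ≤ 1 * del := by gcongr
    _ = del := one_mul _

noncomputable def bb (x : ℝ) : ℝ := rho x - rho (x - 1/2)
noncomputable def bb1 (x : ℝ) : ℝ := rho1 x - rho1 (x - 1/2)
noncomputable def bb2 (x : ℝ) : ℝ := rho2 x - rho2 (x - 1/2)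

lemma bb_d (x : ℝ) : HasDerivAt bb (bb1 x) x := by
  have := (rho_d x).sub ((rho_d (x - 1/2)).comp x ((hasDerivAt_id x).sub_const (1/2)))
  refine this.congr_deriv ?_
  unfold bb1; ring
lemma bb1_d (x : ℝ) : HasDerivAt bb1 (bb2 x) x := by
  have := (rho1_d x).sub ((rho1_d (x - 1/2)).comp x ((hasDerivAt_id x).sub_const (1/2)))
  refine this.congr_deriv ?_
  unfold bb2; ring
lemma bb_zero (x : ℝ) (h : x ≤ 0 ∨ 1 ≤ x) : bb x = 0 := by
  unfold bb
  rcases h with h | h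
  · rw [rho_zero h, rho_zero (by linarith)]; ring
  · rw [rho_one (by linarith), rho_one (by linarith)]; ring
lemma bb1_zero (x : ℝ) (h : x ≤ 0 ∨ 1 ≤ x) : bb1 x = 0 := by
  unfold bb1
  rcases h with h | h
  · rw [rho1_zero _ (Or.inl h), rho1_zero _ (Or.inl (by linarith))]; ring
  · rw [rho1_zero _ (Or.inr (by linarith)), rho1_zero _ (Or.inr (by linarith))]; ring
lemma bb_bd (x : ℝ) : |bb x| ≤ 2 * RR := by
  unfold bb
  have := RR_one
  rw [abs_le]; constructor <;> linarith [rho_nonneg x, rho_le x, rho_nonneg (x-1/2), rho_le (x-1/2)]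
lemma bb1_bd (x : ℝ) : |bb1 x| ≤ 2 * RR := by
  unfold bb1
  exact (abs_sub _ _).trans (by linarith [rho1_bd x, rho1_bd (x-1/2)])
lemma bb2_bd (x : ℝ) : |bb2 x| ≤ 2 * RR := by
  unfold bb2
  exact (abs_sub _ _).trans (by linarith [rho2_bd x, rho2_bd (x-1/2)])

lemma mulbd {r c : ℝ} {z : ℂ} (hr : |r| ≤ c * RR) (hz : ‖z‖ ≤ del) : ‖(r : ℂ) * z‖ ≤ c / 1000000 := by
  rw [norm_mul, Complex.norm_real, Real.norm_eq_abs]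
  calc |r| * ‖z‖ ≤ (c * RR) * del := mul_le_mul hr hz (norm_nonneg _) ((abs_nonneg _).trans hr)
    _ = c * (del * RR) := by ring
    _ = _ := by rw [del_RR]; ring

theorem dataB (α : ℝ) (h0 : 0 < α) (h2 : α < 1/2) (hy : YD y y1 y2 y3) :
    ∃ c : ℤ → Cb, (Summable fun k => ‖c k‖) ∧ ∑' k, ‖c k‖ ≤ 1/1000 ∧
      ∀ Y X, 0 ≤ X → X < 1/α → ∑' k : ℤ, c k Y * ee ((k * α * X : ℝ)) =
        (chi Y / wt Y : ℝ) * ((rho1 X : ℂ) * y (pt Y X) / 2) := by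
  have key := fourier_data α h0 h2
    (fun Y X => (chi Y / wt Y : ℝ) * ((rho1 X : ℂ) * y (pt Y X) / 2))
    (fun Y X => (chi Y / wt Y : ℝ) * (((rho2 X : ℂ) * y (pt Y X) + (rho1 X : ℂ) * y1 (pt Y X))/ 2))
    (fun Y X => (chi Y / wt Y : ℝ) * ((((rho3 X : ℂ) * y (pt Y X) + (rho2 X : ℂ) * y1 (pt Y X)) +
      ((rho2 X : ℂ) * y1 (pt Y X) + (rho1 X : ℂ) * y2 (pt Y X)))/ 2)) (4/1000000) ?_ ?_ ?_ ?_ ?_ ?_ ?_ ?_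
  · obtain ⟨c, h, h', h''⟩ := key
    exact ⟨c, h, h'.trans (by norm_num), h''⟩
  · have c1 : Continuous fun p : ℝ × ℝ => chi p.1 / wt p.1 :=
      (chi_cont.comp continuous_fst).div (wt_cont.comp continuous_fst) (fun p => (wt_pos _).ne')
    have c2 := pt_c hy.c0
    have c3 := rho1_smooth.continuous
    exact (Complex.continuous_ofReal.comp c1).mul
      (((Complex.continuous_ofReal.comp (c3.comp continuous_snd)).mul c2).div_const 2)
  · intro Y x
    exact (((rho1_d x).ofReal_comp.mul (pt_comp hy.d0 Y x)).div_const 2).const_mul _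
  · intro Y x
    exact ((((rho2_d x).ofReal_comp.mul (pt_comp hy.d0 Y x)).add
      ((rho1_d x).ofReal_comp.mul (pt_comp hy.d1 Y x))).div_const 2).const_mul _
  · intro Y
    have e : Continuous fun x : ℝ => ((Y, x) : ℝ × ℝ) := by fun_prop
    have c0 := (pt_c hy.c0).comp e
    have c1 := (pt_c hy.c1).comp e
    have c2 := (pt_c hy.c2).comp e
    have r1 := Complex.continuous_ofReal.comp rho1_smooth.continuous
    have r2 := Complex.continuous_ofReal.comp rho2_smooth.continuous
    have r3 := Complex.continuous_ofReal.comp rho3_smooth.continuous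
    exact continuous_const.mul ((((r3.mul c0).add (r2.mul c1)).add
      ((r2.mul c1).add (r1.mul c2))).div_const 2)
  · intro Y x hx
    have hx' : x ≤ 0 ∨ 1/2 ≤ x := hx.imp id (fun h => by linarith)
    simp [rho1_zero x hx']
  · intro Y x hx
    have hx' : x ≤ 0 ∨ 1/2 ≤ x := hx.imp id (fun h => by linarith)
    simp [rho1_zero x hx', rho2_zero x hx']
  · intro Y x
    have h := chi_wt Y (pt_im Y x ▸ hy.b0 _ (pt_im_nonneg Y x))
    have := mulbd (c := 1) (by simpa using rho1_bd x) h
    have e : ((chi Y / wt Y : ℝ) : ℂ) * ((rho1 x : ℂ) * y (pt Y x) / 2) =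
      ((rho1 x : ℂ) * (((chi Y / wt Y : ℝ) : ℂ) * y (pt Y x))) / 2 := by ring
    simp only [e]
    rw [norm_div, Complex.norm_ofNat]
    linarith
  · intro Y x
    have k0 := chi_wt Y (pt_im Y x ▸ hy.b0 _ (pt_im_nonneg Y x))
    have k1 := chi_wt Y (pt_im Y x ▸ hy.b1 _ (pt_im_nonneg Y x))
    have k2 := chi_wt Y (pt_im Y x ▸ hy.b2 _ (pt_im_nonneg Y x))
    have t1 := mulbd (c := 1) (by simpa using rho3_bd x) k0
    have t2 := mulbd (c := 1) (by simpa using rho2_bd x) k1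
    have t3 := mulbd (c := 1) (by simpa using rho1_bd x) k2
    have e : ((chi Y / wt Y : ℝ) : ℂ) * ((((rho3 x : ℂ) * y (pt Y x) + (rho2 x : ℂ) * y1 (pt Y x)) +
      ((rho2 x : ℂ) * y1 (pt Y x) + (rho1 x : ℂ) * y2 (pt Y x)))/ 2) =
      (((rho3 x : ℂ) * (((chi Y / wt Y : ℝ) : ℂ) * y (pt Y x)) +
        (rho2 x : ℂ) * (((chi Y / wt Y : ℝ) : ℂ) * y1 (pt Y x))) +
       ((rho2 x : ℂ) * (((chi Y / wt Y : ℝ) : ℂ) * y1 (pt Y x)) +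
        (rho1 x : ℂ) * (((chi Y / wt Y : ℝ) : ℂ) * y2 (pt Y x)))) / 2 := by ring
    simp only [e]
    rw [norm_div, Complex.norm_ofNat]
    have n1 := norm_add_le ((rho3 x : ℂ) * (((chi Y / wt Y : ℝ) : ℂ) * y (pt Y x)) +
        (rho2 x : ℂ) * (((chi Y / wt Y : ℝ) : ℂ) * y1 (pt Y x)))
        ((rho2 x : ℂ) * (((chi Y / wt Y : ℝ) : ℂ) * y1 (pt Y x)) +
        (rho1 x : ℂ) * (((chi Y / wt Y : ℝ) : ℂ) * y2 (pt Y x)))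
    have n2 := norm_add_le ((rho3 x : ℂ) * (((chi Y / wt Y : ℝ) : ℂ) * y (pt Y x)))
        ((rho2 x : ℂ) * (((chi Y / wt Y : ℝ) : ℂ) * y1 (pt Y x)))
    have n3 := norm_add_le ((rho2 x : ℂ) * (((chi Y / wt Y : ℝ) : ℂ) * y1 (pt Y x)))
        ((rho1 x : ℂ) * (((chi Y / wt Y : ℝ) : ℂ) * y2 (pt Y x)))
    linarith

theorem dataA (α : ℝ) (h0 : 0 < α) (h2 : α < 1/2) (hy : YD y y1 y2 y3) :
    ∃ c : ℤ → Cb, (Summable fun k => ‖c k‖) ∧ ∑' k, ‖c k‖ ≤ 1/1000 ∧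
      ∀ Y X, 0 ≤ X → X < 1/α → ∑' k : ℤ, c k Y * ee ((k * α * X : ℝ)) =
        (chi Y : ℝ) * ((rho1 X : ℂ) * y (pt Y X) / 2 + (bb X : ℂ) * y1 (pt Y X)) := by
  have key := fourier_data α h0 h2
    (fun Y X => (chi Y : ℝ) * ((rho1 X : ℂ) * y (pt Y X) / 2 + (bb X : ℂ) * y1 (pt Y X)))
    (fun Y X => (chi Y : ℝ) * (((rho2 X : ℂ) * y (pt Y X) + (rho1 X : ℂ) * y1 (pt Y X))/ 2 +
      ((bb1 X : ℂ) * y1 (pt Y X) + (bb X : ℂ) * y2 (pt Y X))))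
    (fun Y X => (chi Y : ℝ) * ((((rho3 X : ℂ) * y (pt Y X) + (rho2 X : ℂ) * y1 (pt Y X)) +
      ((rho2 X : ℂ) * y1 (pt Y X) + (rho1 X : ℂ) * y2 (pt Y X)))/ 2 +
      (((bb2 X : ℂ) * y1 (pt Y X) + (bb1 X : ℂ) * y2 (pt Y X)) +
      ((bb1 X : ℂ) * y2 (pt Y X) + (bb X : ℂ) * y3 (pt Y X))))) (10/1000000) ?_ ?_ ?_ ?_ ?_ ?_ ?_ ?_
  · obtain ⟨c, h, h', h''⟩ := key
    exact ⟨c, h, h'.trans (by norm_num), h''⟩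
  · have c1 := chi_cont.comp (continuous_fst (X := ℝ) (Y := ℝ))
    have c2 := pt_c hy.c0
    have c2' := pt_c hy.c1
    have c3 := rho1_smooth.continuous
    have c4 : Continuous bb := continuous_iff_continuousAt.2 fun x => (bb_d x).continuousAt
    exact (Complex.continuous_ofReal.comp c1).mul
      ((((Complex.continuous_ofReal.comp (c3.comp continuous_snd)).mul c2).div_const 2).add
      ((Complex.continuous_ofReal.comp (c4.comp continuous_snd)).mul c2'))
  · intro Y x
    exact ((((rho1_d x).ofReal_comp.mul (pt_comp hy.d0 Y x)).div_const 2).add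
      ((bb_d x).ofReal_comp.mul (pt_comp hy.d1 Y x))).const_mul _
  · intro Y x
    exact (((((rho2_d x).ofReal_comp.mul (pt_comp hy.d0 Y x)).add
      ((rho1_d x).ofReal_comp.mul (pt_comp hy.d1 Y x))).div_const 2).add
      (((bb1_d x).ofReal_comp.mul (pt_comp hy.d1 Y x)).add
      ((bb_d x).ofReal_comp.mul (pt_comp hy.d2 Y x)))).const_mul _
  · intro Y
    have e : Continuous fun x : ℝ => ((Y, x) : ℝ × ℝ) := by fun_prop
    have c0 := (pt_c hy.c0).comp e
    have c1 := (pt_c hy.c1).comp e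
    have c2 := (pt_c hy.c2).comp e
    have c3 := (pt_c hy.c3).comp e
    have r1 := Complex.continuous_ofReal.comp rho1_smooth.continuous
    have r2 := Complex.continuous_ofReal.comp rho2_smooth.continuous
    have r3 := Complex.continuous_ofReal.comp rho3_smooth.continuous
    have s0 : Continuous fun x => (bb x : ℂ) := Complex.continuous_ofReal.comp
      (continuous_iff_continuousAt.2 fun x => (bb_d x).continuousAt)
    have s1 : Continuous fun x => (bb1 x : ℂ) := Complex.continuous_ofReal.comp
      (continuous_iff_continuousAt.2 fun x => (bb1_d x).continuousAt)
    have s2 : Continuous fun x => (bb2 x : ℂ) := by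
      have := rho2_smooth.continuous
      unfold bb2; fun_prop
    exact continuous_const.mul (((((r3.mul c0).add (r2.mul c1)).add
      ((r2.mul c1).add (r1.mul c2))).div_const 2).add (((s2.mul c1).add (s1.mul c2)).add
      ((s1.mul c2).add (s0.mul c3))))
  · intro Y x hx
    have hx' : x ≤ 0 ∨ 1/2 ≤ x := hx.imp id (fun h => by linarith)
    simp [rho1_zero x hx', bb_zero x hx]
  · intro Y x hx
    have hx' : x ≤ 0 ∨ 1/2 ≤ x := hx.imp id (fun h => by linarith)
    simp [rho1_zero x hx', rho2_zero x hx', bb_zero x hx, bb1_zero x hx]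
  · intro Y x
    have k0 := chi_b Y (pt_im Y x ▸ hy.b0 _ (pt_im_nonneg Y x))
    have k1 := chi_b Y (pt_im Y x ▸ hy.b1 _ (pt_im_nonneg Y x))
    have t1 := mulbd (c := 1) (by simpa using rho1_bd x) k0
    have t2 := mulbd (bb_bd x) k1
    have e : ((chi Y : ℝ) : ℂ) * ((rho1 x : ℂ) * y (pt Y x) / 2 + (bb x : ℂ) * y1 (pt Y x)) =
      ((rho1 x : ℂ) * (((chi Y : ℝ) : ℂ) * y (pt Y x))) / 2 +
        (bb x : ℂ) * (((chi Y : ℝ) : ℂ) * y1 (pt Y x)) := by ring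
    simp only [e]
    refine (norm_add_le _ _).trans ?_
    rw [norm_div, Complex.norm_ofNat]
    linarith
  · intro Y x
    have k0 := chi_b Y (pt_im Y x ▸ hy.b0 _ (pt_im_nonneg Y x))
    have k1 := chi_b Y (pt_im Y x ▸ hy.b1 _ (pt_im_nonneg Y x))
    have k2 := chi_b Y (pt_im Y x ▸ hy.b2 _ (pt_im_nonneg Y x))
    have k3 := chi_b Y (pt_im Y x ▸ hy.b3 _ (pt_im_nonneg Y x))
    have t1 := mulbd (c := 1) (by simpa using rho3_bd x) k0
    have t2 := mulbd (c := 1) (by simpa using rho2_bd x) k1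
    have t3 := mulbd (c := 1) (by simpa using rho1_bd x) k2
    have t4 := mulbd (bb2_bd x) k1
    have t5 := mulbd (bb1_bd x) k2
    have t6 := mulbd (bb_bd x) k3
    have e : ((chi Y : ℝ) : ℂ) * ((((rho3 x : ℂ) * y (pt Y x) + (rho2 x : ℂ) * y1 (pt Y x)) +
      ((rho2 x : ℂ) * y1 (pt Y x) + (rho1 x : ℂ) * y2 (pt Y x)))/ 2 +
      (((bb2 x : ℂ) * y1 (pt Y x) + (bb1 x : ℂ) * y2 (pt Y x)) +
      ((bb1 x : ℂ) * y2 (pt Y x) + (bb x : ℂ) * y3 (pt Y x)))) =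
      (((rho3 x : ℂ) * (((chi Y : ℝ) : ℂ) * y (pt Y x)) +
        (rho2 x : ℂ) * (((chi Y : ℝ) : ℂ) * y1 (pt Y x))) +
       ((rho2 x : ℂ) * (((chi Y : ℝ) : ℂ) * y1 (pt Y x)) +
        (rho1 x : ℂ) * (((chi Y : ℝ) : ℂ) * y2 (pt Y x)))) / 2 +
      (((bb2 x : ℂ) * (((chi Y : ℝ) : ℂ) * y1 (pt Y x)) +
        (bb1 x : ℂ) * (((chi Y : ℝ) : ℂ) * y2 (pt Y x))) +
       ((bb1 x : ℂ) * (((chi Y : ℝ) : ℂ) * y2 (pt Y x)) +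
        (bb x : ℂ) * (((chi Y : ℝ) : ℂ) * y3 (pt Y x)))) := by ring
    simp only [e]
    generalize (rho3 x : ℂ) * (((chi Y : ℝ) : ℂ) * y (pt Y x)) = z1 at *
    generalize (rho2 x : ℂ) * (((chi Y : ℝ) : ℂ) * y1 (pt Y x)) = z2 at *
    generalize (rho1 x : ℂ) * (((chi Y : ℝ) : ℂ) * y2 (pt Y x)) = z3 at *
    generalize (bb2 x : ℂ) * (((chi Y : ℝ) : ℂ) * y1 (pt Y x)) = z4 at *
    generalize (bb1 x : ℂ) * (((chi Y : ℝ) : ℂ) * y2 (pt Y x)) = z5 at *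
    generalize (bb x : ℂ) * (((chi Y : ℝ) : ℂ) * y3 (pt Y x)) = z6 at *
    have n0 := norm_add_le (((z1 + z2) + (z2 + z3))/2) ((z4 + z5) + (z5 + z6))
    have n1 := norm_add_le (z1 + z2) (z2 + z3)
    have n2 := norm_add_le z1 z2
    have n3 := norm_add_le z2 z3
    have n4 := norm_add_le (z4 + z5) (z5 + z6)
    have n5 := norm_add_le z4 z5
    have n6 := norm_add_le z5 z6
    rw [norm_div, Complex.norm_ofNat] at n0
    linarith

/-- Beltrami solution adapted to `y` -/
theorem bel (α : ℝ) (h0 : 0 < α) (h2 : α < 1/2) (hy : YD y y1 y2 y3) :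
    ∃ w P Q : ℂ → ℂ,
      (∀ τ, HasFDerivAt (𝕜 := ℝ) w (P τ • (1 : ℂ →L[ℝ] ℂ) + Q τ • (Complex.conjCLE : ℂ →L[ℝ] ℂ)) τ) ∧
      (∀ τ, ‖P τ - 1‖ ≤ 1/50) ∧ (∀ τ, ‖Q τ‖ ≤ 1/50) ∧ (∀ τ, ‖w τ - τ‖ ≤ 1/50) ∧
      (∀ τ, w (τ + (1/α : ℝ)) = w τ + (1/α : ℝ)) ∧
      Tendsto (fun τ => w τ - τ) (comap Complex.im atTop) (𝓝 0) ∧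
      (∀ τ, τ.im ≤ 0 → Q τ = 0) ∧
      (∀ τ, 1/2 ≤ τ.re → τ.re < 1/α → Q τ = 0) ∧
      (∀ τ, -(1/α) + 1/2 ≤ τ.re → τ.re < 0 → Q τ = 0) ∧
      (∀ τ, -(1/α) + 1/2 ≤ τ.re → τ.re < 1/α → 1 ≤ τ.im →
        (1 + ((rho1 τ.re : ℂ) * y τ / 2 + (rho τ.re : ℂ) * y1 τ)) * Q τ =
          ((rho1 τ.re : ℂ) * y τ / 2) * P τ) := by
  obtain ⟨a, sa, ba, ea⟩ := dataA α h0 h2 hy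
  obtain ⟨b, sb, bb', eb⟩ := dataB α h0 h2 hy
  obtain ⟨w, P, Q, hw, hPQ, hP, hQ, hwb, hwp, hwt⟩ := beltrami α h0.ne' a b sa sb ba bb'
  have hA : ∀ τ : ℂ, (1 + ∑' k : ℤ, a k τ.im * ee ((k * α * τ.re : ℝ))) ≠ 0 := by
    intro τ h
    have h1 := tsum_of_norm_bounded (f := fun k : ℤ => a k τ.im * ee ((k * α * τ.re : ℝ)))
      sa.hasSum (fun k => by
        rw [norm_mul, ee_norm_real, mul_one]
        exact BoundedContinuousFunction.norm_coe_le_norm _ _)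
    have h3 : ∑' k : ℤ, a k τ.im * ee ((k * α * τ.re : ℝ)) = -1 := by linear_combination h
    rw [h3, norm_neg, norm_one] at h1
    linarith
  have hz : ∀ τ : ℂ, ∑' k : ℤ, b k τ.im * ee ((k * α * τ.re : ℝ)) = 0 → Q τ = 0 := by
    intro τ h
    have := hPQ τ
    rw [h, mul_zero, zero_mul] at this
    exact (mul_eq_zero.1 this).resolve_left (hA τ)
  have hper : ∀ (Y X : ℝ) (n : ℤ), ∑' k : ℤ, b k Y * ee ((k * α * X : ℝ)) =
      ∑' k : ℤ, b k Y * ee ((k * α * (X + n * (1/α)) : ℝ)) := by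
    intro Y X n
    congr 1; ext k
    congr 1
    have : ((k * α * (X + n * (1/α)) : ℝ) : ℂ) = ((k * α * X : ℝ) : ℂ) + (k * n : ℤ) := by
      have : (k * α * (X + n * (1/α)) : ℝ) = k * α * X + (k * n : ℤ) := by
        push_cast; field_simp
      rw [this]; push_cast; ring
    rw [this, ee_add_int]
  have q1 : ∀ τ : ℂ, τ.im ≤ 0 → Q τ = 0 := by
    intro τ hτ
    apply hz
    set n : ℤ := -⌊τ.re / (1/α)⌋ with hn
    have hω : 0 < 1/α := by positivity
    have f1 := Int.floor_le (τ.re / (1/α))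
    have f2 := Int.lt_floor_add_one (τ.re / (1/α))
    rw [le_div_iff₀ hω] at f1
    rw [div_lt_iff₀ hω] at f2
    rw [hper _ _ n, eb _ _ (by rw [hn]; push_cast; linarith) (by rw [hn]; push_cast; linarith),
      chi_zero hτ]
    simp
  have q2 : ∀ τ : ℂ, 1/2 ≤ τ.re → τ.re < 1/α → Q τ = 0 := by
    intro τ h1 h3
    apply hz
    rw [eb _ _ (by linarith) h3, rho1_zero _ (Or.inr h1)]
    simp
  have q3 : ∀ τ : ℂ, -(1/α) + 1/2 ≤ τ.re → τ.re < 0 → Q τ = 0 := by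
    intro τ h1 h3
    apply hz
    rw [hper _ _ 1, eb _ _ (by push_cast; linarith) (by push_cast; linarith),
      rho1_zero _ (Or.inr (by push_cast; linarith))]
    simp
  refine ⟨w, P, Q, hw, hP, hQ, hwb, hwp, hwt, q1, q2, q3, ?_⟩
  intro τ h1 h3 h4
  rcases lt_or_ge τ.re 0 with h5 | h5
  · rw [q3 τ h1 h5, rho1_zero _ (Or.inl h5.le)]; simp
  rcases le_or_gt (1/2) τ.re with h6 | h6
  · rw [q2 τ h6 h3, rho1_zero _ (Or.inr h6)]; simp
  have e := hPQ τ
  rw [ea _ _ h5 h3, eb _ _ h5 h3, chi_one h4, pt_self (by linarith)] at e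
  have e2 : bb τ.re = rho τ.re := by
    unfold bb; rw [rho_zero (x := τ.re - 1/2) (by linarith), sub_zero]
  rw [e2] at e
  have e3 : (wt τ.im : ℂ) ≠ 0 := by exact_mod_cast (wt_pos τ.im).ne'
  push_cast at e
  rw [one_mul] at e
  rw [e]
  field_simp

end SQB

namespace SQB
open MeasureTheory Filter Topology

lemma homeo_of_lip (k : ℂ → ℂ) (hk : ∀ a b, ‖k a - k b‖ ≤ 1/2 * ‖a - b‖) :
    ∃ h : ℂ ≃ₜ ℂ, (∀ z, h z = z + k z) ∧ ∀ a b, ‖a - b‖ ≤ 2 * ‖h a - h b‖ := by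
  have hA : ApproximatesLinearOn (fun z => z + k z) ((ContinuousLinearEquiv.refl ℝ ℂ : ℂ ≃L[ℝ] ℂ) : ℂ →L[ℝ] ℂ)
      univ (1/2) := by
    intro a _ b _
    have : (a + k a) - (b + k b) - ((ContinuousLinearEquiv.refl ℝ ℂ : ℂ ≃L[ℝ] ℂ) : ℂ →L[ℝ] ℂ) (a - b) =
      k a - k b := by simp; ring
    rw [this]
    have := hk a b
    simpa using this
  refine ⟨hA.toHomeomorph _ (Or.inr ?_), fun z => rfl, fun a b => ?_⟩
  · have : ‖((ContinuousLinearEquiv.refl ℝ ℂ).symm : ℂ →L[ℝ] ℂ)‖₊ = 1 := by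
      have : ((ContinuousLinearEquiv.refl ℝ ℂ).symm : ℂ →L[ℝ] ℂ) = ContinuousLinearMap.id ℝ ℂ := rfl
      rw [this]
      exact NNReal.eq ContinuousLinearMap.norm_id
    rw [this, inv_one]
    rw [← NNReal.coe_lt_coe]; norm_num
  · change ‖a - b‖ ≤ 2 * ‖(a + k a) - (b + k b)‖
    have h1 := hk a b
    have h2 : a - b = ((a + k a) - (b + k b)) - (k a - k b) := by ring
    have h3 : ‖a - b‖ ≤ ‖(a + k a) - (b + k b)‖ + ‖k a - k b‖ := by
      conv_lhs => rw [h2]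
      exact norm_sub_le _ _
    linarith

lemma conf (H : ℂ ≃ₜ ℂ) (w : ℂ → ℂ) (L : ℂ →L[ℝ] ℂ) (c τ : ℂ) (hH : HasFDerivAt (𝕜 := ℝ) H L τ)
    (hw : HasFDerivAt (𝕜 := ℝ) w (c • L) τ) (lip : ∀ a b, ‖a - b‖ ≤ 2 * ‖H a - H b‖) :
    HasDerivAt (fun x => w (H.symm x)) c (H τ) := by
  rw [hasDerivAt_iff_isLittleO]
  have h1 : (fun τ' => w τ' - w τ - c * (H τ' - H τ)) =o[𝓝 τ] fun τ' => τ' - τ := by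
    have a := hw.isLittleO
    have b := hH.isLittleO.const_mul_left c
    refine (a.sub b).congr_left fun x => ?_
    simp only [smul_apply, smul_eq_mul]
    ring
  have h2 : (fun τ' => w τ' - w τ - c * (H τ' - H τ)) =o[𝓝 τ] fun τ' => H τ' - H τ := by
    refine h1.trans_isBigO (Asymptotics.IsBigO.of_bound 2 (Eventually.of_forall fun x => lip x τ))
  have h3 : Tendsto H.symm (𝓝 (H τ)) (𝓝 τ) := by
    have := H.symm.continuous.tendsto (H τ)
    rwa [H.symm_apply_apply] at this
  have h4 := h2.comp_tendsto h3
  refine (h4.congr (fun x => ?_) (fun x => ?_))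
  · simp only [comp_apply, H.apply_symm_apply, H.symm_apply_apply, smul_eq_mul]; ring
  · simp only [comp_apply, H.apply_symm_apply]

lemma conj_diff (f : ℂ ≃ₜ ℂ) (F : ℂ → ℂ) (c s : ℂ) (hc : c ≠ 0) (h1 : HasDerivAt f c s)
    (h2 : DifferentiableAt ℂ f (s + 1)) (h3 : F =ᶠ[𝓝 (f s)] fun x => f (f.symm x + 1)) :
    DifferentiableAt ℂ F (f s) := by
  have e : f.symm (f s) = s := f.symm_apply_apply s
  have h4 : HasDerivAt f.symm c⁻¹ (f s) := by
    apply HasDerivAt.of_local_left_inverse f.symm.continuous.continuousAt (by rw [e]; exact h1) hc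
    exact Eventually.of_forall fun x => f.apply_symm_apply x
  have h5 : DifferentiableAt ℂ (fun x => f (f.symm x + 1)) (f s) := by
    apply DifferentiableAt.comp (g := f) (f := fun x => f.symm x + 1)
    · rw [e]; exact h2
    · exact h4.differentiableAt.add_const 1
  exact h5.congr_of_eventuallyEq h3

variable {y y1 y2 y3 : ℂ → ℂ}

noncomputable def kk (y : ℂ → ℂ) (τ : ℂ) : ℂ := (rho τ.re : ℂ) * y (pt τ.im τ.re)

lemma kk_norm (hy : YD y y1 y2 y3) (τ : ℂ) : ‖kk y τ‖ ≤ del * wt (max τ.im 0) := by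
  unfold kk
  rw [norm_mul, Complex.norm_real, Real.norm_of_nonneg (rho_nonneg _)]
  have h := hy.b0 _ (pt_im_nonneg τ.im τ.re)
  rw [pt_im] at h
  have := rho_le τ.re
  have := norm_nonneg (y (pt τ.im τ.re))
  nlinarith

lemma kk_norm' (hy : YD y y1 y2 y3) (τ : ℂ) : ‖kk y τ‖ ≤ 1/1000000 := by
  have h1 := kk_norm hy τ
  have h2 := wt_le (max τ.im 0)
  have h3 := wt_pos (max τ.im 0)
  have h4 := del_le
  have h5 := del_pos
  nlinarith

lemma y_lip (hy : YD y y1 y2 y3) (a b : ℂ) (ha : 0 ≤ a.im) (hb : 0 ≤ b.im) :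
    ‖y a - y b‖ ≤ del * ‖a - b‖ := by
  have hc : Convex ℝ {z : ℂ | 0 ≤ z.im} := convex_halfSpace_im_ge 0
  refine hc.norm_image_sub_le_of_norm_hasDerivWithin_le (f' := y1)
    (fun x hx => (hy.d0 x (by have : 0 ≤ x.im := hx; linarith)).hasDerivWithinAt) (fun x hx => ?_) hb ha
  refine (hy.b1 x hx).trans ?_
  have := wt_le x.im
  have := del_pos
  nlinarith

lemma rho_lip (a b : ℝ) : |rho a - rho b| ≤ RR * |a - b| := by
  have := (convex_univ (𝕜 := ℝ) (E := ℝ)).norm_image_sub_le_of_norm_hasDerivWithin_le (f := rho) (f' := rho1)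
    (C := RR) (fun x _ => (rho_d x).hasDerivWithinAt) (fun x _ => rho1_bd x) (mem_univ b) (mem_univ a)
  exact this

lemma pt_lip (a b : ℂ) : ‖pt a.im a.re - pt b.im b.re‖ ≤ 2 * ‖a - b‖ := by
  have e : pt a.im a.re - pt b.im b.re = ((a.re - b.re : ℝ) : ℂ) +
      ((max a.im 0 - max b.im 0 : ℝ) : ℂ) * Complex.I := by
    unfold pt; push_cast; ring
  rw [e]
  refine (norm_add_le _ _).trans ?_
  rw [norm_mul, Complex.norm_I, mul_one, Complex.norm_real, Complex.norm_real, Real.norm_eq_abs,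
    Real.norm_eq_abs]
  have h1 := Complex.abs_re_le_norm (a - b)
  have h2 := Complex.abs_im_le_norm (a - b)
  have h3 := abs_max_sub_max_le_abs a.im b.im 0
  rw [Complex.sub_re] at h1
  rw [Complex.sub_im] at h2
  linarith

lemma kk_lip (hy : YD y y1 y2 y3) (a b : ℂ) : ‖kk y a - kk y b‖ ≤ 1/1000 * ‖a - b‖ := by
  have e : kk y a - kk y b = ((rho a.re - rho b.re : ℝ) : ℂ) * y (pt a.im a.re) +
      (rho b.re : ℂ) * (y (pt a.im a.re) - y (pt b.im b.re)) := by
    unfold kk; push_cast; ring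
  rw [e]
  refine (norm_add_le _ _).trans ?_
  rw [norm_mul, norm_mul, Complex.norm_real, Complex.norm_real, Real.norm_eq_abs,
    Real.norm_of_nonneg (rho_nonneg _)]
  have h1 := rho_lip a.re b.re
  have h2 := y_lip hy _ _ (pt_im_nonneg a.im a.re) (pt_im_nonneg b.im b.re)
  have h3 := pt_lip a b
  have h4 := Complex.abs_re_le_norm (a - b)
  rw [Complex.sub_re] at h4
  have h5 : ‖y (pt a.im a.re)‖ ≤ del := by
    refine (hy.b0 _ (pt_im_nonneg _ _)).trans ?_
    have := wt_le (pt a.im a.re).im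
    have := del_pos
    nlinarith
  have h6 := del_RR
  have h7 := del_le
  have hd := del_pos
  have hR := RR_one
  have hn := norm_nonneg (a - b)
  have t1 : |rho a.re - rho b.re| * ‖y (pt a.im a.re)‖ ≤ (RR * ‖a - b‖) * del := by
    apply mul_le_mul (h1.trans (by gcongr)) h5 (norm_nonneg _) (by positivity)
  have t2 : rho b.re * ‖y (pt a.im a.re) - y (pt b.im b.re)‖ ≤ 1 * (del * (2 * ‖a - b‖)) := by
    apply mul_le_mul (rho_le _) (h2.trans (by gcongr)) (norm_nonneg _) (by norm_num)
  have e1 : (RR * ‖a - b‖) * del = (del * RR) * ‖a - b‖ := by ring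
  rw [e1, h6] at t1
  nlinarith

lemma kk_deriv (hy : YD y y1 y2 y3) (τ : ℂ) (hτ : 0 < τ.im) :
    HasFDerivAt (𝕜 := ℝ) (fun τ => τ + kk y τ)
      ((1 + ((rho1 τ.re : ℂ) * y τ / 2 + (rho τ.re : ℂ) * y1 τ)) • (1 : ℂ →L[ℝ] ℂ) +
        ((rho1 τ.re : ℂ) * y τ / 2) • (Complex.conjCLE : ℂ →L[ℝ] ℂ)) τ := by
  have e : (fun τ => τ + kk y τ) =ᶠ[𝓝 τ] fun τ => τ + (rho τ.re : ℂ) * y τ := by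
    have : ∀ᶠ z : ℂ in 𝓝 τ, 0 < z.im :=
      (isOpen_lt continuous_const Complex.continuous_im).mem_nhds hτ
    filter_upwards [this] with z hz
    unfold kk; rw [pt_self hz.le]
  have d1 := (rho_d τ.re).ofReal_comp.hasFDerivAt.comp τ Complex.reCLM.hasFDerivAt
  have d2 := ((hy.d0 τ (by linarith)).hasFDerivAt.restrictScalars ℝ)
  have d3 := (hasFDerivAt_id (𝕜 := ℝ) τ).add (d1.mul d2)
  refine (d3.congr_of_eventuallyEq e).congr_fderiv ?_
  ext v
  have hv2 : (starRingEnd ℂ) v = 2 * v.re - v := by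
    apply Complex.ext <;> simp
    ring
  simp only [add_apply, smul_apply, smul_eq_mul, ContinuousLinearEquiv.coe_coe, Complex.conjCLE_apply, hv2,
    one_apply_eq_self, ContinuousLinearMap.comp_apply, comp_apply, Complex.reCLM_apply,
    ContinuousLinearMap.toSpanSingleton_apply, ContinuousLinearMap.coe_restrictScalars',
    Complex.real_smul, ContinuousLinearMap.coe_id', id_eq]
  ring

structure Pkg (ω : ℝ) (y w F : ℂ → ℂ) : Prop where
  wb : ∀ τ, ‖w τ - τ‖ ≤ 1/50
  wper : ∀ τ, w (τ + ω) = w τ + ω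
  wtop : Tendsto (fun τ => w τ - τ) (comap Complex.im atTop) (𝓝 0)
  wd : ∀ τ : ℂ, -ω + 1/2 < τ.re → τ.re < 0 → DifferentiableAt ℂ w τ
  Fper : ∀ x, F (x + ω) = F x + ω
  Fb : ∀ x, ‖F x - x - 1‖ ≤ 1/10
  Ftop : Tendsto (fun x => F x - x - 1) (comap Complex.im atTop) (𝓝 0)
  Fd : ∀ x : ℂ, (∀ k : ℤ, 2 ≤ ‖x - k * ω - (-1/4 + Complex.I)‖) → DifferentiableAt ℂ F x
  Fw : ∀ τ : ℂ, -3/2 < τ.re → τ.re ≤ -1 → F (w τ) = w (τ + 1)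
  chain : ∀ s : ℂ, -5/4 ≤ s.re → s.re < -1/4 → 4 < s.im → ∃ M : ℕ, ∃ s' : ℂ,
    s' = s + ω + y (s + ω) - M ∧ -5/4 ≤ s'.re ∧ s'.re < -1/4 ∧ F^[M] (w s') = w s + ω ∧
    ∀ j ≤ M, s.im - 1 ≤ (F^[j] (w s')).im

lemma im_tend (g : ℂ → ℂ) (C : ℝ) (h : ∀ z, ‖g z - z‖ ≤ C) :
    Tendsto g (comap Complex.im atTop) (comap Complex.im atTop) := by
  rw [tendsto_comap_iff]
  have h1 : Tendsto Complex.im (comap Complex.im atTop) atTop := tendsto_comap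
  refine tendsto_atTop_mono (f := fun z : ℂ => z.im - C) (fun z => ?_)
    (tendsto_atTop_add_const_right _ (-C) h1)
  have h2 := (Complex.abs_im_le_norm (g z - z)).trans (h z)
  rw [Complex.sub_im, abs_le] at h2
  simp only [comp_apply]
  linarith [h2.1]

lemma wt_top : Tendsto wt atTop (𝓝 0) := by
  unfold wt
  apply Filter.Tendsto.inv_tendsto_atTop
  exact tendsto_atTop_add_const_left _ 1 (tendsto_pow_atTop (by norm_num))

theorem pkg (α : ℝ) (h0 : 0 < α) (h2 : α < 1/2) (hy : YD y y1 y2 y3) :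
    ∃ w F, Pkg (1/α) y w F := by
  obtain ⟨w, P, Q, hw, hP, hQ, wb, wper, wtop, q1, q2, q3, q4⟩ := bel α h0 h2 hy
  have hω : 2 < 1/α := by rw [lt_div_iff₀ h0]; linarith
  set ω := 1/α with hωdef
  have wlip : ∀ a b, ‖(w a - a) - (w b - b)‖ ≤ 1/2 * ‖a - b‖ := by
    intro a b
    refine (convex_univ (𝕜 := ℝ) (E := ℂ)).norm_image_sub_le_of_norm_hasFDerivWithin_le
      (f := fun z => w z - z) (fun x _ => ((hw x).sub (hasFDerivAt_id x)).hasFDerivWithinAt)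
      (fun x _ => ?_) (mem_univ b) (mem_univ a)
    apply ContinuousLinearMap.opNorm_le_bound _ (by norm_num)
    intro v
    have e : (P x • (1 : ℂ →L[ℝ] ℂ) + Q x • (Complex.conjCLE : ℂ →L[ℝ] ℂ) - ContinuousLinearMap.id ℝ ℂ) v =
      (P x - 1) * v + Q x * (starRingEnd ℂ) v := by
      simp only [add_apply, sub_apply, smul_apply, smul_eq_mul, ContinuousLinearEquiv.coe_coe,
        Complex.conjCLE_apply, one_apply_eq_self, ContinuousLinearMap.coe_id', id_eq]
      ring
    rw [e]
    refine (norm_add_le _ _).trans ?_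
    rw [norm_mul, norm_mul, RCLike.norm_conj]
    have := hP x
    have := hQ x
    have := norm_nonneg v
    nlinarith
  obtain ⟨W, hW, Wlip⟩ := homeo_of_lip (fun z => w z - z) wlip
  have hW : ∀ z, W z = w z := fun z => by rw [hW]; ring
  obtain ⟨H, hH, Hlip⟩ := homeo_of_lip (kk y) (fun a b => (kk_lip hy a b).trans
    (mul_le_mul_of_nonneg_right (by norm_num) (norm_nonneg _)))
  have Hid : ∀ τ : ℂ, τ.re ≤ 0 → H τ = τ := by
    intro τ h; rw [hH, kk, rho_zero h]; simp
  have Hid' : ∀ τ : ℂ, τ.re ≤ 0 → H.symm τ = τ := by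
    intro τ h; rw [H.symm_apply_eq, Hid τ h]
  have Hsn : ∀ u, ‖H.symm u - u‖ ≤ 1/1000000 := by
    intro u
    have : H.symm u - u = - kk y (H.symm u) := by
      have := hH (H.symm u)
      rw [H.apply_symm_apply] at this
      linear_combination -this
    rw [this, norm_neg]; exact kk_norm' hy _
  set Gt : ℂ → ℂ := fun τ => H.symm (H τ + 1) with hGt
  have Gt_e : ∀ τ, Gt τ - τ - 1 = kk y τ - kk y (Gt τ) := by
    intro τ
    have h1 : H (Gt τ) = H τ + 1 := H.apply_symm_apply _
    rw [hH, hH] at h1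
    linear_combination h1
  have Gt_b : ∀ τ, ‖Gt τ - τ - 1‖ ≤ 2/1000000 := by
    intro τ
    rw [Gt_e]
    refine (norm_sub_le _ _).trans ?_
    linarith [kk_norm' hy τ, kk_norm' hy (Gt τ)]
  have Gt_l : ∀ τ : ℂ, τ.re ≤ -1 → Gt τ = τ + 1 := by
    intro τ h
    simp only [hGt]
    rw [Hid τ (by linarith), Hid']
    simp; linarith
  have Gt_r : ∀ τ : ℂ, 1/2 ≤ τ.re → Gt τ = τ + 1 := by
    intro τ h
    simp only [hGt]
    rw [H.symm_apply_eq, hH, hH]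
    unfold kk
    have e : pt (τ + 1).im (τ + 1).re = pt τ.im τ.re + 1 := by
      unfold pt; simp; ring
    rw [e, hy.per, rho_one h, rho_one]
    · ring
    · simp; linarith
  set ef : ℂ → ℂ := fun τ => if 2 < τ.im then Gt τ - τ - 1 else 0 with hef
  have ef_z : ∀ τ : ℂ, τ.re ≤ -1 ∨ 1/2 ≤ τ.re → ef τ = 0 := by
    intro τ h
    simp only [hef]
    split_ifs
    · rcases h with h | h
      · rw [Gt_l τ h]; ring
      · rw [Gt_r τ h]; ring
    · rfl
  have ef_b : ∀ τ, ‖ef τ‖ ≤ 2/1000000 := by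
    intro τ
    simp only [hef]
    split_ifs
    · exact Gt_b τ
    · norm_num
  have ef_t : ∀ τ : ℂ, 2 < τ.im → ‖ef τ‖ ≤ 2 * wt (τ.im - 1) := by
    intro τ h
    simp only [hef]
    rw [if_pos h, Gt_e]
    refine (norm_sub_le _ _).trans ?_
    have n1 := kk_norm hy τ
    have n2 := kk_norm hy (Gt τ)
    have n3 := (Complex.abs_im_le_norm _).trans (Gt_b τ)
    simp only [Complex.sub_im, Complex.one_im, sub_zero] at n3
    rw [abs_le] at n3
    have m1 : wt (max τ.im 0) ≤ wt (τ.im - 1) := wt_mono (by linarith) (le_max_of_le_left (by linarith))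
    have m2 : wt (max (Gt τ).im 0) ≤ wt (τ.im - 1) :=
      wt_mono (by linarith) (le_max_of_le_left (by linarith [n3.1]))
    have d1 := del_le
    have d2 := del_pos
    have := wt_pos (τ.im - 1)
    have := wt_pos (max τ.im 0)
    have := wt_pos (max (Gt τ).im 0)
    nlinarith
  set kf : ℂ → ℤ := fun τ => ⌊(τ.re + 1) / ω⌋ with hkf
  set ep : ℂ → ℂ := fun τ => ef (τ - kf τ * ω) with hep
  have ep_per : ∀ τ, ep (τ + ω) = ep τ := by
    intro τ
    have : kf (τ + ω) = kf τ + 1 := by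
      simp only [hkf]
      rw [Complex.add_re, Complex.ofReal_re]
      have : (τ.re + ω + 1) / ω = (τ.re + 1) / ω + 1 := by
        field_simp; ring
      rw [this, Int.floor_add_one]
    simp only [hep]
    rw [this]; push_cast
    congr 1; ring
  have ep_eq : ∀ τ : ℂ, -ω + 1/2 < τ.re → τ.re < ω - 1 → ep τ = ef τ := by
    intro τ h3 h4
    rcases lt_or_ge τ.re (-1) with h5 | h5
    · have : kf τ = -1 := by
        simp only [hkf]
        rw [Int.floor_eq_iff]
        constructor
        · rw [le_div_iff₀ (by linarith)]; push_cast; linarith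
        · rw [div_lt_iff₀ (by linarith)]; push_cast; linarith
      simp only [hep]
      rw [this, ef_z τ (Or.inl h5.le), ef_z]
      right; simp; linarith
    · have : kf τ = 0 := by
        simp only [hkf]
        rw [Int.floor_eq_iff]
        constructor
        · rw [le_div_iff₀ (by linarith)]; push_cast; linarith
        · rw [div_lt_iff₀ (by linarith)]; push_cast; linarith
      simp only [hep]
      rw [this]; simp
  have ep_b : ∀ τ, ‖ep τ‖ ≤ 2/1000000 := fun τ => ef_b _
  have ep_t : ∀ τ : ℂ, 2 < τ.im → ‖ep τ‖ ≤ 2 * wt (τ.im - 1) := by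
    intro τ h
    have e : (τ - kf τ * ω).im = τ.im := by simp
    have := ef_t (τ - kf τ * ω) (by rw [e]; exact h)
    rwa [e] at this
  set Gp : ℂ → ℂ := fun τ => τ + 1 + ep τ with hGp
  set F : ℂ → ℂ := fun x => w (Gp (W.symm x)) with hF
  have FW : ∀ τ, F (W τ) = w (Gp τ) := by
    intro τ; simp only [hF]; rw [W.symm_apply_apply]
  have Wper : ∀ τ, W (τ + ω) = W τ + ω := fun τ => by rw [hW, hW]; exact wper τ
  have Wsper : ∀ x, W.symm (x + ω) = W.symm x + ω := by
    intro x; rw [W.symm_apply_eq, Wper, W.apply_symm_apply]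
  have Fper : ∀ x, F (x + ω) = F x + ω := by
    intro x
    simp only [hF, hGp]
    rw [Wsper, ep_per, ← wper]
    congr 1; ring
  have FperZ : ∀ x (k : ℤ), F (x + k * ω) = F x + k * ω := by
    intro x k
    induction k with
    | zero => simp
    | succ n ih =>
      have : x + ((n + 1 : ℤ) : ℂ) * ω = (x + (n : ℤ) * ω) + ω := by push_cast; ring
      rw [this, Fper, ih]; push_cast; ring
    | pred n ih =>
      have h := Fper (x + ((-(n:ℤ) - 1 : ℤ) : ℂ) * ω)
      have : x + ((-(n:ℤ) - 1 : ℤ) : ℂ) * ω + ω = x + (-(n : ℤ) : ℤ) * ω := by push_cast; ring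
      rw [this, ih] at h
      push_cast at h ⊢
      linear_combination -h
  have Fform : ∀ x, F x - x - 1 = (w (Gp (W.symm x)) - Gp (W.symm x)) -
      (w (W.symm x) - W.symm x) + ep (W.symm x) := by
    intro x
    have h1 : w (W.symm x) = x := by rw [← hW, W.apply_symm_apply]
    rw [h1]
    simp only [hF, hGp]
    ring
  have Pne : ∀ τ, P τ ≠ 0 := by
    intro τ h
    have := hP τ
    rw [h] at this
    norm_num at this
  -- local behaviour
  have dW : ∀ τ, Q τ = 0 → HasDerivAt w (P τ) τ := by
    intro τ hq
    have h : HasFDerivAt w (P τ • (1 : ℂ →L[ℝ] ℂ)) τ := by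
      refine (hw τ).congr_fderiv ?_
      ext v
      all_goals simp [hq]
    have := conf (Homeomorph.refl ℂ) w 1 (P τ) τ (hasFDerivAt_id τ) h (fun a b => by
      simp only [Homeomorph.refl_apply, id]
      have := norm_nonneg (a - b)
      linarith)
    exact this
  set f : ℂ ≃ₜ ℂ := H.symm.trans W with hf
  have fa : ∀ u, f u = w (H.symm u) := fun u => hW _
  have fsymm : ∀ x, f.symm x = H (W.symm x) := fun x => rfl
  have fH : ∀ τ, f (H τ) = w τ := fun τ => by rw [fa, H.symm_apply_apply]
  have df : ∀ τ : ℂ, -ω + 1/2 < τ.re → τ.re < ω → 1 < τ.im →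
      ∃ c, c ≠ 0 ∧ HasDerivAt f c (H τ) := by
    intro τ h3 h4 h5
    have e := q4 τ h3.le h4 h5.le
    set hz := (1 + ((rho1 τ.re : ℂ) * y τ / 2 + (rho τ.re : ℂ) * y1 τ)) with hhz
    set hb := ((rho1 τ.re : ℂ) * y τ / 2) with hhb
    have b0 := hy.b0 τ (by linarith)
    have b1 := hy.b1 τ (by linarith)
    have hwt := wt_le τ.im
    have hd := del_pos
    have hR := RR_one
    have b0' : ‖y τ‖ ≤ del := b0.trans (by nlinarith)
    have b1' : ‖y1 τ‖ ≤ del := b1.trans (by nlinarith)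
    have t1 := mulbd (c := 1) (by simpa using rho1_bd τ.re) b0'
    have t2 := mulbd (r := rho τ.re) (c := 1) (by
      rw [abs_of_nonneg (rho_nonneg _)]; linarith [rho_le τ.re]) b1'
    have hzne : hz ≠ 0 := by
      intro h
      have : (rho1 τ.re : ℂ) * y τ / 2 + (rho τ.re : ℂ) * y1 τ = -1 := by
        rw [hhz] at h; linear_combination h
      have h' := norm_add_le ((rho1 τ.re : ℂ) * y τ / 2) ((rho τ.re : ℂ) * y1 τ)
      rw [this, norm_neg, norm_one, norm_div, Complex.norm_ofNat] at h'
      linarith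
    refine ⟨P τ / hz, div_ne_zero (Pne τ) hzne, ?_⟩
    have dH : HasFDerivAt (𝕜 := ℝ) H (hz • (1 : ℂ →L[ℝ] ℂ) + hb • (Complex.conjCLE : ℂ →L[ℝ] ℂ)) τ := by
      have : (H : ℂ → ℂ) = fun τ => τ + kk y τ := funext hH
      rw [this]
      exact kk_deriv hy τ (by linarith)
    have := conf H w _ (P τ / hz) τ dH (by
      refine (hw τ).congr_fderiv ?_
      ext v
      simp only [add_apply, smul_apply, smul_eq_mul]
      field_simp
      linear_combination ((Complex.conjCLE : ℂ →L[ℝ] ℂ) v) * e) Hlip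
    have e2 : (f : ℂ → ℂ) = fun x => w (H.symm x) := funext fa
    rw [e2]; exact this
  have nb : ∀ (p : ℂ → Prop) (τ : ℂ), (∀ᶠ z in 𝓝 τ, p z) → ∀ᶠ x in 𝓝 (w τ), p (W.symm x) := by
    intro p τ h
    have : Tendsto W.symm (𝓝 (w τ)) (𝓝 τ) := by
      have := W.symm.continuous.tendsto (W τ)
      rwa [W.symm_apply_apply, hW] at this
    exact this.eventually h
  have nre : ∀ (a : ℝ) (τ : ℂ), a < τ.re → ∀ᶠ z : ℂ in 𝓝 τ, a < z.re := fun a τ h =>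
    (isOpen_lt continuous_const Complex.continuous_re).mem_nhds h
  have nre' : ∀ (a : ℝ) (τ : ℂ), τ.re < a → ∀ᶠ z : ℂ in 𝓝 τ, z.re < a := fun a τ h =>
    (isOpen_lt Complex.continuous_re continuous_const).mem_nhds h
  have nim : ∀ (a : ℝ) (τ : ℂ), a < τ.im → ∀ᶠ z : ℂ in 𝓝 τ, a < z.im := fun a τ h =>
    (isOpen_lt continuous_const Complex.continuous_im).mem_nhds h
  have nim' : ∀ (a : ℝ) (τ : ℂ), τ.im < a → ∀ᶠ z : ℂ in 𝓝 τ, z.im < a := fun a τ h =>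
    (isOpen_lt Complex.continuous_im continuous_const).mem_nhds h
  -- step relation
  have Gp_top : ∀ τ : ℂ, -ω + 1/2 < τ.re → τ.re < ω - 1 → 2 < τ.im → Gp τ = Gt τ := by
    intro τ h3 h4 h5
    simp only [hGp]
    rw [ep_eq τ h3 h4]
    simp only [hef]
    rw [if_pos h5]; ring
  have Fstep : ∀ τ : ℂ, -ω + 1/2 < τ.re → τ.re < ω - 1 → 2 < τ.im → F (w τ) = f (H τ + 1) := by
    intro τ h3 h4 h5
    rw [← hW, FW, Gp_top τ h3 h4 h5, fa]
  have reg1 : ∀ τ : ℂ, -ω + 1/2 < τ.re → τ.re < ω - 1 → 2 < τ.im → DifferentiableAt ℂ F (w τ) := by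
    intro τ h3 h4 h5
    obtain ⟨c, hc, hd⟩ := df τ h3 (by linarith) (by linarith)
    have gb := Gt_b τ
    have g1 := (Complex.abs_re_le_norm _).trans gb
    have g2 := (Complex.abs_im_le_norm _).trans gb
    simp only [Complex.sub_im, Complex.one_im, sub_zero, Complex.sub_re, Complex.one_re, abs_le] at g1 g2
    have gr : (Gt τ).re < ω := by
      rcases le_or_gt (1/2) τ.re with h6 | h6
      · rw [Gt_r τ h6]; simp; linarith
      · linarith [g1.2]
    obtain ⟨c', _, hd'⟩ := df (Gt τ) (by linarith [g1.1]) gr (by linarith [g2.1])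
    have e1 : H (Gt τ) = H τ + 1 := H.apply_symm_apply _
    rw [e1] at hd'
    rw [← fH]
    apply conj_diff f F c (H τ) hc hd hd'.differentiableAt
    rw [fH]
    filter_upwards [nb _ τ (nre _ τ h3), nb _ τ (nre' _ τ h4), nb _ τ (nim _ τ h5)] with x k1 k2 k3
    have := Fstep _ k1 k2 k3
    rw [← hW, W.apply_symm_apply] at this
    rw [this, fsymm]
  have regW : ∀ τ : ℂ, Q τ = 0 → Q (τ + 1) = 0 → (∀ᶠ z in 𝓝 τ, ep z = 0) →
      DifferentiableAt ℂ F (w τ) := by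
    intro τ k1 k2 k3
    have eW : (W : ℂ → ℂ) = w := funext hW
    rw [← hW]
    apply conj_diff W F (P τ) τ (Pne τ) (by rw [eW]; exact dW τ k1)
      (by rw [eW]; exact (dW _ k2).differentiableAt)
    rw [hW]
    filter_upwards [nb _ τ k3] with x k
    simp only [hF, hGp]
    rw [k, add_zero, hW]
  have reg2 : ∀ τ : ℂ, 1/2 < τ.re → τ.re < ω - 1 → DifferentiableAt ℂ F (w τ) := by
    intro τ h3 h4
    apply regW τ (q2 τ h3.le (by linarith)) (q2 _ (by simp; linarith) (by simp; linarith))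
    filter_upwards [nre _ τ h3, nre' _ τ h4] with z k1 k2
    rw [ep_eq z (by linarith) k2, ef_z z (Or.inr k1.le)]
  have reg3 : ∀ τ : ℂ, τ.im < 0 → DifferentiableAt ℂ F (w τ) := by
    intro τ h3
    apply regW τ (q1 τ h3.le) (q1 _ (by simp; linarith))
    filter_upwards [nim' _ τ h3] with z k1
    simp only [hep, hef]
    rw [if_neg]
    simp; linarith
  refine ⟨w, F, wb, wper, wtop, ?_, Fper, ?_, ?_, ?_, ?_, ?_⟩
  · intro τ h3 h4
    exact (dW τ (q3 τ h3.le h4)).differentiableAt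
  · intro x
    rw [Fform]
    refine (norm_add_le _ _).trans ?_
    have := norm_sub_le (w (Gp (W.symm x)) - Gp (W.symm x)) (w (W.symm x) - W.symm x)
    linarith [wb (Gp (W.symm x)), wb (W.symm x), ep_b (W.symm x)]
  · have ws : ∀ x, ‖W.symm x - x‖ ≤ 1/50 := by
      intro x
      have := wb (W.symm x)
      rw [← hW, W.apply_symm_apply] at this
      rwa [norm_sub_rev]
    have T1 : Tendsto W.symm (comap Complex.im atTop) (comap Complex.im atTop) := im_tend _ _ ws
    have T2 : Tendsto Gp (comap Complex.im atTop) (comap Complex.im atTop) := im_tend _ 2 (fun z => by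
      simp only [hGp]
      have : z + 1 + ep z - z = 1 + ep z := by ring
      rw [this]
      refine (norm_add_le _ _).trans ?_
      rw [norm_one]; linarith [ep_b z])
    have T3 : Tendsto ep (comap Complex.im atTop) (𝓝 0) := by
      have k1 : Tendsto Complex.im (comap Complex.im atTop) atTop := tendsto_comap
      have k2 : Tendsto (fun z : ℂ => 2 * wt (z.im - 1)) (comap Complex.im atTop) (𝓝 0) := by
        have := (wt_top.comp (tendsto_atTop_add_const_right _ (-1) k1)).const_mul 2
        rw [mul_zero] at this
        exact this
      apply squeeze_zero_norm' _ k2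
      filter_upwards [k1.eventually (eventually_gt_atTop 2)] with z hz using ep_t z hz
    have : (fun x => F x - x - 1) = fun x => (w (Gp (W.symm x)) - Gp (W.symm x)) -
      (w (W.symm x) - W.symm x) + ep (W.symm x) := funext Fform
    rw [this]
    have := (((wtop.comp T2).comp T1).sub (wtop.comp T1)).add (T3.comp T1)
    simpa using this
  · intro x hx
    set τ0 := W.symm x with hτ0
    have hx0 : w τ0 = x := by rw [← hW, hτ0, W.apply_symm_apply]
    set k := kf τ0 with hk
    set τ := τ0 - k * ω with hτ
    have hωp : 0 < ω := by linarith
    have hf1 : k ≤ (τ0.re + 1) / ω := Int.floor_le _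
    have hf2 : (τ0.re + 1) / ω < k + 1 := Int.lt_floor_add_one _
    rw [le_div_iff₀ hωp] at hf1
    rw [div_lt_iff₀ hωp] at hf2
    have hr : τ.re = τ0.re - k * ω := by simp [hτ]
    have r1 : -1 ≤ τ.re := by rw [hr]; linarith
    have r2 : τ.re < ω - 1 := by rw [hr]; linarith
    have wτ : w τ = x - k * ω := by
      have : ∀ (k : ℤ) z, w (z + k * ω) = w z + k * ω := by
        intro k z
        induction k with
        | zero => simp
        | succ n ih =>
          have : z + ((n + 1 : ℤ) : ℂ) * ω = (z + (n : ℤ) * ω) + ω := by push_cast; ring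
          rw [this, wper, ih]; push_cast; ring
        | pred n ih =>
          have h := wper (z + ((-(n:ℤ) - 1 : ℤ) : ℂ) * ω)
          have : z + ((-(n:ℤ) - 1 : ℤ) : ℂ) * ω + ω = z + (-(n : ℤ) : ℤ) * ω := by push_cast; ring
          rw [this, ih] at h
          push_cast at h ⊢
          linear_combination -h
      have h := this k τ
      have e : τ + k * ω = τ0 := by rw [hτ]; ring
      rw [e, hx0] at h
      rw [h]; ring
    have main : DifferentiableAt ℂ F (w τ) := by
      by_cases c1 : 2 < τ.im
      · exact reg1 τ (by linarith) r2 c1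
      by_cases c2 : 1/2 < τ.re
      · exact reg2 τ c2 r2
      by_cases c3 : τ.im < 0
      · exact reg3 τ c3
      exfalso
      have h1 := hx k
      rw [← wτ] at h1
      have h3 : ‖τ - (-1/4 + Complex.I)‖ ≤ 7/4 := by
        refine (Complex.norm_le_abs_re_add_abs_im _).trans ?_
        have a1 : |(τ - (-1/4 + Complex.I)).re| ≤ 3/4 := by
          simp; rw [abs_le]; constructor <;> linarith
        have a2 : |(τ - (-1/4 + Complex.I)).im| ≤ 1 := by
          have : (-1/4 + Complex.I : ℂ).im = 1 := by simp
          rw [Complex.sub_im, this]; rw [abs_le]; constructor <;> linarith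
        linarith
      have h4 : ‖w τ - (-1/4 + Complex.I)‖ ≤ ‖w τ - τ‖ + ‖τ - (-1/4 + Complex.I)‖ := by
        have : w τ - (-1/4 + Complex.I) = (w τ - τ) + (τ - (-1/4 + Complex.I)) := by ring
        rw [this]; exact norm_add_le _ _
      linarith [wb τ]
    have e : F = fun z => F (z - k * ω) + k * ω := by
      funext z
      have := FperZ (z - k * ω) k
      rw [sub_add_cancel] at this
      exact this
    rw [e]
    apply DifferentiableAt.add_const
    apply DifferentiableAt.comp (g := F) (f := fun z => z - k * (ω:ℂ))
    · rw [← wτ]; exact main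
    · fun_prop
  · intro τ t1 t2
    rw [← hW, FW, hGp]
    simp only
    rw [ep_eq τ (by linarith) (by linarith), ef_z τ (Or.inl t2), add_zero]
  · intro s s1 s2 s3
    have bs := hy.b0 (s + ω) (by simp; linarith)
    have hbs : ‖y (s + ω)‖ ≤ 1/1000000 := by
      refine bs.trans ?_
      have := wt_le (s + ω).im
      have := wt_pos (s + ω).im
      have := del_le
      have := del_pos
      nlinarith
    have b1 := (Complex.abs_re_le_norm _).trans hbs
    have b2 := (Complex.abs_im_le_norm _).trans hbs
    rw [abs_le] at b1 b2
    set A := s + ω + y (s + ω) with hA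
    have Are : A.re = s.re + ω + (y (s + ω)).re := by simp [hA]
    have Aim : A.im = s.im + (y (s + ω)).im := by simp [hA]
    set M := ⌊A.re + 5/4⌋₊ with hM
    have M1 : (M : ℝ) ≤ A.re + 5/4 := Nat.floor_le (by linarith)
    have M2 : A.re + 5/4 < M + 1 := Nat.lt_floor_add_one _
    have s'r : (A - M).re = A.re - M := by simp
    have fs' : w (A - M) = f (A - M) := by
      rw [fa, Hid' _ (by rw [s'r]; linarith)]
    have it : ∀ j : ℕ, j ≤ M → F^[j] (w (A - M)) = f (A - M + j) := by
      intro j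
      induction j with
      | zero => intro _; simp [fs']
      | succ j ih =>
        intro hj
        rw [iterate_succ_apply', ih (by omega)]
        have hjM : (j : ℝ) + 1 ≤ M := by exact_mod_cast hj
        have hj0 : (0:ℝ) ≤ j := Nat.cast_nonneg j
        set u := A - M + j with hu
        have ur : u.re = A.re - M + j := by simp [hu]
        have ui : u.im = A.im := by simp [hu]
        have n1 := (Complex.abs_re_le_norm _).trans (Hsn u)
        have n2 := (Complex.abs_im_le_norm _).trans (Hsn u)
        rw [abs_le, Complex.sub_re] at n1
        rw [abs_le, Complex.sub_im] at n2
        have := Fstep (H.symm u) (by linarith [n1.1]) (by linarith [n1.2]) (by linarith [n2.1])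
        rw [← fa, H.apply_symm_apply] at this
        rw [this, hu]
        push_cast
        congr 1; ring
    refine ⟨M, A - M, rfl, ?_, ?_, ?_, ?_⟩
    · rw [s'r]; linarith
    · rw [s'r]; linarith
    · rw [it M le_rfl, sub_add_cancel, ← wper]
      have : H (s + ω) = A := by
        rw [hH]
        unfold kk
        rw [pt_self (by simp; linarith), rho_one (by simp; linarith)]
        simp [hA]
      rw [← this, fH]
    · intro j hj
      rw [it j hj, fa]
      have n2 := (Complex.abs_im_le_norm _).trans (Hsn (A - M + j))
      have n3 := (Complex.abs_im_le_norm _).trans (wb (H.symm (A - M + j)))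
      have e : (A - M + j).im = A.im := by simp
      rw [abs_le, Complex.sub_im, e] at n2
      rw [abs_le, Complex.sub_im] at n3
      linarith [n2.1, n3.1]

end SQB

namespace SQB
open MeasureTheory Filter Topology

/-- shift constant -/
noncomputable def mu : ℝ := del * Real.exp (-(8 * Real.pi)) / 1000
lemma mu_pos : 0 < mu := by unfold mu; have := del_pos; positivity
lemma mu_exp : mu * Real.exp (8 * Real.pi) = del / 1000 := by
  unfold mu
  rw [Real.exp_neg]; field_simp

lemma exp_wt (Y : ℝ) (h : 0 ≤ Y) : Real.exp (-(2 * Real.pi * Y)) ≤ wt Y := by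
  unfold wt
  rw [Real.exp_neg]
  apply inv_anti₀ (by positivity)
  have h1 := Real.quadratic_le_exp_of_nonneg (x := 2 * Real.pi * Y) (by positivity)
  have h3 := Real.pi_gt_three
  have : Y^2 ≤ (2 * Real.pi * Y)^2/2 := by
    have : (2 * Real.pi * Y)^2/2 = 2 * Real.pi^2 * Y^2 := by ring
    rw [this]
    have h4 : 1 ≤ 2 * Real.pi^2 := by nlinarith
    nlinarith [sq_nonneg Y]
  have : 0 ≤ 2 * Real.pi * Y := by positivity
  linarith

lemma halfplane_cauchy (f : ℂ → ℂ) (a B : ℝ)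
    (hd : DifferentiableOn ℂ f {τ | a < τ.im})
    (hb : ∀ τ : ℂ, a < τ.im → ‖f τ‖ ≤ B * Real.exp (-(2 * Real.pi * τ.im))) :
    ∀ τ : ℂ, a + 1 < τ.im →
      ‖deriv f τ‖ ≤ B * Real.exp (2 * Real.pi) * Real.exp (-(2 * Real.pi * τ.im)) := by
  intro τ hτ
  have im1 : ∀ z ∈ closedBall τ 1, τ.im - 1 ≤ z.im := by
    intro z hz
    rw [mem_closedBall, dist_eq_norm] at hz
    have := (Complex.abs_im_le_norm _).trans hz
    rw [Complex.sub_im, abs_le] at this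
    linarith [this.1]
  have hB : 0 ≤ B := by
    have := (norm_nonneg _).trans (hb τ (by linarith))
    exact nonneg_of_mul_nonneg_left this (Real.exp_pos _)
  have := Complex.norm_deriv_le_of_forall_mem_sphere_norm_le (c := τ) (R := 1) (f := f)
    (C := B * Real.exp (2 * Real.pi) * Real.exp (-(2 * Real.pi * τ.im))) one_pos
    (by
      apply DifferentiableOn.diffContOnCl
      rw [closure_ball _ one_ne_zero]
      intro z hz
      exact (hd z (show a < z.im by linarith [im1 z hz])).mono (fun u hu => by
        show a < u.im
        linarith [im1 u hu]))
    (by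
      intro z hz
      have h1 := im1 z (sphere_subset_closedBall hz)
      refine (hb z (by linarith)).trans ?_
      rw [mul_assoc B, ← Real.exp_add]
      gcongr
      have := Real.pi_pos
      nlinarith)
  simpa using this

lemma eta_ex (ω : ℝ) (G : ℂ → ℂ) (hG : Cls ω G) : ∃ η : ℂ → ℂ,
    DifferentiableOn ℂ η (ball 0 (1/406)) ∧ (∀ q ∈ ball (0:ℂ) (1/406), ‖η q‖ ≤ 100 * ‖q‖) ∧
    ∀ q ∈ ball (0:ℂ) (1/406), G q = q * ee ω * ee (η (ee ω * q)) := by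
  have n1 := ee_norm_real ω
  have hb0 : ball (0:ℂ) 1 ∈ 𝓝 (0:ℂ) := ball_mem_nhds _ one_pos
  set g := dslope G 0 with hg
  have gd : DifferentiableOn ℂ g (ball 0 1) :=
    (Complex.differentiableOn_dslope hb0).2 hG.diff
  have g0 : g 0 = ee ω := by rw [hg, dslope_same, hG.der]
  have gb : ∀ z ∈ ball (0:ℂ) 1, ‖g z‖ ≤ 201 := by
    intro z hz
    have := Complex.norm_dslope_le_div_of_mapsTo_ball (f := G) (c := 0) (R₁ := 1) (R₂ := 201)
      hG.diff (by
        intro w hw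
        rw [hG.zero, mem_closedBall_zero_iff]
        linarith [hG.bd w hw]) hz
    simpa using this
  have geq : ∀ z, G z = z * g z := by
    intro z
    have := sub_smul_dslope G 0 z
    rw [hG.zero, sub_zero, sub_zero, smul_eq_mul] at this
    exact this.symm
  set k : ℂ → ℂ := fun q => g (q / ee ω) / ee ω with hk
  have md : ∀ q ∈ ball (0:ℂ) 1, q / ee ω ∈ ball (0:ℂ) 1 := by
    intro q hq
    rw [mem_ball_zero_iff] at *
    rw [norm_div, n1, div_one]; exact hq
  have kd : DifferentiableOn ℂ k (ball 0 1) :=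
    (gd.comp (by fun_prop) md).div_const _
  have k0 : k 0 = 1 := by simp [hk, g0, ee_ne]
  have kb : ∀ q ∈ ball (0:ℂ) 1, ‖k q - 1‖ ≤ 203 * ‖q‖ := by
    intro q hq
    have := Complex.dist_le_div_mul_dist_of_mapsTo_ball (f := k) (c := 0) (R₁ := 1) (R₂ := 203)
      kd (by
        intro w hw
        rw [k0, mem_closedBall, dist_eq_norm]
        have h1 := gb _ (md w hw)
        have h2 : ‖k w‖ ≤ 201 := by rw [hk]; simp only; rw [norm_div, n1, div_one]; exact h1
        have := norm_sub_le (k w) 1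
        rw [norm_one] at this
        linarith) hq
    rw [k0, dist_eq_norm, dist_zero_right] at this
    simpa using this
  have sm : ∀ q ∈ ball (0:ℂ) (1/406), ‖k q - 1‖ ≤ 1/2 ∧ q ∈ ball (0:ℂ) 1 := by
    intro q hq
    have h1 : q ∈ ball (0:ℂ) 1 := ball_subset_ball (by norm_num) hq
    refine ⟨(kb q h1).trans ?_, h1⟩
    rw [mem_ball_zero_iff] at hq
    linarith
  have sl : ∀ q ∈ ball (0:ℂ) (1/406), k q ∈ Complex.slitPlane := by
    intro q hq
    have := Complex.mem_slitPlane_of_norm_lt_one (z := k q - 1) (by linarith [(sm q hq).1])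
    rwa [add_sub_cancel] at this
  have pi3 := Real.pi_gt_three
  have hpi : (2 * Real.pi * Complex.I : ℂ) ≠ 0 := Complex.two_pi_I_ne_zero
  refine ⟨fun q => Complex.log (k q) / (2 * Real.pi * Complex.I), ?_, ?_, ?_⟩
  · apply DifferentiableOn.div_const
    exact (kd.mono (ball_subset_ball (by norm_num))).clog sl
  · intro q hq
    rw [norm_div]
    have h1 := Complex.norm_log_one_add_half_le_self (sm q hq).1
    rw [add_sub_cancel] at h1
    have h2 : ‖(2 * Real.pi * Complex.I : ℂ)‖ = 2 * Real.pi := by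
      simp [abs_of_pos Real.pi_pos]
    rw [h2, div_le_iff₀ (by positivity)]
    have h3 := kb q (sm q hq).2
    have := norm_nonneg q
    nlinarith
  · intro q hq
    have hq' : ee ω * q ∈ ball (0:ℂ) (1/406) := by
      rw [mem_ball_zero_iff] at *
      rw [norm_mul, n1, one_mul]; exact hq
    have : ee (Complex.log (k (ee ω * q)) / (2 * Real.pi * Complex.I)) = k (ee ω * q) := by
      unfold ee
      rw [mul_div_cancel₀ _ hpi]
      exact Complex.exp_log (Complex.slitPlane_ne_zero (sl _ hq'))
    simp only
    rw [this, hk]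
    simp only
    rw [mul_div_cancel_left₀ _ (ee_ne _), geq]
    field_simp [ee_ne]

lemma ee_diff : Differentiable ℂ ee := by unfold ee; fun_prop

theorem yex (ω : ℝ) (G : ℂ → ℂ) (hG : Cls ω G) : ∃ y y1 y2 y3 : ℂ → ℂ, YD y y1 y2 y3 ∧
    ∀ τ : ℂ, 0 ≤ τ.im → mu * ee (τ + ω + y (τ + ω)) = G (mu * ee τ) := by
  obtain ⟨η, ηd, ηb, ηe⟩ := eta_ex ω G hG
  have pi3 := Real.pi_gt_three
  have mp := mu_pos
  have qn : ∀ τ : ℂ, ‖(mu : ℂ) * ee τ‖ = mu * Real.exp (-(2 * Real.pi * τ.im)) := by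
    intro τ; rw [norm_mul, ee_norm, Complex.norm_real, Real.norm_of_nonneg mp.le]
  have small : ∀ τ : ℂ, -4 < τ.im → (mu : ℂ) * ee τ ∈ ball (0:ℂ) (1/406) := by
    intro τ hτ
    rw [mem_ball_zero_iff, qn]
    have h1 : Real.exp (-(2 * Real.pi * τ.im)) ≤ Real.exp (8 * Real.pi) := by
      apply Real.exp_le_exp.2; nlinarith
    have h2 : mu * Real.exp (-(2 * Real.pi * τ.im)) ≤ mu * Real.exp (8 * Real.pi) := by gcongr
    rw [mu_exp] at h2
    linarith [del_le]
  set y : ℂ → ℂ := fun τ => η (mu * ee τ) with hy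
  have op : ∀ a : ℝ, IsOpen {τ : ℂ | a < τ.im} := fun a => isOpen_lt continuous_const Complex.continuous_im
  have yd : DifferentiableOn ℂ y {τ | -4 < τ.im} := by
    apply ηd.comp
    · exact (ee_diff.const_mul _).differentiableOn
    · intro τ hτ; exact small τ hτ
  have yd1 : DifferentiableOn ℂ (deriv y) {τ | -4 < τ.im} := yd.deriv (op _)
  have yd2 : DifferentiableOn ℂ (deriv (deriv y)) {τ | -4 < τ.im} := yd1.deriv (op _)
  have yd3 : DifferentiableOn ℂ (deriv (deriv (deriv y))) {τ | -4 < τ.im} := yd2.deriv (op _)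
  have b0 : ∀ τ : ℂ, -4 < τ.im → ‖y τ‖ ≤ (100 * mu) * Real.exp (-(2 * Real.pi * τ.im)) := by
    intro τ hτ
    have := ηb _ (small τ hτ)
    rw [qn] at this
    rw [mul_assoc]; exact this
  have sub : ∀ a : ℝ, -4 ≤ a → {τ : ℂ | a < τ.im} ⊆ {τ | -4 < τ.im} := fun a ha τ h => lt_of_le_of_lt ha h
  have b1 := halfplane_cauchy y (-4) _ yd b0
  have b2 := halfplane_cauchy (deriv y) (-4+1) _ (yd1.mono (sub _ (by norm_num))) b1
  have b3 := halfplane_cauchy (deriv (deriv y)) (-4+1+1) _ (yd2.mono (sub _ (by norm_num))) b2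
  have fin : ∀ (z : ℂ) (τ : ℂ) (c : ℝ), 0 ≤ τ.im → c ≤ 8 * Real.pi →
      ‖z‖ ≤ 100 * mu * Real.exp c * Real.exp (-(2 * Real.pi * τ.im)) → ‖z‖ ≤ del * wt τ.im := by
    intro z τ c h hc hz
    refine hz.trans ?_
    have h1 := exp_wt _ h
    have h2 : 100 * mu * Real.exp c ≤ 100 * (mu * Real.exp (8 * Real.pi)) := by
      rw [mul_assoc]; gcongr
    rw [mu_exp] at h2
    have h3 : 100 * mu * Real.exp c ≤ del := by linarith [del_pos]
    have := del_pos
    gcongr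
  have D : ∀ f : ℂ → ℂ, DifferentiableOn ℂ f {τ | -4 < τ.im} → ∀ τ : ℂ, -1 < τ.im →
      HasDerivAt f (deriv f τ) τ := by
    intro f hf τ hτ
    exact (hf.differentiableAt ((op _).mem_nhds (show -4 < τ.im by linarith))).hasDerivAt
  refine ⟨y, deriv y, deriv (deriv y), deriv (deriv (deriv y)), ⟨?_, ?_, ?_, ?_, ?_, ?_, ?_, ?_, ?_⟩, ?_⟩
  · exact D _ yd
  · exact D _ yd1
  · exact D _ yd2
  · exact (yd3.mono (sub (-1) (by norm_num))).continuousOn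
  · intro τ; simp only [hy]; rw [ee_add, ee_one, mul_one]
  · intro τ h
    refine fin _ τ 0 h (by positivity) ?_
    rw [Real.exp_zero, mul_one]; exact b0 τ (by linarith)
  · intro τ h
    exact fin _ τ (2 * Real.pi) h (by linarith) (b1 τ (by linarith))
  · intro τ h
    refine fin _ τ (2 * Real.pi + 2 * Real.pi) h (by linarith) ?_
    have := b2 τ (by linarith)
    rw [Real.exp_add, ← mul_assoc]; exact this
  · intro τ h
    refine fin _ τ (2 * Real.pi + 2 * Real.pi + 2 * Real.pi) h (by linarith) ?_
    have := b3 τ (by linarith)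
    rw [Real.exp_add, Real.exp_add, ← mul_assoc, ← mul_assoc]; exact this
  · intro τ h
    rw [ηe _ (small τ (by linarith)), ee_add, ee_add]
    simp only [hy]
    rw [ee_add]
    ring_nf

end SQB

namespace SQB
open MeasureTheory Filter Topology

lemma cusp (α : ℝ) (h0 : 0 < α) (f : ℂ → ℂ) (hf : ∀ x, f (x + (1/α : ℝ)) = f x) :
    ∃ g : ℂ → ℂ, (∀ x, g (ee (α * x)) = f x) ∧
      (∀ x, DifferentiableAt ℂ f x → DifferentiableAt ℂ g (ee (α * x))) ∧
      ∀ L, (∀ᶠ z in comap Complex.im atTop, DifferentiableAt ℂ f z) →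
        Tendsto f (comap Complex.im atTop) (𝓝 L) → DifferentiableAt ℂ g 0 ∧ g 0 = L := by
  have hh : 0 < 1/α := by positivity
  have q : ∀ x, Periodic.qParam (1/α) x = ee (α * x) := by
    intro x
    unfold Periodic.qParam ee
    congr 1
    push_cast
    have : (α : ℂ) ≠ 0 := by exact_mod_cast h0.ne'
    field_simp
  have hp : Periodic f ((1/α : ℝ) : ℂ) := hf
  refine ⟨Periodic.cuspFunction (1/α) f, ?_, ?_, ?_⟩
  · intro x
    rw [← q]; exact Periodic.eq_cuspFunction hh.ne' hp x
  · intro x hx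
    rw [← q]; exact Periodic.differentiableAt_cuspFunction hh.ne' hp hx
  · intro L h1 h2
    have hb : BoundedAtFilter (comap Complex.im atTop) f := by
      unfold BoundedAtFilter
      exact h2.isBigO_one ℝ
    refine ⟨Periodic.differentiableAt_cuspFunction_zero hh hp h1 hb, ?_⟩
    have := Periodic.tendsto_at_I_inf hh hp h1 hb
    have ne : NeBot (comap Complex.im atTop) := by
      apply comap_neBot
      intro t ht
      obtain ⟨r, hr⟩ := Filter.nonempty_of_mem ht
      exact ⟨⟨0, r⟩, hr⟩
    exact tendsto_nhds_unique this h2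

lemma remov (f : ℂ → ℂ) (p : ℂ) (B : ℝ)
    (hd : ∀ z ∈ ball (0:ℂ) 1, z ≠ p → DifferentiableAt ℂ f z)
    (hb : ∀ z ∈ ball (0:ℂ) 1, z ≠ p → ‖f z‖ ≤ B) : ∃ g : ℂ → ℂ,
    DifferentiableOn ℂ g (ball 0 1) ∧ (∀ z ∈ ball (0:ℂ) 1, ‖g z‖ ≤ B) ∧ ∀ z, z ≠ p → g z = f z := by
  by_cases hp : p ∈ ball (0:ℂ) 1
  · set g := update f p (limUnder (𝓝[≠] p) f) with hg
    have hn : ball (0:ℂ) 1 ∈ 𝓝 p := isOpen_ball.mem_nhds hp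
    have gd : DifferentiableOn ℂ g (ball 0 1) :=
      Complex.differentiableOn_update_limUnder_of_bddAbove hn
        (fun z hz => (hd z hz.1 hz.2).differentiableWithinAt)
        ⟨B, by rintro _ ⟨z, hz, rfl⟩; exact hb z hz.1 hz.2⟩
    have ge : ∀ z, z ≠ p → g z = f z := fun z hz => update_of_ne hz _ _
    refine ⟨g, gd, ?_, ge⟩
    intro z hz
    by_cases h : z = p
    · have hc : Tendsto g (𝓝[≠] p) (𝓝 (g p)) :=
        ((gd.differentiableAt hn).continuousAt.tendsto).mono_left nhdsWithin_le_nhds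
      rw [h]
      refine le_of_tendsto hc.norm ?_
      filter_upwards [self_mem_nhdsWithin, nhdsWithin_le_nhds hn] with u h1 h2
      rw [ge u h1]; exact hb u h2 h1
    · rw [ge z h]; exact hb z hz h
  · have ne : ∀ z ∈ ball (0:ℂ) 1, z ≠ p := fun z hz h => hp (h ▸ hz)
    exact ⟨f, fun z hz => (hd z hz (ne z hz)).differentiableWithinAt,
      fun z hz => hb z hz (ne z hz), fun z _ => rfl⟩

lemma exp_sub_one_le (z : ℂ) : ‖Complex.exp z - 1‖ ≤ ‖z‖ * Real.exp ‖z‖ := by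
  have := Complex.norm_exp_sub_sum_le_norm_mul_exp z 1
  simpa using this

lemma exp_four : Real.exp (2 * Real.pi) ≤ 600 := by
  have h1 : Real.exp (2 * Real.pi) ≤ Real.exp (1/3.5) ^ 22 := by
    rw [← Real.exp_nat_mul]
    apply Real.exp_le_exp.2
    have := Real.pi_lt_d4
    norm_num; linarith
  have h2 : Real.exp (1/3.5) ≤ 1.3335 := by
    have := Real.exp_bound' (x := 1/3.5) (by norm_num) (by norm_num) (n := 4) (by norm_num)
    refine this.trans ?_
    norm_num [Finset.sum_range_succ, Nat.factorial]
  refine h1.trans ((pow_le_pow_left₀ (Real.exp_pos _).le h2 22).trans ?_)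
  norm_num

/-- puncture centre -/
noncomputable def xc : ℂ := -1/4 + Complex.I
noncomputable def VV (α : ℝ) (x : ℂ) : ℂ := ee (α * (x - xc))
/-- coordinate -/
noncomputable def UU (α : ℝ) (x : ℂ) : ℂ := VV α x / (1 - VV α x) * (10000 * α)

theorem descend (α : ℝ) (h0 : 0 < α) (h2 : α < 1/2) (y w F : ℂ → ℂ) (hp : Pkg (1/α) y w F) :
    ∃ G, Cls α G ∧ ∀ x : ℂ, VV α x ≠ 1 → ‖UU α x‖ < 1 → G (UU α x) = UU α (F x) := by
  have αne : (α : ℂ) ≠ 0 := by exact_mod_cast h0.ne'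
  have pi3 := Real.pi_gt_three
  have pi4 := Real.pi_lt_d4
  have n2 : ∀ z : ℂ, ‖2 * Real.pi * Complex.I * z‖ = 2 * Real.pi * ‖z‖ := by
    intro z; simp [abs_of_pos Real.pi_pos]
  set f : ℂ → ℂ := fun x => ee (α * (F (x + xc) - (x + xc))) with hf
  have fper : ∀ x, f (x + (1/α : ℝ)) = f x := by
    intro x
    simp only [hf]
    have : x + (1/α : ℝ) + xc = (x + xc) + (1/α : ℝ) := by ring
    rw [this, hp.Fper]
    congr 2; ring
  have Fn : ∀ x, ‖F x - x‖ ≤ 11/10 := by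
    intro x
    have : F x - x = (F x - x - 1) + 1 := by ring
    rw [this]
    refine (norm_add_le _ _).trans ?_
    rw [norm_one]; linarith [hp.Fb x]
  have fb : ∀ x, ‖f x‖ ≤ 2 := by
    intro x
    simp only [hf]
    rw [ee_norm]
    have h1 := (Complex.abs_im_le_norm _).trans (hp.Fb (x + xc))
    rw [abs_le] at h1
    have h3 : ((α : ℂ) * (F (x + xc) - (x + xc))).im = α * (F (x + xc) - (x+xc) - 1).im := by
      simp
    rw [h3]
    have h4 : α * (-(1/10)) ≤ α * (F (x + xc) - (x+xc) - 1).im := by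
      apply mul_le_mul_of_nonneg_left _ h0.le
      linarith [h1.1]
    have h5 := Real.log_two_gt_d9
    calc _ ≤ Real.exp (Real.log 2) := Real.exp_le_exp.2 (by nlinarith)
      _ = 2 := Real.exp_log (by norm_num)
  have fb1 : ∀ x, ‖1 - f x‖ ≤ 400 * α := by
    intro x
    rw [norm_sub_rev]
    simp only [hf, ee]
    refine (exp_sub_one_le _).trans ?_
    rw [n2, norm_mul, Complex.norm_real, Real.norm_of_nonneg h0.le]
    have h1 := Fn (x + xc)
    have h4 : α * ‖F (x + xc) - (x + xc)‖ ≤ α * (11/10) := by gcongr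
    have h3 : 2 * Real.pi * (α * ‖F (x + xc) - (x + xc)‖) ≤ 7 * α := by nlinarith
    have h5 : Real.exp (2 * Real.pi * (α * ‖F (x + xc) - (x + xc)‖)) ≤ 55 := by
      calc _ ≤ Real.exp (7/2) := Real.exp_le_exp.2 (by linarith)
        _ ≤ Real.exp 1 ^ 4 := by rw [← Real.exp_nat_mul]; apply Real.exp_le_exp.2; norm_num
        _ ≤ 2.7182818286 ^ 4 := pow_le_pow_left₀ (Real.exp_pos _).le Real.exp_one_lt_d9.le 4
        _ ≤ 55 := by norm_num
    calc _ ≤ 7 * α * 55 := by gcongr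
      _ ≤ 400 * α := by nlinarith
  obtain ⟨g, g1, g2, g3⟩ := cusp α h0 f fper
  have fd : ∀ x : ℂ, (∀ k : ℤ, 2 ≤ ‖x - k * (1/α : ℝ)‖) → DifferentiableAt ℂ f x := by
    intro x hx
    have h1 : DifferentiableAt ℂ F (x + xc) := hp.Fd _ (fun k => by
      have : x + xc - k * (1/α : ℝ) - (-1/4 + Complex.I) = x - k * (1/α : ℝ) := by
        unfold xc; ring
      rw [this]; exact hx k)
    have h3 : DifferentiableAt ℂ (fun x => F (x + xc)) x :=
      DifferentiableAt.comp (g := F) (f := fun x => x + xc) x h1 (by fun_prop)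
    exact ee_diff.differentiableAt.comp x (by fun_prop)
  have ftop : Tendsto f (comap Complex.im atTop) (𝓝 (ee α)) := by
    have t1 : Tendsto (fun x : ℂ => x + xc) (comap Complex.im atTop) (comap Complex.im atTop) :=
      im_tend _ ‖xc‖ (fun z => by simp)
    have t2 := hp.Ftop.comp t1
    have t3 : Tendsto (fun x => (α : ℂ) * (F (x + xc) - (x + xc))) (comap Complex.im atTop) (𝓝 α) := by
      have := (t2.add_const 1).const_mul (α : ℂ)
      rw [zero_add, mul_one] at this
      refine this.congr (fun x => ?_)
      simp only [comp_apply]; ring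
    exact (ee_diff.continuous.tendsto _).comp t3
  have fdev : ∀ᶠ z in comap Complex.im atTop, DifferentiableAt ℂ f z := by
    have : ∀ᶠ z : ℂ in comap Complex.im atTop, 2 ≤ z.im := (eventually_ge_atTop 2).comap _
    filter_upwards [this] with z hz
    apply fd
    intro k
    refine le_trans ?_ (Complex.abs_im_le_norm _)
    have : (z - k * (1/α : ℝ)).im = z.im := by
      have : (k : ℂ) * (1/α : ℝ) = ((k * (1/α) : ℝ) : ℂ) := by push_cast; ring
      rw [this, Complex.sub_im, Complex.ofReal_im, sub_zero]
    rw [this]; exact hz.trans (le_abs_self _)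
  obtain ⟨gd0, g0⟩ := g3 _ fdev ftop
  have surj : ∀ V : ℂ, V ≠ 0 → ∃ x : ℂ, ee (α * x) = V := by
    intro V hV
    refine ⟨Complex.log V / (2 * Real.pi * Complex.I) / α, ?_⟩
    rw [mul_div_cancel₀ _ αne]
    unfold ee
    rw [mul_div_cancel₀ _ Complex.two_pi_I_ne_zero, Complex.exp_log hV]
  have gb : ∀ V, ‖g V‖ ≤ 2 ∧ ‖1 - g V‖ ≤ 400 * α := by
    intro V
    by_cases hV : V = 0
    · rw [hV, g0]
      have : NeBot (comap Complex.im atTop) := by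
        apply comap_neBot
        intro t ht
        obtain ⟨r, hr⟩ := Filter.nonempty_of_mem ht
        exact ⟨⟨0, r⟩, hr⟩
      exact ⟨le_of_tendsto ftop.norm (Eventually.of_forall fb),
        le_of_tendsto (ftop.const_sub 1).norm (Eventually.of_forall fb1)⟩
    · obtain ⟨x, rfl⟩ := surj V hV
      rw [g1]; exact ⟨fb x, fb1 x⟩
  have gdiff : ∀ V, (V = 0 ∨ α * 10000 ≤ ‖1/V - 1‖) → DifferentiableAt ℂ g V := by
    intro V hV
    by_cases h : V = 0
    · rw [h]; exact gd0
    have hV := hV.resolve_left h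
    obtain ⟨x, rfl⟩ := surj V h
    apply g2
    apply fd
    intro k
    by_contra hlt
    push Not at hlt
    set z := x - k * (1/α : ℝ) with hz
    have e1 : 1 / ee (α * x) = ee (-(α * z)) := by
      rw [ee_neg, one_div]
      congr 1
      have : (α * x : ℂ) = α * z + k := by
        rw [hz]; push_cast; field_simp; ring
      rw [this, ee_add_int]
    rw [e1] at hV
    have h1 := exp_sub_one_le (2 * Real.pi * Complex.I * (-(α * z)))
    rw [n2, norm_neg, norm_mul, Complex.norm_real, Real.norm_of_nonneg h0.le] at h1
    have h3 : α * ‖z‖ ≤ α * 2 := by gcongr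
    have h4 : Real.exp (2 * Real.pi * (α * ‖z‖)) ≤ 600 := by
      refine le_trans (Real.exp_le_exp.2 ?_) exp_four
      nlinarith
    have h5 : 2 * Real.pi * (α * ‖z‖) ≤ 2 * Real.pi * (α * 2) := by gcongr
    have h6 : 2 * Real.pi * (α * ‖z‖) * Real.exp (2 * Real.pi * (α * ‖z‖)) ≤ 2 * Real.pi * (α * 2) * 600 := by
      gcongr
    have : α * 10000 ≤ 2 * Real.pi * (α * 2) * 600 := hV.trans (h1.trans h6)
    nlinarith
  -- the descended map
  set κ : ℂ := 10000 * α with hκ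
  have κne : κ ≠ 0 := by rw [hκ]; simp [αne]
  have κn : ‖κ‖ = 10000 * α := by
    rw [hκ]; simp [abs_of_pos h0]
  set D : ℂ → ℂ := fun z => 1 + z / κ * (1 - g (z / κ / (1 + z / κ))) with hD
  set G0 : ℂ → ℂ := fun z => z * g (z / κ / (1 + z / κ)) / D z with hG0
  have Dn : ∀ z ∈ ball (0:ℂ) 1, 1/2 ≤ ‖D z‖ := by
    intro z hz
    rw [mem_ball_zero_iff] at hz
    have h1 := (gb (z / κ / (1 + z / κ))).2
    have h3 : ‖z / κ * (1 - g (z / κ / (1 + z / κ)))‖ ≤ 1/2 := by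
      rw [norm_mul, norm_div, κn]
      calc ‖z‖ / (10000 * α) * ‖1 - g (z / κ / (1 + z / κ))‖ ≤ 1 / (10000 * α) * (400 * α) := by gcongr
        _ = 400/10000 := by field_simp
        _ ≤ 1/2 := by norm_num
    have h4 := norm_sub_norm_le (1:ℂ) (-(z / κ * (1 - g (z / κ / (1 + z / κ)))))
    rw [norm_neg, norm_one, sub_neg_eq_add] at h4
    simp only [hD]
    linarith
  have Dne : ∀ z ∈ ball (0:ℂ) 1, D z ≠ 0 := by
    intro z hz h
    have := Dn z hz
    rw [h, norm_zero] at this; linarith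
  have gz : ∀ z ∈ ball (0:ℂ) 1, z ≠ -κ → DifferentiableAt ℂ (fun z => g (z / κ / (1 + z / κ))) z := by
    intro z hz hk
    have h1 : 1 + z / κ ≠ 0 := by
      intro h
      apply hk
      field_simp at h
      linear_combination h
    refine DifferentiableAt.comp (g := g) (f := fun z => z / κ / (1 + z / κ)) z (gdiff _ ?_) ?_
    · by_cases h : z = 0
      · left; simp [h]
      right
      have : 1 / (z / κ / (1 + z / κ)) - 1 = κ / z := by field_simp; ring
      rw [this, norm_div, κn, le_div_iff₀ (norm_pos_iff.2 h)]
      rw [mem_ball_zero_iff] at hz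
      nlinarith
    · exact (differentiableAt_id.div_const _).div (by fun_prop) h1
  have Gd : ∀ z ∈ ball (0:ℂ) 1, z ≠ -κ → DifferentiableAt ℂ G0 z := by
    intro z hz hk
    have := gz z hz hk
    refine DifferentiableAt.div (differentiableAt_id.mul this) ?_ (Dne z hz)
    exact ((differentiableAt_id.div_const _).mul (this.const_sub 1)).const_add 1
  have Gb : ∀ z ∈ ball (0:ℂ) 1, z ≠ -κ → ‖G0 z‖ ≤ 200 := by
    intro z hz hk
    have h1 := Dn z hz
    have h3 := (gb (z / κ / (1 + z / κ))).1
    rw [mem_ball_zero_iff] at hz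
    simp only [hG0]
    rw [norm_div, div_le_iff₀ (by linarith), norm_mul]
    have : ‖z‖ * ‖g (z / κ / (1 + z / κ))‖ ≤ 1 * 2 := by gcongr
    linarith
  obtain ⟨G, G1, G2, G3⟩ := remov G0 (-κ) 200 Gd Gb
  have κ0 : (0:ℂ) ≠ -κ := by simpa [eq_comm] using κne
  have z0 : (0:ℂ) ∈ ball (0:ℂ) 1 := mem_ball_self one_pos
  refine ⟨G, ⟨G1, G2, ?_, ?_⟩, ?_⟩
  · rw [G3 _ κ0]; simp [hG0]
  · have ev : G =ᶠ[𝓝 0] G0 := by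
      filter_upwards [isOpen_ne.mem_nhds κ0] with z hz
      exact G3 z hz
    rw [ev.deriv_eq]
    have h1 := gz 0 z0 κ0
    have h3 : HasDerivAt (fun z => g (z / κ / (1 + z / κ)) / D z)
        (deriv (fun z => g (z / κ / (1 + z / κ)) / D z) 0) 0 := by
      refine DifferentiableAt.hasDerivAt (DifferentiableAt.div h1 ?_ (Dne 0 z0))
      exact ((differentiableAt_id.div_const _).mul (h1.const_sub 1)).const_add 1
    have h4 := (hasDerivAt_id (0:ℂ)).mul h3
    have h5 : G0 = id * (fun z => g (z / κ / (1 + z / κ)) / D z) := by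
      funext z; simp only [hG0, Pi.mul_apply, id]; ring
    rw [h5, h4.deriv]
    simp [hD, g0]
  · intro x hx hu
    have hV : 1 - VV α x ≠ 0 := sub_ne_zero.2 hx.symm
    set V := VV α x with hVd
    have Vne : V ≠ 0 := ee_ne _
    have e1 : UU α x / κ = V / (1 - V) := by
      unfold UU; rw [← hκ, mul_div_assoc, div_self κne, mul_one]
    have e2 : UU α x / κ / (1 + UU α x / κ) = V := by
      rw [e1]; field_simp; ring
    have hne : UU α x ≠ -κ := by
      intro h
      rw [h, neg_div, div_self κne] at e1
      field_simp at e1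
      ring_nf at e1
      simp at e1
    have gv : g V = f (x - xc) := by rw [hVd]; unfold VV; rw [g1]
    have vf : VV α (F x) = V * g V := by
      rw [gv, hVd, hf]
      simp only [sub_add_cancel]
      unfold VV
      rw [← ee_add]; congr 1; ring
    rw [G3 _ hne]
    simp only [hG0, hD]
    rw [e2, e1]
    have hD' := Dne (UU α x) (by rw [mem_ball_zero_iff]; exact hu)
    simp only [hD] at hD'
    rw [e2, e1] at hD'
    unfold UU
    rw [vf, ← hVd, ← hκ]
    have : 1 + V / (1 - V) * (1 - g V) = (1 - V * g V) / (1 - V) := by field_simp; ring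
    rw [this] at hD' ⊢
    have h6 : 1 - V * g V ≠ 0 := fun h => hD' (by rw [h, zero_div])
    field_simp

end SQB

namespace SQB
open MeasureTheory Filter Topology

lemma Lin_mono (α r r' : ℝ) (hr : r' ≤ r) (h : Lin α r) : Lin α r' := by
  intro G hG
  obtain ⟨φ, h1, h2, h3, h4, h5⟩ := h G hG
  exact ⟨φ, h1.mono (ball_subset_ball hr), h2, h3, fun z hz => h4 z (ball_subset_ball hr hz), h5⟩

/-- height -/
noncomputable def TT (α r : ℝ) : ℝ := 1 + Real.log (4100000 * α / r) / (2 * Real.pi * α)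

lemma VV_small (α r : ℝ) (h0 : 0 < α) (hr : 0 < r) (x : ℂ) (hx : TT α r < x.im) :
    ‖VV α x‖ < r / (4100000 * α) := by
  unfold VV
  rw [ee_norm]
  have e : ((α : ℂ) * (x - xc)).im = α * (x.im - 1) := by
    unfold xc; simp
  rw [e, ← Real.exp_log (show 0 < r / (4100000 * α) by positivity)]
  apply Real.exp_lt_exp.2
  have : r / (4100000 * α) = (4100000 * α / r)⁻¹ := by field_simp
  rw [this, Real.log_inv, neg_lt_neg_iff]
  unfold TT at hx
  have h1 : Real.log (4100000 * α / r) / (2 * Real.pi * α) < x.im - 1 := by linarith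
  rw [div_lt_iff₀ (by have := Real.pi_pos; positivity)] at h1
  linarith

theorem ell (α : ℝ) (h0 : 0 < α) (h2 : α < 1/2) (y w F : ℂ → ℂ) (hp : Pkg (1/α) y w F)
    (r : ℝ) (hr : 0 < r) (hL : Lin α r) : ∃ ℓ : ℂ → ℂ,
      (∀ x : ℂ, TT α r < x.im → DifferentiableAt ℂ ℓ x) ∧
      (∀ x : ℂ, TT α r < x.im → ‖ℓ x - x‖ ≤ 0.13 / α) ∧
      (∀ x, ℓ (x + (1/α : ℝ)) = ℓ x + (1/α : ℝ)) ∧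
      (∀ x, TT α r < x.im → TT α r < (F x).im → ℓ (F x) = ℓ x + 1) ∧
      Tendsto (fun x => ℓ x - x) (comap Complex.im atTop) (𝓝 0) := by
  have rα := Lin_cremer α r h0 h2 hL
  have αne : (α : ℂ) ≠ 0 := by exact_mod_cast h0.ne'
  have pi3 := Real.pi_gt_three
  obtain ⟨G, hG, hGU⟩ := descend α h0 h2 y w F hp
  obtain ⟨φ, φd, φ0, φ1, φb, φe⟩ := hL G hG
  set d := dslope φ 0 with hd
  have hn : ball (0:ℂ) r ∈ 𝓝 (0:ℂ) := ball_mem_nhds _ hr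
  have dd : DifferentiableOn ℂ d (ball 0 r) := (Complex.differentiableOn_dslope hn).2 φd
  have d0 : d 0 = 1 := by rw [hd, dslope_same, φ1]
  have deq : ∀ z, φ z = z * d z := by
    intro z
    have := sub_smul_dslope φ 0 z
    rw [φ0, sub_zero, sub_zero, smul_eq_mul] at this
    exact this.symm
  have db : ∀ z ∈ ball (0:ℂ) r, ‖d z - 1‖ ≤ 1/2 := by
    intro z hz
    by_cases h : z = 0
    · rw [h, d0]; norm_num
    have h1 := φb z hz
    have : φ z - z = z * (d z - 1) := by rw [deq]; ring
    rw [this, norm_mul] at h1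
    have := norm_pos_iff.2 h
    nlinarith
  have ds : ∀ z ∈ ball (0:ℂ) r, d z ∈ Complex.slitPlane := by
    intro z hz
    have := Complex.mem_slitPlane_of_norm_lt_one (z := d z - 1) (by linarith [db z hz])
    rwa [add_sub_cancel] at this
  -- smallness
  have Vs : ∀ x : ℂ, TT α r < x.im → ‖VV α x‖ ≤ 1/1000000 := by
    intro x hx
    refine (VV_small α r h0 hr x hx).le.trans ?_
    rw [div_le_div_iff₀ (by positivity) (by norm_num)]
    linarith
  have V1 : ∀ x : ℂ, TT α r < x.im → 999999/1000000 ≤ ‖1 - VV α x‖ := by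
    intro x hx
    have := norm_sub_norm_le (1:ℂ) (VV α x)
    rw [norm_one] at this
    linarith [Vs x hx]
  have V1ne : ∀ x : ℂ, TT α r < x.im → 1 - VV α x ≠ 0 := by
    intro x hx h
    have := V1 x hx
    rw [h, norm_zero] at this; linarith
  have Us : ∀ x : ℂ, TT α r < x.im → ‖UU α x‖ < r / 400 := by
    intro x hx
    have h1 := V1 x hx
    have h3 := VV_small α r h0 hr x hx
    unfold UU
    rw [norm_mul, norm_div]
    have e : ‖(10000 * α : ℂ)‖ = 10000 * α := by simp [abs_of_pos h0]
    rw [e, div_mul_eq_mul_div, div_lt_iff₀ (by linarith)]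
    calc ‖VV α x‖ * (10000 * α) < r / (4100000 * α) * (10000 * α) := by gcongr
      _ = r / 410 := by field_simp; norm_num
      _ ≤ r / 400 * (999999/1000000) := by linarith
      _ ≤ r / 400 * ‖1 - VV α x‖ := by gcongr
  have Ub : ∀ x : ℂ, TT α r < x.im → UU α x ∈ ball (0:ℂ) r := by
    intro x hx
    rw [mem_ball_zero_iff]; linarith [Us x hx]
  -- functional equation on a ball
  have fe : ∀ z ∈ ball (0:ℂ) (r/400), φ (G z) = ee α * φ z := by
    have sub1 : ball (0:ℂ) (r/400) ⊆ ball 0 1 := ball_subset_ball (by linarith)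
    have sub2 : ball (0:ℂ) (r/400) ⊆ ball 0 r := ball_subset_ball (by linarith)
    have Gm : MapsTo G (ball (0:ℂ) (r/400)) (ball 0 r) := by
      intro z hz
      have := Complex.dist_le_div_mul_dist_of_mapsTo_ball (f := G) (c := 0) (R₁ := 1) (R₂ := 200)
        hG.diff (by
          intro w hw
          rw [hG.zero, mem_closedBall_zero_iff]
          exact hG.bd w hw) (sub1 hz)
      rw [hG.zero, dist_zero_right, dist_zero_right, div_one] at this
      rw [mem_ball_zero_iff] at *
      linarith
    have a1 : AnalyticOnNhd ℂ (fun z => φ (G z)) (ball 0 (r/400)) :=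
      DifferentiableOn.analyticOnNhd (φd.comp (hG.diff.mono sub1) Gm) isOpen_ball
    have a2 : AnalyticOnNhd ℂ (fun z => ee α * φ z) (ball 0 (r/400)) :=
      DifferentiableOn.analyticOnNhd ((φd.mono sub2).const_mul _) isOpen_ball
    exact a1.eqOn_of_preconnected_of_eventuallyEq a2 (convex_ball _ _).isPreconnected
      (mem_ball_self (by positivity)) φe
  have hpi : (2 * Real.pi * Complex.I : ℂ) ≠ 0 := Complex.two_pi_I_ne_zero
  have npi : ‖(2 * Real.pi * Complex.I * α : ℂ)‖ = 2 * Real.pi * α := by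
    simp [abs_of_pos Real.pi_pos, abs_of_pos h0]
  set ℓ : ℂ → ℂ := fun x => x + (Complex.log (d (UU α x)) - Complex.log (1 - VV α x)) /
    (2 * Real.pi * Complex.I * α) with hℓ
  have Vper : ∀ x, VV α (x + (1/α : ℝ)) = VV α x := by
    intro x
    unfold VV
    have : (α : ℂ) * (x + (1/α : ℝ) - xc) = α * (x - xc) + 1 := by push_cast; field_simp; ring
    rw [this, ee_add, ee_one, mul_one]
  have V1s : ∀ x : ℂ, TT α r < x.im → 1 - VV α x ∈ Complex.slitPlane := by
    intro x hx
    have := Complex.mem_slitPlane_of_norm_lt_one (z := - VV α x)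
      (by rw [norm_neg]; linarith [Vs x hx])
    rwa [← sub_eq_add_neg] at this
  have Vd : ∀ x, DifferentiableAt ℂ (VV α) x := by
    intro x
    exact ee_diff.differentiableAt.comp x (by fun_prop)
  have Ud : ∀ x : ℂ, TT α r < x.im → DifferentiableAt ℂ (UU α) x := by
    intro x hx
    exact ((Vd x).div ((Vd x).const_sub 1) (V1ne x hx)).mul_const _
  have ℓb : ∀ x : ℂ, TT α r < x.im → ‖ℓ x - x‖ ≤ 0.13 / α := by
    intro x hx
    have e : ℓ x - x = (Complex.log (d (UU α x)) - Complex.log (1 - VV α x)) /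
        (2 * Real.pi * Complex.I * α) := by simp only [hℓ]; ring
    rw [e, norm_div, npi, div_le_div_iff₀ (by positivity) h0]
    have h1 := Complex.norm_log_one_add_half_le_self (db _ (Ub x hx))
    have h3 := Complex.norm_log_one_add_half_le_self (z := -VV α x)
      (by rw [norm_neg]; linarith [Vs x hx])
    rw [add_sub_cancel] at h1
    rw [← sub_eq_add_neg, norm_neg] at h3
    have h4 := norm_sub_le (Complex.log (d (UU α x))) (Complex.log (1 - VV α x))
    have h5 := db _ (Ub x hx)
    have h6 := Vs x hx
    have : ‖Complex.log (d (UU α x)) - Complex.log (1 - VV α x)‖ ≤ 0.76 := by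
      norm_num; linarith
    nlinarith
  have ℓe : ∀ x : ℂ, TT α r < x.im → 10000 * α * ee (α * (ℓ x - xc)) = φ (UU α x) := by
    intro x hx
    have e : (α : ℂ) * (ℓ x - xc) = α * (x - xc) + (Complex.log (d (UU α x)) -
        Complex.log (1 - VV α x)) / (2 * Real.pi * Complex.I) := by
      simp only [hℓ]; field_simp; ring
    have e2 : ee ((Complex.log (d (UU α x)) - Complex.log (1 - VV α x)) / (2 * Real.pi * Complex.I))
        = d (UU α x) / (1 - VV α x) := by
      unfold ee
      rw [mul_div_cancel₀ _ hpi, Complex.exp_sub,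
        Complex.exp_log (Complex.slitPlane_ne_zero (ds _ (Ub x hx))), Complex.exp_log (V1ne x hx)]
    rw [e, ee_add, e2, deq]
    change 10000 * (α:ℂ) * (VV α x * _) = _
    have := V1ne x hx
    unfold UU
    ring
  refine ⟨ℓ, ?_, ℓb, ?_, ?_, ?_⟩
  · intro x hx
    have h1 : DifferentiableAt ℂ (fun x => d (UU α x)) x :=
      (dd.differentiableAt (isOpen_ball.mem_nhds (Ub x hx))).comp x (Ud x hx)
    exact differentiableAt_id.add (((h1.clog (ds _ (Ub x hx))).sub
      (((Vd x).const_sub 1).clog (V1s x hx))).div_const _)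
  · intro x
    simp only [hℓ, UU]
    rw [Vper]; ring
  · intro x hx hFx
    have h1 := ℓe x hx
    have h3 := ℓe (F x) hFx
    rw [← hGU x (fun h => V1ne x hx (by rw [h, sub_self])) (by
      have := Us x hx; linarith), fe _ (by rw [mem_ball_zero_iff]; exact Us x hx), ← h1] at h3
    have h4 : ee (α * (ℓ (F x) - xc)) = ee (α + α * (ℓ x - xc)) := by
      rw [ee_add]
      have : (10000 * α : ℂ) ≠ 0 := by simp [αne]
      apply mul_left_cancel₀ this
      rw [h3]; ring
    obtain ⟨k, hk⟩ := ee_eq h4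
    have h5 : (α : ℂ) * (ℓ (F x) - ℓ x - 1) = k := by linear_combination hk
    have h6 : ‖(α : ℂ) * (ℓ (F x) - ℓ x - 1)‖ < 1 := by
      rw [norm_mul, Complex.norm_real, Real.norm_of_nonneg h0.le]
      have e : ℓ (F x) - ℓ x - 1 = (ℓ (F x) - F x) - (ℓ x - x) + (F x - x - 1) := by ring
      have := norm_add_le ((ℓ (F x) - F x) - (ℓ x - x)) (F x - x - 1)
      have := norm_sub_le (ℓ (F x) - F x) (ℓ x - x)
      have := ℓb x hx
      have := ℓb (F x) hFx
      have := hp.Fb x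
      have t : ‖ℓ (F x) - ℓ x - 1‖ ≤ 0.26 / α + 1/10 := by
        rw [e]
        have : (0.26 / α : ℝ) = 0.13 / α + 0.13 / α := by ring
        linarith
      calc α * ‖ℓ (F x) - ℓ x - 1‖ ≤ α * (0.26 / α + 1/10) := by gcongr
        _ = 0.26 + α / 10 := by field_simp
        _ < 1 := by norm_num; linarith
    rw [h5, Complex.norm_intCast] at h6
    have k0 : k = 0 := by
      have : |k| < 1 := by exact_mod_cast h6
      exact Int.abs_lt_one_iff.1 this
    rw [k0, Int.cast_zero] at h5
    have := (mul_eq_zero.1 h5).resolve_left αne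
    linear_combination this
  · have Vt : Tendsto (VV α) (comap Complex.im atTop) (𝓝 0) := by
      rw [tendsto_zero_iff_norm_tendsto_zero]
      have e : ∀ x, ‖VV α x‖ = Real.exp (-(2 * Real.pi * α * (x.im - 1))) := by
        intro x
        unfold VV
        rw [ee_norm]
        have e : ((α : ℂ) * (x - xc)).im = α * (x.im - 1) := by
          unfold xc; simp
        rw [e]; ring_nf
      simp only [e]
      apply Real.tendsto_exp_neg_atTop_nhds_zero.comp
      have : Tendsto Complex.im (comap Complex.im atTop) atTop := tendsto_comap
      exact (tendsto_atTop_add_const_right _ (-1) this).const_mul_atTop (by positivity)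
    have Ut : Tendsto (UU α) (comap Complex.im atTop) (𝓝 0) := by
      have := (Vt.div (Vt.const_sub 1) (by simp)).mul_const (10000 * α : ℂ)
      rw [sub_zero, zero_div, zero_mul] at this
      exact this
    have dt : Tendsto (fun x => d (UU α x)) (comap Complex.im atTop) (𝓝 1) := by
      rw [← d0]
      exact ((dd.differentiableAt hn).continuousAt.tendsto).comp Ut
    have l1 : Tendsto (fun x => Complex.log (d (UU α x))) (comap Complex.im atTop) (𝓝 0) := by
      have := dt.clog (by simp)
      simpa using this
    have l2 : Tendsto (fun x => Complex.log (1 - VV α x)) (comap Complex.im atTop) (𝓝 0) := by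
      have := (Vt.const_sub 1).clog (by simp)
      simpa using this
    have := (l1.sub l2).div_const (2 * Real.pi * Complex.I * α)
    rw [sub_zero, zero_div] at this
    refine this.congr (fun x => ?_)
    simp only [hℓ]; ring

end SQB

namespace SQB
open MeasureTheory Filter Topology

/-- 1-periodic extension from the strip -/
lemma per_ext (E : ℂ → ℂ) (T B : ℝ)
    (Ed : ∀ s : ℂ, -3/2 < s.re → s.re < 0 → T < s.im → DifferentiableAt ℂ E s)
    (Eb : ∀ s : ℂ, -3/2 < s.re → s.re < 0 → T < s.im → ‖E s‖ ≤ B)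
    (Ep : ∀ s : ℂ, -3/2 < s.re → s.re < -1 → T < s.im → E (s + 1) = E s)
    (Et : Tendsto E (comap Complex.im atTop) (𝓝 0)) :
    ∃ P : ℂ → ℂ, (∀ s, P (s + 1) = P s) ∧ (∀ s : ℂ, T < s.im → DifferentiableAt ℂ P s) ∧
      (∀ s : ℂ, T < s.im → ‖P s‖ ≤ B) ∧ Tendsto P (comap Complex.im atTop) (𝓝 0) ∧
      ∀ s : ℂ, -5/4 ≤ s.re → s.re < -1/4 → P s = E s := by
  set n : ℂ → ℤ := fun s => ⌊s.re + 5/4⌋ with hn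
  set P : ℂ → ℂ := fun s => E (s - n s) with hP
  have nr : ∀ s : ℂ, -5/4 ≤ (s - n s).re ∧ (s - n s).re < -1/4 := by
    intro s
    have h1 := Int.floor_le (s.re + 5/4)
    have h2 := Int.lt_floor_add_one (s.re + 5/4)
    simp only [hn, Complex.sub_re, Complex.intCast_re]
    constructor <;> linarith
  have ni : ∀ s : ℂ, (s - n s).im = s.im := by intro s; simp
  have nu : ∀ (s : ℂ) (k : ℤ), -5/4 ≤ (s - k).re → (s - k).re < -1/4 → n s = k := by
    intro s k h1 h2
    simp only [Complex.sub_re, Complex.intCast_re] at h1 h2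
    simp only [hn]
    rw [Int.floor_eq_iff]
    constructor <;> linarith
  have loc : ∀ (s : ℂ) (k : ℤ), -3/2 < (s - k).re → (s - k).re < 0 → T < s.im → P s = E (s - k) := by
    intro s k h1 h2 h3
    have hi : (s - k).im = s.im := by simp
    by_cases a : (s - k).re < -5/4
    · have : n s = k - 1 := nu s (k-1) (by
        have : (s - (k - 1 : ℤ)).re = (s - k).re + 1 := by push_cast; simp; ring
        rw [this]; linarith) (by
        have : (s - (k - 1 : ℤ)).re = (s - k).re + 1 := by push_cast; simp; ring
        rw [this]; linarith)
      simp only [hP]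
      rw [this, ← Ep (s - k) h1 (by linarith) (by rw [hi]; exact h3)]
      congr 1; push_cast; ring
    by_cases b : (s - k).re < -1/4
    · simp only [hP]
      rw [nu s k (by linarith) b]
    · have e : (s - (k + 1 : ℤ)).re = (s - k).re - 1 := by push_cast; simp; ring
      have : n s = k + 1 := nu s (k+1) (by rw [e]; linarith) (by rw [e]; linarith)
      simp only [hP]
      rw [this]
      have hi : (s - (k + 1 : ℤ)).im = s.im := by simp
      rw [← Ep (s - (k + 1 : ℤ)) (by rw [e]; linarith) (by rw [e]; linarith) (by rw [hi]; exact h3)]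
      congr 1; push_cast; ring
  refine ⟨P, ?_, ?_, ?_, ?_, ?_⟩
  · intro s
    have : n (s + 1) = n s + 1 := by
      simp only [hn, Complex.add_re, Complex.one_re]
      rw [← Int.floor_add_one]; congr 1; ring
    simp only [hP]
    rw [this]; congr 1; push_cast; ring
  · intro s hs
    have h1 := nr s
    have hi := ni s
    have ev : P =ᶠ[𝓝 s] fun z => E (z - n s) := by
      have o1 : ∀ᶠ z : ℂ in 𝓝 s, s.re - 1/4 < z.re :=
        (isOpen_lt continuous_const Complex.continuous_re).mem_nhds (by simp)
      have o2 : ∀ᶠ z : ℂ in 𝓝 s, z.re < s.re + 1/4 :=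
        (isOpen_lt Complex.continuous_re continuous_const).mem_nhds (by simp)
      have o3 : ∀ᶠ z : ℂ in 𝓝 s, T < z.im :=
        (isOpen_lt continuous_const Complex.continuous_im).mem_nhds hs
      filter_upwards [o1, o2, o3] with z a b c
      simp only [Complex.sub_re, Complex.intCast_re] at h1
      apply loc z (n s) _ _ c
      · simp only [Complex.sub_re, Complex.intCast_re]; linarith
      · simp only [Complex.sub_re, Complex.intCast_re]; linarith
    rw [ev.differentiableAt_iff]
    exact DifferentiableAt.comp (g := E) (f := fun z => z - (n s : ℂ)) s
      (Ed _ (by linarith) (by linarith) (by rw [hi]; exact hs)) (by fun_prop)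
  · intro s hs
    have h1 := nr s
    have hi := ni s
    exact Eb _ (by linarith) (by linarith) (by rw [hi]; exact hs)
  · apply Et.comp
    rw [tendsto_comap_iff]
    refine (tendsto_comap (f := Complex.im) (x := atTop)).congr (fun s => ?_)
    exact (ni s).symm
  · intro s h1 h2
    simp only [hP]
    have : n s = 0 := nu s 0 (by simpa using h1) (by simpa using h2)
    rw [this]; simp

theorem step_raw (α : ℝ) (h0 : 0 < α) (h2 : α < 1/2) (r : ℝ) (hr : 0 < r) (hL : Lin α r) :
    Lin (1/α) (mu * Real.exp (-(2 * Real.pi * (TT α r + 1))) * (α / 4)) := by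
  intro G1 hG1
  have rα := Lin_cremer α r h0 h2 hL
  have pi3 := Real.pi_gt_three
  have pi4 := Real.pi_lt_d4
  have mp := mu_pos
  have mne : (mu : ℂ) ≠ 0 := by exact_mod_cast mp.ne'
  obtain ⟨y, y1, y2, y3, hy, hyG⟩ := yex (1/α) G1 hG1
  obtain ⟨w, F, hp⟩ := pkg α h0 h2 hy
  obtain ⟨ℓ, ℓd, ℓb, ℓp, ℓF, ℓt⟩ := ell α h0 h2 y w F hp r hr hL
  have hω : 2 < 1/α := by rw [lt_div_iff₀ h0]; linarith
  set T := TT α r with hT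
  have T1 : 3 ≤ T := by
    rw [hT]; unfold TT
    have h1 : 2 * Real.pi ≤ Real.log (4100000 * α / r) := by
      rw [Real.le_log_iff_exp_le (by positivity)]
      refine exp_four.trans ?_
      rw [le_div_iff₀ hr]; nlinarith
    have : 2 ≤ Real.log (4100000 * α / r) / (2 * Real.pi * α) := by
      rw [le_div_iff₀ (by positivity)]; nlinarith
    linarith
  set E : ℂ → ℂ := fun s => ℓ (w s) - s with hE
  have wi : ∀ s : ℂ, s.im - 1/50 ≤ (w s).im := by
    intro s
    have := (Complex.abs_im_le_norm _).trans (hp.wb s)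
    rw [abs_le, Complex.sub_im] at this
    linarith [this.1]
  have Fi : ∀ x : ℂ, x.im - 1/10 ≤ (F x).im := by
    intro s
    have := (Complex.abs_im_le_norm _).trans (hp.Fb s)
    rw [abs_le] at this
    simp at this
    linarith [this.1]
  obtain ⟨P, Pp, Pd, Pb, Pt, PE⟩ := per_ext E (T + 1) (0.14 / α)
    (by
      intro s h1 h3 h4
      have h5 := hp.wd s (by linarith) h3
      exact (DifferentiableAt.comp (g := ℓ) s (ℓd (w s) (by linarith [wi s])) h5).sub
        differentiableAt_id)
    (by
      intro s h1 h3 h4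
      have h5 := ℓb (w s) (by linarith [wi s])
      have h6 := hp.wb s
      have e : E s = (ℓ (w s) - w s) + (w s - s) := by simp only [hE]; ring
      rw [e]
      refine (norm_add_le _ _).trans ?_
      have : 0.14 / α = 0.13 / α + 0.01 * (1/α) := by ring
      rw [this]
      linarith)
    (by
      intro s h1 h3 h4
      simp only [hE]
      rw [← hp.Fw s h1 h3.le, ℓF (w s) (by linarith [wi s]) (by linarith [wi s, Fi (w s)])]
      ring)
    (by
      have t1 : Tendsto w (comap Complex.im atTop) (comap Complex.im atTop) := im_tend w _ hp.wb
      have := (ℓt.comp t1).add hp.wtop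
      rw [add_zero] at this
      refine this.congr (fun s => ?_)
      simp only [comp_apply, hE]; ring)
  -- chain relation
  have ch0 : ∀ s : ℂ, -5/4 ≤ s.re → s.re < -1/4 → T + 3 < s.im →
      P (s + (1/α:ℝ) + y (s + (1/α:ℝ))) + (s + (1/α:ℝ) + y (s + (1/α:ℝ))) = P s + s + (1/α:ℝ) := by
    intro s s1 s2 s3
    obtain ⟨M, s', hs', a1, a2, a3, a4⟩ := hp.chain s s1 s2 (by linarith)
    have it : ∀ j : ℕ, j ≤ M → ℓ (F^[j] (w s')) = ℓ (w s') + j := by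
      intro j
      induction j with
      | zero => intro _; simp
      | succ j ih =>
        intro hj
        have b1 := a4 j (by omega)
        have b2 := a4 (j+1) hj
        rw [iterate_succ_apply'] at b2 ⊢
        rw [ℓF _ (by linarith) (by linarith), ih (by omega)]
        push_cast; ring
    have h1 := it M le_rfl
    rw [a3, ℓp] at h1
    have Pk : ∀ (k : ℕ) (z : ℂ), P (z + k) = P z := by
      intro k z
      induction k with
      | zero => simp
      | succ k ih => rw [← ih, ← Pp (z + k)]; congr 1; push_cast; ring
    have e : s + (1/α:ℝ) + y (s + (1/α:ℝ)) = s' + M := by rw [hs']; ring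
    rw [e, Pk, PE s' a1 a2, PE s s1 s2]
    simp only [hE]
    linear_combination -h1
  have PZ : ∀ (k : ℤ) (z : ℂ), P (z + k) = P z := by
    intro k z
    have := (show Periodic P 1 from Pp).int_mul k z
    rwa [mul_one] at this
  have yZ : ∀ (k : ℤ) (z : ℂ), y (z + k) = y z := by
    intro k z
    have := (show Periodic y 1 from hy.per).int_mul k z
    rwa [mul_one] at this
  have ch : ∀ s : ℂ, T + 3 < s.im →
      P (s + (1/α:ℝ) + y (s + (1/α:ℝ))) + (s + (1/α:ℝ) + y (s + (1/α:ℝ))) = P s + s + (1/α:ℝ) := by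
    intro s hs
    set k := ⌊s.re + 5/4⌋ with hk
    have h1 := Int.floor_le (s.re + 5/4)
    have h2 := Int.lt_floor_add_one (s.re + 5/4)
    set z := s - k with hz
    have sz : s = z + k := by rw [hz]; ring
    have zr : z.re = s.re - k := by simp [hz]
    have := ch0 z (by rw [zr]; linarith) (by rw [zr]; linarith) (by simpa [hz] using hs)
    have e1 : z + k + (1/α:ℝ) = z + (1/α:ℝ) + k := by ring
    rw [sz, e1, yZ]
    have e2 : z + (1/α:ℝ) + k + y (z + (1/α:ℝ)) = z + (1/α:ℝ) + y (z + (1/α:ℝ)) + k := by ring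
    rw [e2, PZ, PZ]
    linear_combination this
  -- descend
  obtain ⟨ε, ε1, ε2, ε3⟩ := cusp 1 one_pos P (fun x => by simpa using Pp x)
  simp only [Complex.ofReal_one, one_mul] at ε1 ε2
  obtain ⟨εd0, ε0⟩ := ε3 0 (by
    have : ∀ᶠ z : ℂ in comap Complex.im atTop, T + 1 < z.im := (eventually_gt_atTop _).comap _
    filter_upwards [this] with z hz
    exact Pd z hz) Pt
  set ρ := Real.exp (-(2 * Real.pi * (T + 1))) with hρ
  have ρp : 0 < ρ := Real.exp_pos _
  have surj : ∀ (q : ℂ) (t : ℝ), q ≠ 0 → ‖q‖ < Real.exp (-(2 * Real.pi * t)) → ∃ s : ℂ, ee s = q ∧ t < s.im := by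
    intro q t hq hn
    have e : ee (Complex.log q / (2 * Real.pi * Complex.I)) = q := by
      unfold ee
      rw [mul_div_cancel₀ _ Complex.two_pi_I_ne_zero, Complex.exp_log hq]
    refine ⟨_, e, ?_⟩
    rw [← e, ee_norm] at hn
    have := Real.exp_lt_exp.1 hn
    have : 2 * Real.pi * t < 2 * Real.pi * (Complex.log q / (2 * Real.pi * Complex.I)).im := by linarith
    exact lt_of_mul_lt_mul_left this (by positivity)
  have εd : DifferentiableOn ℂ ε (ball 0 ρ) := by
    intro q hq
    apply DifferentiableAt.differentiableWithinAt
    by_cases h : q = 0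
    · rw [h]; exact εd0
    obtain ⟨s, rfl, hs⟩ := surj q (T+1) h (by rw [mem_ball_zero_iff] at hq; exact hq)
    exact ε2 s (Pd s hs)
  have εb : ∀ q ∈ ball (0:ℂ) ρ, ‖ε q‖ ≤ 0.14 / α := by
    intro q hq
    by_cases h : q = 0
    · rw [h, ε0, norm_zero]; positivity
    obtain ⟨s, rfl, hs⟩ := surj q (T+1) h (by rw [mem_ball_zero_iff] at hq; exact hq)
    rw [ε1]; exact Pb s hs
  have εb2 : ∀ q ∈ ball (0:ℂ) (ρ * (α / 4)), ‖ε q‖ ≤ 1/25 := by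
    intro q hq
    have hq' : q ∈ ball (0:ℂ) ρ := ball_subset_ball (by nlinarith) hq
    have := Complex.dist_le_div_mul_dist_of_mapsTo_ball (f := ε) (c := 0) (R₁ := ρ) (R₂ := 0.14 / α)
      εd (by
        intro z hz
        rw [ε0, mem_closedBall_zero_iff]
        exact εb z hz) hq'
    rw [ε0, dist_zero_right, dist_zero_right] at this
    refine this.trans ?_
    rw [mem_ball_zero_iff] at hq
    calc 0.14 / α / ρ * ‖q‖ ≤ 0.14 / α / ρ * (ρ * (α / 4)) := by gcongr
      _ = 0.14 / 4 := by field_simp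
      _ ≤ 1/25 := by norm_num
  have sc : ∀ z ∈ ball (0:ℂ) (mu * ρ * (α / 4)), z / mu ∈ ball (0:ℂ) (ρ * (α / 4)) := by
    intro z hz
    rw [mem_ball_zero_iff] at *
    rw [norm_div, Complex.norm_real, Real.norm_of_nonneg mp.le, div_lt_iff₀ mp]
    linarith
  have sub : ball (0:ℂ) (ρ * (α / 4)) ⊆ ball 0 ρ := ball_subset_ball (by nlinarith)
  set φ : ℂ → ℂ := fun z => z * ee (ε (z / mu)) with hφ
  have ein : DifferentiableOn ℂ (fun z => ee (ε (z / mu))) (ball 0 (mu * ρ * (α / 4))) := by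
    apply ee_diff.comp_differentiableOn
    exact (εd.mono sub).comp (by fun_prop) sc
  have rp : 0 < mu * ρ * (α / 4) := by positivity
  refine ⟨φ, differentiableOn_id.mul ein, by simp [hφ], ?_, ?_, ?_⟩
  · have h1 := (ein.differentiableAt (ball_mem_nhds _ rp)).hasDerivAt
    have := ((hasDerivAt_id (0:ℂ)).mul h1).deriv
    have e : φ = id * (fun z => ee (ε (z / mu))) := rfl
    rw [e, this]
    simp [ε0, ee_zero]
  · intro z hz
    have h1 := εb2 _ (sc z hz)
    have e : φ z - z = z * (ee (ε (z / mu)) - 1) := by simp only [hφ]; ring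
    rw [e, norm_mul]
    have h3 := exp_sub_one_le (2 * Real.pi * Complex.I * ε (z / mu))
    have n2 : ‖2 * Real.pi * Complex.I * ε (z / mu)‖ = 2 * Real.pi * ‖ε (z / mu)‖ := by
      simp [abs_of_pos Real.pi_pos]
    rw [n2] at h3
    have h4 : 2 * Real.pi * ‖ε (z / mu)‖ ≤ 0.26 := by
      norm_num at pi4 ⊢
      nlinarith [norm_nonneg (ε (z / mu))]
    have h5 : Real.exp (2 * Real.pi * ‖ε (z / mu)‖) ≤ 1.8 := by
      have := Real.log_two_gt_d9
      have h6 : Real.exp (0.26 : ℝ) ≤ 1 / (1 - 0.26) :=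
        Real.exp_bound_div_one_sub_of_interval (by norm_num) (by norm_num)
      exact (Real.exp_le_exp.2 h4).trans (h6.trans (by norm_num))
    have h6 : ‖ee (ε (z / mu)) - 1‖ ≤ 0.26 * 1.8 := by
      refine h3.trans ?_
      gcongr
    have := norm_nonneg z
    have : ‖ee (ε (z / mu)) - 1‖ ≤ 1/2 := h6.trans (by norm_num)
    nlinarith
  · have hn : ball (0:ℂ) (mu * Real.exp (-(2 * Real.pi * (T + 3)))) ∈ 𝓝 (0:ℂ) :=
      ball_mem_nhds _ (by positivity)
    filter_upwards [hn] with z hz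
    by_cases h : z = 0
    · rw [h, hG1.zero]; simp [hφ]
    rw [mem_ball_zero_iff] at hz
    obtain ⟨s, hs, hs2⟩ := surj (z / mu) (T+3) (div_ne_zero h mne) (by
      rw [norm_div, Complex.norm_real, Real.norm_of_nonneg mp.le, div_lt_iff₀ mp]
      linarith)
    have ez : z = mu * ee s := by rw [hs]; field_simp
    rw [ez, ← hyG s (by linarith)]
    simp only [hφ]
    rw [mul_div_cancel_left₀ _ mne, mul_div_cancel_left₀ _ mne, ε1, ε1, mul_assoc, mul_assoc,
      ← ee_add, ← ee_add, add_comm _ (P _), ch s hs2, ee_add, add_comm (P s)]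
    ring

theorem brjuno_of_lin (α : ℝ) (h : Irrational α) (r : ℝ) (hr : 0 < r) (hL : Lin α r) :
    BrjunoCondition α := by
  have mp := mu_pos
  have ml : mu ≤ 1 := by
    have h1 := mu_exp
    have h2 : 1 ≤ Real.exp (8 * Real.pi) := Real.one_le_exp (by have := Real.pi_pos; positivity)
    have := del_le
    nlinarith
  have pi3 := Real.pi_gt_three
  have l4 : 0 ≤ Real.log (4 / mu) := Real.log_nonneg (by rw [le_div_iff₀ mp]; linarith)
  have lb : 0 ≤ Real.log 4100000 := Real.log_nonneg (by norm_num)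
  set C := Real.log 4100000 + (4 * Real.pi + Real.log (4 / mu) + 1) with hC
  refine recursion (fun x K => Lin x (Real.exp (-K))) C (by positivity)
    (fun x K => Lin_add x _) (fun x K => Lin_neg x _) ?_ ?_ α h (-Real.log r)
    (by simpa [Real.exp_log hr] using hL)
  · intro x K h0 h1 hP
    have := Lin_cremer x _ h0 h1 hP
    have h3 := (Real.le_log_iff_exp_le h0).2 this
    rw [one_div, Real.log_inv]
    have : 0 ≤ C := by positivity
    linarith
  · intro x K h0 h1 hP
    refine Lin_mono _ _ _ ?_ (step_raw x h0 h1 _ (Real.exp_pos _) hP)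
    have e : mu * Real.exp (-(2 * Real.pi * (TT x (Real.exp (-K)) + 1))) * (x / 4) =
        Real.exp (-(2 * Real.pi * (TT x (Real.exp (-K)) + 1)) - Real.log (4 / mu) + Real.log x) := by
      rw [Real.exp_add, Real.exp_sub, Real.exp_log (by positivity), Real.exp_log h0]
      field_simp
    rw [e]
    apply Real.exp_le_exp.2
    unfold TT
    have e2 : Real.log (4100000 * x / Real.exp (-K)) = Real.log 4100000 + Real.log x + K := by
      rw [Real.log_div (by positivity) (Real.exp_pos _).ne', Real.log_mul (by norm_num) h0.ne',
        Real.log_exp]; ring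
    rw [e2]
    have e3 : 2 * Real.pi * (1 + (Real.log 4100000 + Real.log x + K) / (2 * Real.pi * x) + 1) =
      4 * Real.pi + (Real.log 4100000 + Real.log x + K) / x := by field_simp; ring
    rw [e3, one_div, Real.log_inv]
    have h5 : -1 ≤ x * Real.log x := by
      have := Real.one_sub_inv_le_log_of_pos h0
      have : x * (1 - x⁻¹) ≤ x * Real.log x := by gcongr
      rw [mul_sub, mul_inv_cancel₀ h0.ne'] at this
      linarith
    have h6 : 4 * Real.pi + Real.log (4 / mu) - Real.log x ≤ (4 * Real.pi + Real.log (4 / mu) + 1) / x := by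
      rw [le_div_iff₀ h0]
      have : 0 ≤ 4 * Real.pi + Real.log (4 / mu) := by positivity
      nlinarith
    have h7 : (K - -Real.log x + C) / x = (Real.log 4100000 + Real.log x + K) / x + (4 * Real.pi + Real.log (4 / mu) + 1) / x := by
      rw [hC]; ring
    rw [h7]
    linarith

end SQB

namespace SQB
open MeasureTheory Filter Topology

lemma holo_log (g : ℂ → ℂ) (z0 : ℂ) (r : ℝ) (hr : 0 < r) (hg : DifferentiableOn ℂ g (ball z0 r))
    (h0 : ∀ z ∈ ball z0 r, g z ≠ 0) :
    ∃ L : ℂ → ℂ, DifferentiableOn ℂ L (ball z0 r) ∧ ∀ z ∈ ball z0 r, Complex.exp (L z) = g z := by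
  have hd : DifferentiableOn ℂ (fun z => deriv g z / g z) (ball z0 r) :=
    (hg.deriv isOpen_ball).div hg h0
  obtain ⟨L, hL⟩ := hd.isExactOn_ball.with_val_at z0 (Complex.log (g z0))
  obtain ⟨hL1, hL0⟩ : (∀ z ∈ ball z0 r, HasDerivAt L (deriv g z / g z) z) ∧
      L z0 = Complex.log (g z0) := by
    constructor
    · first | exact hL.1 | exact hL.2
    · first | exact hL.2 | exact hL.1
  refine ⟨L, fun z hz => (hL1 z hz).differentiableAt.differentiableWithinAt, ?_⟩
  have hz0 : z0 ∈ ball z0 r := mem_ball_self hr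
  have hconst : ∀ z ∈ ball z0 r, HasDerivAt (fun z => Complex.exp (-L z) * g z) 0 z := by
    intro z hz
    have hgz : HasDerivAt g (deriv g z) z :=
      ((hg z hz).differentiableAt (isOpen_ball.mem_nhds hz)).hasDerivAt
    have h1 : HasDerivAt (fun z => Complex.exp (-L z)) (Complex.exp (-L z) * (-(deriv g z / g z))) z :=
      (hL1 z hz).fun_neg.cexp
    refine (h1.fun_mul hgz).congr_deriv ?_
    have := h0 z hz
    field_simp
    ring
  intro z hz
  have h1 : Complex.exp (-L z) * g z = Complex.exp (-L z0) * g z0 := by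
    refine (convex_ball z0 r).is_const_of_fderivWithin_eq_zero (𝕜 := ℂ)
      (f := fun z => Complex.exp (-L z) * g z)
      (fun z hz => (hconst z hz).differentiableAt.differentiableWithinAt) (fun x hx => ?_) hz hz0
    rw [fderivWithin_of_isOpen isOpen_ball hx, (hconst x hx).hasFDerivAt.fderiv]
    ext; simp
  rw [hL0, Complex.exp_neg, Complex.exp_neg, Complex.exp_log (h0 _ hz0),
    inv_mul_cancel₀ (h0 _ hz0)] at h1
  have h2 := Complex.exp_ne_zero (L z)
  field_simp at h1
  exact h1.symm

lemma holo_sqrt (g : ℂ → ℂ) (z0 : ℂ) (r : ℝ) (hg : DifferentiableOn ℂ g (ball z0 r))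
    (h0 : ∀ z ∈ ball z0 r, g z ≠ 0) (t1 : ℂ) (ht1 : t1 ∈ ball z0 r) (s1 : ℂ) (hs1 : s1 ^ 2 = g t1) :
    ∃ s : ℂ → ℂ, DifferentiableOn ℂ s (ball z0 r) ∧ (∀ z ∈ ball z0 r, s z ^ 2 = g z) ∧ s t1 = s1 := by
  have hr : 0 < r := lt_of_le_of_lt dist_nonneg (mem_ball.1 ht1)
  obtain ⟨L, hL, hE⟩ := holo_log g z0 r hr hg h0
  have hs : DifferentiableOn ℂ (fun z => Complex.exp (L z / 2)) (ball z0 r) :=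
    (hL.div_const 2).cexp
  have hsq : ∀ z ∈ ball z0 r, Complex.exp (L z / 2) ^ 2 = g z := by
    intro z hz
    rw [← hE z hz, ← Complex.exp_nat_mul]; congr 1; push_cast; ring
  have := (sq_eq_sq_iff_eq_or_eq_neg (a := s1) (b := Complex.exp (L t1 / 2))).1
    (by rw [hs1, hsq _ ht1])
  rcases this with h | h
  · exact ⟨_, hs, hsq, h.symm⟩
  · exact ⟨fun z => -Complex.exp (L z / 2), hs.neg, fun z hz => by simpa using hsq z hz, h.symm⟩

lemma harnack (g : ℂ → ℂ) (hg : DifferentiableOn ℂ g (ball 0 1))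
    (h0 : ∀ z ∈ ball (0:ℂ) 1, g z ≠ 0) (M ρ : ℝ) (hρ : 0 < ρ)
    (hM : ∀ z ∈ ball (0:ℂ) 1, ‖g z‖ < M) (hg0 : ρ ≤ ‖g 0‖) (t : ℂ) (ht : ‖t‖ ≤ 1 / 2) :
    ρ * (ρ / M) ^ 2 ≤ ‖g t‖ := by
  obtain ⟨L, hL, hE⟩ := holo_log g 0 1 one_pos hg h0
  have hz0 : (0:ℂ) ∈ ball (0:ℂ) 1 := mem_ball_self one_pos
  have hρM : ρ < M := hg0.trans_lt (hM 0 hz0)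
  have hM0 : 0 < M := hρ.trans hρM
  have hK : 0 < Real.log (M / ρ) := Real.log_pos ((one_lt_div hρ).2 hρM)
  have hre : ∀ z ∈ ball (0:ℂ) 1, (L z).re = Real.log ‖g z‖ := by
    intro z hz; rw [← hE z hz, Complex.norm_exp, Real.log_exp]
  have htb : t ∈ ball (0:ℂ) 1 := by rw [mem_ball_zero_iff]; linarith
  have := Complex.borelCaratheodory_zero (f := fun z => L z - L 0) (M := Real.log (M / ρ)) (R := 1)
    (z := t) hK (hL.sub_const _) (by
      intro z hz
      simp only [mem_ofPred_eq, Complex.sub_re]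
      rw [hre z hz, hre 0 hz0, Real.log_div hM0.ne' hρ.ne']
      have h1 := Real.log_le_log (norm_pos_iff.2 (h0 z hz)) (hM z hz).le
      have h2 := Real.log_le_log hρ hg0
      linarith) one_pos htb (by simp)
  have h3 : ‖L t - L 0‖ ≤ 2 * Real.log (M / ρ) := by
    refine this.trans ?_
    rw [div_le_iff₀ (by linarith)]
    nlinarith
  have h4 := (abs_le.1 (Complex.abs_re_le_norm (L t - L 0))).1
  rw [Complex.sub_re, hre t htb, hre 0 hz0] at h4
  have h2 := Real.log_le_log hρ hg0
  rw [← Real.log_le_log_iff (by positivity) (norm_pos_iff.2 (h0 t htb)),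
    Real.log_mul (by positivity) (by positivity), Real.log_pow,
    ← neg_neg (Real.log (ρ / M)), ← Real.log_inv, inv_div]
  push_cast
  linarith

lemma pullback (c t1 : ℂ) (R : ℝ) (v : ℂ → ℂ → ℂ)
    (hv1 : ∀ t ∈ ball t1 R, ∀ x ∈ ball (0:ℂ) (‖c‖+9), ‖v t x‖ ≤ 1/4)
    (hv2 : ∀ t ∈ ball t1 R, ∀ x ∈ ball (0:ℂ) (‖c‖+9), ∀ y ∈ ball (0:ℂ) (‖c‖+9),
      ‖v t x - v t y‖ ≤ 1/2*‖x-y‖)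
    (hv3 : ∀ x : ℂ → ℂ, DifferentiableOn ℂ x (ball t1 R) →
      MapsTo x (ball t1 R) (ball (0:ℂ) (‖c‖+9)) →
      DifferentiableOn ℂ (fun t => v t (x t)) (ball t1 R))
    (y : ℂ → ℂ) (hy : DifferentiableOn ℂ y (ball t1 R)) (hyc : ∀ t ∈ ball t1 R, y t ≠ c)
    (S : ℝ) (hS0 : 0 ≤ S) (hS : S + 1/4 ≤ ‖c‖+8) (hyS : ∀ t ∈ ball t1 R, ‖y t‖ + ‖c‖ ≤ S^2)
    (t0 : ℂ) (ht0 : t0 ∈ ball t1 R) (x0 : ℂ) (hx0 : x0 ∈ ball (0:ℂ) (‖c‖+9))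
    (h0 : (x0 + v t0 x0)^2 + c = y t0) :
    ∃ x : ℂ → ℂ, DifferentiableOn ℂ x (ball t1 R) ∧ x t0 = x0 ∧
      ∀ t ∈ ball t1 R, (x t + v t (x t))^2 + c = y t ∧ ‖x t‖ ≤ S + 1/4 := by
  obtain ⟨s, hs, hsq, hs0⟩ := holo_sqrt (fun t => y t - c) t1 R (hy.sub_const c)
    (fun z hz => sub_ne_zero.2 (hyc z hz)) t0 ht0 (x0 + v t0 x0) (by rw [← h0]; ring)
  have hsS : ∀ t ∈ ball t1 R, ‖s t‖ ≤ S := by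
    intro t ht
    have h1 : ‖s t‖^2 ≤ S^2 := by
      rw [← norm_pow, hsq t ht]
      exact (norm_sub_le _ _).trans (hyS t ht)
    exact (sq_le_sq₀ (norm_nonneg _) hS0).1 h1
  let X : ℕ → ℂ → ℂ := fun k => Nat.rec (fun t => s t) (fun _ Y t => s t - v t (Y t)) k
  have hX0 : ∀ t, X 0 t = s t := fun t => rfl
  have hXs : ∀ k t, X (k+1) t = s t - v t (X k t) := fun k t => rfl
  have hXb : ∀ k, ∀ t ∈ ball t1 R, ‖X k t‖ ≤ S + 1/4 := by
    intro k
    induction k with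
    | zero => intro t ht; rw [hX0]; linarith [hsS t ht]
    | succ k ih =>
      intro t ht; rw [hXs]
      have := hv1 t ht (X k t) (by rw [mem_ball_zero_iff]; linarith [ih t ht])
      linarith [norm_sub_le (s t) (v t (X k t)), hsS t ht]
  have hXm : ∀ k, ∀ t ∈ ball t1 R, X k t ∈ ball (0:ℂ) (‖c‖+9) := fun k t ht => by
    rw [mem_ball_zero_iff]; linarith [hXb k t ht]
  have hXd : ∀ k, DifferentiableOn ℂ (X k) (ball t1 R) := by
    intro k
    induction k with
    | zero => exact hs
    | succ k ih => exact hs.sub (hv3 (X k) ih (hXm k))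
  have hXc : ∀ k, ∀ t ∈ ball t1 R, dist (X k t) (X (k+1) t) ≤ 1/4 * (1/2)^k := by
    intro k
    induction k with
    | zero =>
      intro t ht
      rw [dist_eq_norm, hXs, hX0]
      simpa using hv1 t ht (s t) (hXm 0 t ht)
    | succ k ih =>
      intro t ht
      rw [dist_eq_norm, hXs (k+1), hXs k]
      have h1 : s t - v t (X k t) - (s t - v t (X (k+1) t)) = v t (X (k+1) t) - v t (X k t) := by ring
      rw [← hXs k, hXs k, h1]
      have h2 := hv2 t ht _ (hXm (k+1) t ht) _ (hXm k t ht)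
      have h3 := ih t ht
      rw [dist_comm, dist_eq_norm] at h3
      rw [pow_succ]; linarith
  have hlim : ∀ t ∈ ball t1 R, ∃ l, Tendsto (fun k => X k t) atTop (𝓝 l) := fun t ht =>
    cauchySeq_tendsto_of_complete (cauchySeq_of_le_geometric (1/2) (1/4) (by norm_num)
      (fun k => hXc k t ht))
  choose! x hx using hlim
  have hdist : ∀ k, ∀ t ∈ ball t1 R, dist (X k t) (x t) ≤ 1/4 * (1/2)^k / (1 - 1/2) :=
    fun k t ht => dist_le_of_le_geometric_of_tendsto (1/2) (1/4) (by norm_num)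
      (fun k => hXc k t ht) (hx t ht) k
  have hunif : TendstoUniformlyOn X x atTop (ball t1 R) := by
    rw [Metric.tendstoUniformlyOn_iff]
    intro ε hε
    have : Tendsto (fun k : ℕ => (1/4:ℝ) * (1/2)^k / (1 - 1/2)) atTop (𝓝 (1/4 * 0 / (1 - 1/2))) :=
      ((tendsto_pow_atTop_nhds_zero_of_lt_one (by norm_num) (by norm_num)).const_mul _).div_const _
    filter_upwards [this.eventually (gt_mem_nhds (by simpa using hε))] with k hk t ht
    rw [dist_comm]; exact (hdist k t ht).trans_lt hk
  have hxb : ∀ t ∈ ball t1 R, ‖x t‖ ≤ S + 1/4 := fun t ht =>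
    le_of_tendsto (hx t ht).norm (Eventually.of_forall fun k => hXb k t ht)
  have hxm : ∀ t ∈ ball t1 R, x t ∈ ball (0:ℂ) (‖c‖+9) := fun t ht => by
    rw [mem_ball_zero_iff]; linarith [hxb t ht]
  have hfix : ∀ t ∈ ball t1 R, x t = s t - v t (x t) := by
    intro t ht
    refine tendsto_nhds_unique ((tendsto_add_atTop_iff_nat 1).2 (hx t ht)) ?_
    have : Tendsto (fun k => v t (X k t)) atTop (𝓝 (v t (x t))) := by
      rw [tendsto_iff_norm_sub_tendsto_zero]
      have h1 := (tendsto_iff_norm_sub_tendsto_zero.1 (hx t ht)).const_mul (1/2)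
      rw [mul_zero] at h1
      exact squeeze_zero (fun _ => norm_nonneg _)
        (fun k => hv2 t ht _ (hXm k t ht) _ (hxm t ht)) h1
    exact this.const_sub (s t)
  refine ⟨x, hunif.tendstoLocallyUniformlyOn.differentiableOn
    (Eventually.of_forall hXd) isOpen_ball, ?_, fun t ht => ⟨?_, hxb t ht⟩⟩
  · have h1 := hfix t0 ht0
    rw [hs0] at h1
    have h2 := hv2 t0 ht0 _ hx0 _ (hxm t0 ht0)
    have h3 : x t0 - x0 = v t0 x0 - v t0 (x t0) := by linear_combination h1
    rw [← h3, ← norm_sub_rev (x t0)] at h2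
    have h4 : ‖x t0 - x0‖ ≤ 0 := by linarith [norm_nonneg (x t0 - x0)]
    exact sub_eq_zero.1 (norm_le_zero_iff.1 h4)
  · have h1 := hfix t ht
    have h2 := hsq t ht
    have : x t + v t (x t) = s t := by linear_combination h1
    rw [this]; linear_combination h2

end SQB

namespace SQB
open MeasureTheory Filter Topology

/-- the perturbed quadratic map -/
noncomputable def FF (V : ℂ → ℂ) (c z : ℂ) : ℂ := (z + V z)^2 + c

lemma lip_of_bound (V : ℂ → ℂ) (ρ M : ℝ) (hV : DifferentiableOn ℂ V (ball 0 (ρ + 1)))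
    (hVb : ∀ z ∈ ball (0:ℂ) (ρ+1), ‖V z‖ ≤ M) :
    ∀ x ∈ ball (0:ℂ) ρ, ∀ y ∈ ball (0:ℂ) ρ, ‖V x - V y‖ ≤ M * ‖x - y‖ := by
  intro x hx y hy
  refine (convex_ball (0:ℂ) ρ).norm_image_sub_le_of_norm_deriv_le (𝕜 := ℂ) (f := V) ?_ ?_ hy hx
  · intro z hz
    exact (hV z (ball_subset_ball (by linarith) hz)).differentiableAt
      (isOpen_ball.mem_nhds (ball_subset_ball (by linarith) hz))
  · intro z hz
    rw [mem_ball_zero_iff] at hz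
    have key : ∀ r : ℝ, 0 < r → r < 1 → ‖deriv V z‖ ≤ M / r := by
      intro r hr hr1
      have hsub : closedBall z r ⊆ ball (0:ℂ) (ρ+1) := by
        intro w hw
        rw [mem_closedBall, dist_eq_norm] at hw
        rw [mem_ball_zero_iff]
        calc ‖w‖ = ‖(w - z) + z‖ := by ring_nf
          _ ≤ ‖w - z‖ + ‖z‖ := norm_add_le _ _
          _ < ρ + 1 := by linarith
      refine Complex.norm_deriv_le_of_forall_mem_sphere_norm_le hr ?_ ?_
      · exact DifferentiableOn.diffContOnCl (by
          rw [closure_ball z hr.ne']; exact hV.mono hsub)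
      · intro w hw; exact hVb w (hsub (sphere_subset_closedBall hw))
    have ht : Tendsto (fun r : ℝ => M / r) (𝓝[<] 1) (𝓝 (M/1)) := by
      have : ContinuousAt (fun r : ℝ => M / r) 1 := by
        apply ContinuousAt.div₀ <;> first | fun_prop | norm_num
      exact this.tendsto.mono_left nhdsWithin_le_nhds
    rw [div_one] at ht
    refine ge_of_tendsto ht ?_
    have h01 : Ioo (0:ℝ) 1 ∈ 𝓝[<] (1:ℝ) := Ioo_mem_nhdsLT (by norm_num)
    filter_upwards [h01] with r hr using key r hr.1 hr.2

lemma orb_iter (F : ℂ → ℂ) (orb : ℕ → ℂ) (ho : ∀ i, F (orb i) = orb (i+1)) (k i : ℕ) :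
    F^[k] (orb i) = orb (i + k) := by
  induction k with
  | zero => rfl
  | succ k ih => rw [iterate_succ_apply', ih, ho]; rfl

lemma iter_deriv (V : ℂ → ℂ) (c : ℂ) (orb d : ℕ → ℂ) (ho : ∀ i, FF V c (orb i) = orb (i+1))
    (hd : ∀ i, HasDerivAt V (d i) (orb i)) (k : ℕ) :
    HasDerivAt (FF V c)^[k] (∏ i ∈ Finset.range k, (2 * (orb i + V (orb i)) * (1 + d i))) (orb 0) := by
  induction k with
  | zero => simpa using hasDerivAt_id (orb 0)
  | succ k ih =>
    rw [iterate_succ', Finset.prod_range_succ, mul_comm]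
    have h1 : HasDerivAt (FF V c) (2 * (orb k + V (orb k)) * (1 + d k)) ((FF V c)^[k] (orb 0)) := by
      rw [orb_iter _ orb ho, zero_add]
      have := (((hasDerivAt_id (orb k)).fun_add (hd k)).fun_pow 2).add_const c
      refine this.congr_deriv ?_
      simp
    exact h1.comp (orb 0) ih

lemma attract (c : ℂ) (V : ℂ → ℂ) (hV : DifferentiableOn ℂ V (ball 0 (‖c‖+10)))
    (hVb : ∀ z ∈ ball (0:ℂ) (‖c‖+10), ‖V z‖ ≤ 1/4) (n : ℕ) (hn : 1 ≤ n) (orb : ℕ → ℂ)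
    (ho : ∀ i, FF V c (orb i) = orb (i+1)) (hper : ∀ i, orb (i+n) = orb i)
    (hA : ∀ i, ‖orb i‖ < ‖c‖ + 4) (m : ℂ) (hm : HasDerivAt (FF V c)^[n] m (orb 0)) (hm1 : ‖m‖ < 1) :
    ∀ j, ‖(FF V c)^[j] c‖ < ‖c‖ + 4 := by
  by_contra! hcon
  obtain ⟨j0, hj0⟩ := hcon
  set F := FF V c with hF
  have hlip := lip_of_bound V (‖c‖+9) (1/4) (by convert hV using 2; ring)
    (by convert hVb using 4; ring)
  have hne : ∀ j, orb 0 ≠ F^[j] c ∨ j0 ≤ j := by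
    intro j
    by_contra! h
    obtain ⟨i, rfl⟩ := Nat.exists_eq_add_of_lt h.2
    have : F^[j + i + 1] c = orb (i+1) := by
      rw [show j + i + 1 = (i+1) + j by ring, iterate_add_apply, ← h.1, orb_iter F orb ho, zero_add]
    rw [this] at hj0
    linarith [hA (i+1)]
  obtain ⟨δ, hδ, hN⟩ : ∃ δ > 0, ball (orb 0) δ ⊆
      ball (0:ℂ) (‖c‖+4) ∩ ⋂ j ∈ Finset.range j0, {F^[j] c}ᶜ := by
    have hop : IsOpen (ball (0:ℂ) (‖c‖+4) ∩ ⋂ j ∈ Finset.range j0, ({F^[j] c}ᶜ : Set ℂ)) := by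
      refine isOpen_ball.inter (isOpen_biInter_finset ?_)
      intro j _; exact isOpen_compl_singleton
    refine Metric.isOpen_iff.1 hop (orb 0) ⟨?_, ?_⟩
    · rw [mem_ball_zero_iff]; exact hA 0
    · simp only [mem_iInter]
      intro j hj
      rcases hne j with h | h
      · exact h
      · exact absurd (Finset.mem_range.1 hj) (by omega)
  have hN1 : ∀ z ∈ ball (orb 0) δ, ‖z‖ < ‖c‖+4 := fun z hz => by
    simpa using (hN hz).1
  have hN2 : ∀ z ∈ ball (orb 0) δ, ∀ j < j0, z ≠ F^[j] c := fun z hz j hj => by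
    have := (hN hz).2
    simp only [mem_iInter] at this
    exact this j (Finset.mem_range.2 hj)
  have hz0 : orb 0 ∈ ball (orb 0) δ := mem_ball_self hδ
  have hg : ∀ j : ℕ, ∃ g : ℂ → ℂ, DifferentiableOn ℂ g (ball (orb 0) δ) ∧ g (orb 0) = orb ((n-1)*j) ∧
      ∀ z ∈ ball (orb 0) δ, F^[j] (g z) = z ∧ ∀ i ≤ j, ‖F^[i] (g z)‖ < ‖c‖+4 := by
    intro j
    induction j with
    | zero =>
      refine ⟨id, differentiableOn_id, by simp, fun z hz => ⟨rfl, fun i hi => ?_⟩⟩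
      obtain rfl : i = 0 := by omega
      exact hN1 z hz
    | succ j ih =>
      obtain ⟨g, hgd, hg0, hg1⟩ := ih
      obtain ⟨x, hxd, hx0, hx⟩ := pullback c (orb 0) δ (fun _ z => V z)
        (fun t _ x hx => hVb x (ball_subset_ball (by linarith) hx))
        (fun t _ x hx y hy => (hlip x hx y hy).trans (by gcongr; norm_num))
        (fun x hxd hxm => hV.comp hxd (fun t ht => ball_subset_ball (by linarith) (hxm ht)))
        g hgd (by
          intro t ht hgt
          obtain ⟨h1, h2⟩ := hg1 t ht
          rcases lt_or_ge j j0 with h | h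
          · exact hN2 t ht j h (by rw [← hgt]; exact h1.symm)
          · have := h2 j0 h
            rw [hgt] at this
            linarith) (‖c‖+3) (by positivity) (by linarith) (by
          intro t ht
          have := (hg1 t ht).2 0 (Nat.zero_le _)
          simp only [iterate_zero, id] at this
          nlinarith [norm_nonneg c]) (orb 0) hz0 (orb ((n-1)*(j+1))) (by
            rw [mem_ball_zero_iff]; linarith [hA ((n-1)*(j+1))]) (by
            have := ho ((n-1)*(j+1))
            rw [hF] at this
            change FF V c _ = _
            rw [this, hg0, ← hper ((n-1)*j)]
            congr 1
            obtain ⟨k, rfl⟩ : ∃ k, n = k + 1 := ⟨n-1, by omega⟩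
            simp; ring)
      have hFx : ∀ t ∈ ball (orb 0) δ, F (x t) = g t := fun t ht => (hx t ht).1
      refine ⟨x, hxd, hx0, fun z hz => ⟨?_, ?_⟩⟩
      · rw [iterate_succ_apply, hFx z hz]; exact (hg1 z hz).1
      · intro i hi
        cases i with
        | zero => simp only [iterate_zero, id]; linarith [(hx z hz).2]
        | succ i => rw [iterate_succ_apply, hFx z hz]; exact (hg1 z hz).2 i (by omega)
  have hbound : ∀ l : ℕ, 1 ≤ ‖m‖^l * ((‖c‖+4)/(δ/2)) := by
    intro l
    obtain ⟨g, hgd, hg0, hg1⟩ := hg (n*l)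
    have horb : ∀ k, orb (n * k) = orb 0 := by
      intro k
      induction k with
      | zero => rfl
      | succ k ih => rw [Nat.mul_succ, hper, ih]
    have hg0' : g (orb 0) = orb 0 := by
      rw [hg0, mul_left_comm, horb]
    have hgder : HasDerivAt g (deriv g (orb 0)) (orb 0) :=
      ((hgd _ hz0).differentiableAt (isOpen_ball.mem_nhds hz0)).hasDerivAt
    have hfix : F^[n] (orb 0) = orb 0 := by
      rw [orb_iter F orb ho, hper]
    have h1 := HasDerivAt.iterate (orb 0) hm hfix l
    rw [← iterate_mul] at h1
    rw [← hg0'] at h1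
    have h2 := h1.comp (orb 0) hgder
    have h3 : HasDerivAt (F^[n*l] ∘ g) 1 (orb 0) := by
      refine (hasDerivAt_id (orb 0)).congr_of_eventuallyEq ?_
      filter_upwards [isOpen_ball.mem_nhds hz0] with z hz using (hg1 z hz).1
    have h4 := h2.unique h3
    have h5 : ‖deriv g (orb 0)‖ ≤ (‖c‖+4)/(δ/2) := by
      have hsub : closedBall (orb 0) (δ/2) ⊆ ball (orb 0) δ :=
        closedBall_subset_ball (by linarith)
      refine Complex.norm_deriv_le_of_forall_mem_sphere_norm_le (by linarith) ?_ ?_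
      · exact DifferentiableOn.diffContOnCl (by
          rw [closure_ball _ (by linarith)]; exact hgd.mono hsub)
      · intro w hw
        exact ((hg1 w (hsub (sphere_subset_closedBall hw))).2 0 (Nat.zero_le _)).le
    calc (1:ℝ) = ‖m^l * deriv g (orb 0)‖ := by rw [h4]; simp
      _ = ‖m‖^l * ‖deriv g (orb 0)‖ := by rw [norm_mul, norm_pow]
      _ ≤ _ := by gcongr
  have ht : Tendsto (fun l : ℕ => ‖m‖^l * ((‖c‖+4)/(δ/2))) atTop (𝓝 (0 * ((‖c‖+4)/(δ/2)))) :=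
    (tendsto_pow_atTop_nhds_zero_of_lt_one (norm_nonneg _) hm1).mul_const _
  have := ge_of_tendsto ht (Eventually.of_forall hbound)
  norm_num at this

lemma nonesc (c : ℂ) (V : ℂ → ℂ) (hV : DifferentiableOn ℂ V (ball 0 (‖c‖+10)))
    (hVb : ∀ z ∈ ball (0:ℂ) (‖c‖+10), ‖V z‖ ≤ 1/8) (n : ℕ) (hn : 1 ≤ n) (orb : ℕ → ℂ)
    (ho : ∀ i, orb i ^ 2 + c = orb (i+1)) (hper : ∀ i, orb (i+n) = orb i)
    (hdist : ∀ i, 0 < i → i < n → orb i ≠ orb 0)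
    (hA : ∀ i, ‖orb i‖ < ‖c‖ + 4) (hlam : ‖∏ i ∈ Finset.range n, (2 * orb i)‖ ≤ 1)
    (hV0 : ∀ i, V (orb i) = 0) (hV1 : ∀ i, HasDerivAt V 0 (orb i)) :
    ∀ j, ‖(FF V c)^[j] c‖ < ‖c‖ + 5 := by
  classical
  set Z : Finset ℂ := ((Finset.range n).image orb).erase (orb 0) with hZ
  set a : ℂ → ℂ := fun z => ∏ ζ ∈ Z, ((z - ζ) / (orb 0 - ζ)) with ha
  have had : Differentiable ℂ a := by
    rw [ha]; apply Differentiable.fun_finsetProd; intro ζ _; fun_prop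
  have ha0 : a (orb 0) = 1 := by
    rw [ha]; apply Finset.prod_eq_one
    intro ζ hζ
    rw [div_self]; exact sub_ne_zero.2 (Finset.ne_of_mem_erase hζ).symm
  have hai : ∀ i, 0 < i → i < n → a (orb i) = 0 := by
    intro i h0 h1
    rw [ha]
    refine Finset.prod_eq_zero (i := orb i) ?_ (by simp)
    exact Finset.mem_erase.2 ⟨hdist i h0 h1, Finset.mem_image_of_mem _ (Finset.mem_range.2 h1)⟩
  have hmod : ∀ i, orb i = orb (i % n) := by
    intro i
    induction i using Nat.strong_induction_on with
    | _ i ih =>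
      rcases lt_or_ge i n with h | h
      · rw [Nat.mod_eq_of_lt h]
      · obtain ⟨k, rfl⟩ := Nat.exists_eq_add_of_le' h
        rw [hper, ih k (by omega), Nat.add_mod_right]
  set p : ℂ → ℂ := fun z => -((z - orb 0) * a z ^ 2) with hp
  have hpd : Differentiable ℂ p := by rw [hp]; fun_prop
  have hp0 : ∀ i, p (orb i) = 0 := by
    intro i
    rw [hmod i]
    rcases Nat.eq_zero_or_pos (i % n) with h | h
    · rw [h]; simp [hp]
    · simp [hp, hai _ h (Nat.mod_lt _ (by omega))]
  have hpder : ∀ z, HasDerivAt p (-(1 * a z ^ 2 + (z - orb 0) * (2 * a z * deriv a z))) z := by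
    intro z
    have h1 := (((hasDerivAt_id z).sub_const (orb 0)).fun_mul ((had z).hasDerivAt.fun_pow 2)).fun_neg
    refine h1.congr_deriv ?_
    simp
  obtain ⟨M, hM⟩ := (isCompact_closedBall (0:ℂ) (‖c‖+10)).exists_bound_of_continuousOn
    hpd.continuous.continuousOn
  set Vs : ℝ → ℂ → ℂ := fun s z => V z + s * p z with hVs
  have hesc : ∀ s : ℝ, 0 < s → s < 1 → s * (|M|+1) < 1/8 → ∀ j, ‖(FF (Vs s) c)^[j] c‖ < ‖c‖+4 := by
    intro s hs hs1 hsM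
    have hFo : ∀ i, FF (Vs s) c (orb i) = orb (i+1) := by
      intro i; simp [FF, hVs, hV0, hp0, ho]
    have hder := iter_deriv (Vs s) c orb _ hFo
      (fun i => (hV1 i).fun_add ((hpder (orb i)).const_mul (s:ℂ))) n
    refine attract c (Vs s) (hV.add ((hpd.const_mul _).differentiableOn)) ?_ n hn orb hFo hper hA _ hder ?_
    · intro z hz
      have h1 := hM z (ball_subset_closedBall hz)
      calc ‖Vs s z‖ ≤ ‖V z‖ + ‖(s:ℂ) * p z‖ := norm_add_le _ _
        _ ≤ 1/8 + s * (|M|+1) := by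
          rw [norm_mul, Complex.norm_real, Real.norm_of_nonneg hs.le]
          gcongr
          · exact hVb z hz
          · linarith [le_abs_self M]
        _ ≤ 1/4 := by linarith
    · have hprod : (∏ i ∈ Finset.range n, (2 * (orb i + Vs s (orb i)) *
          (1 + (0 + (s:ℂ) * -(1 * a (orb i) ^ 2 + (orb i - orb 0) * (2 * a (orb i) * deriv a (orb i)))))))
          = (∏ i ∈ Finset.range n, (2 * orb i)) * (1 - s) := by
        obtain ⟨k, rfl⟩ : ∃ k, n = k + 1 := ⟨n-1, by omega⟩
        rw [Finset.prod_range_succ', Finset.prod_range_succ', mul_assoc (Finset.prod _ _)]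
        refine congr_arg₂ (· * ·) ?_ ?_
        · apply Finset.prod_congr rfl
          intro i hi
          rw [Finset.mem_range] at hi
          simp only [hVs, hV0, hp0, hai (i+1) (by omega) (by omega)]
          ring
        · simp only [hVs, hV0, hp0, ha0]; ring
      rw [hprod, norm_mul]
      have h1 : ‖(1 - s : ℂ)‖ = 1 - s := by
        rw [← Complex.ofReal_one, ← Complex.ofReal_sub, Complex.norm_real, Real.norm_of_nonneg]
        linarith
      rw [h1]
      nlinarith [norm_nonneg (∏ i ∈ Finset.range n, (2 * orb i))]
  have hev : ∀ᶠ s : ℝ in 𝓝[>] 0, ∀ j, ‖(FF (Vs s) c)^[j] c‖ < ‖c‖+4 := by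
    have h1 : ∀ᶠ s : ℝ in 𝓝 0, s * (|M|+1) < 1/8 := by
      have : Tendsto (fun s : ℝ => s * (|M|+1)) (𝓝 0) (𝓝 (0 * (|M|+1))) := by
        apply Continuous.tendsto; fun_prop
      exact this.eventually (gt_mem_nhds (by norm_num))
    filter_upwards [self_mem_nhdsWithin, h1.filter_mono nhdsWithin_le_nhds,
      Ioo_mem_nhdsGT (show (0:ℝ) < 1 by norm_num)] with s hs h2 h3
    exact hesc s hs h3.2 h2
  have hlim : ∀ j, Tendsto (fun s : ℝ => (FF (Vs s) c)^[j] c) (𝓝[>] 0) (𝓝 ((FF V c)^[j] c)) ∧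
      ‖(FF V c)^[j] c‖ ≤ ‖c‖+4 := by
    intro j
    have hb : Tendsto (fun s : ℝ => (FF (Vs s) c)^[j] c) (𝓝[>] 0) (𝓝 ((FF V c)^[j] c)) →
        ‖(FF V c)^[j] c‖ ≤ ‖c‖+4 := fun h =>
      le_of_tendsto h.norm (hev.mono fun s hs => (hs j).le)
    suffices h : Tendsto (fun s : ℝ => (FF (Vs s) c)^[j] c) (𝓝[>] 0) (𝓝 ((FF V c)^[j] c)) from ⟨h, hb h⟩
    clear hb
    induction j with
    | zero => exact tendsto_const_nhds
    | succ j ih =>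
      have hb : ‖(FF V c)^[j] c‖ ≤ ‖c‖+4 := le_of_tendsto ih.norm (hev.mono fun s hs => (hs j).le)
      simp only [iterate_succ_apply']
      have hVc : ContinuousAt V ((FF V c)^[j] c) := by
        have hm : (FF V c)^[j] c ∈ ball (0:ℂ) (‖c‖+10) := by rw [mem_ball_zero_iff]; linarith
        exact ((hV _ hm).differentiableAt (isOpen_ball.mem_nhds hm)).continuousAt
      have hs0 : Tendsto (fun s : ℝ => (s:ℂ)) (𝓝[>] 0) (𝓝 0) := by
        have : Tendsto (fun s : ℝ => (s:ℂ)) (𝓝 0) (𝓝 ((0:ℝ):ℂ)) := Complex.continuous_ofReal.tendsto 0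
        simpa using this.mono_left nhdsWithin_le_nhds
      have h1 := ((ih.add ((hVc.tendsto.comp ih).add
        (hs0.mul ((hpd.continuous.tendsto _).comp ih)))).pow 2).add_const c
      simp only [zero_mul, add_zero] at h1
      exact h1
  intro j
  linarith [(hlim j).2]

end SQB

namespace SQB
open MeasureTheory Filter Topology

lemma unif (c : ℂ) (n : ℕ) (hn : 1 ≤ n) (orb : ℕ → ℂ)
    (ho : ∀ i, orb i ^ 2 + c = orb (i+1)) (hper : ∀ i, orb (i+n) = orb i)
    (hdist : ∀ i, 0 < i → i < n → orb i ≠ orb 0)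
    (hA : ∀ i, ‖orb i‖ < ‖c‖ + 4) (hlam : ‖∏ i ∈ Finset.range n, (2 * orb i)‖ ≤ 1)
    (ρ : ℝ) (hρ : 0 < ρ)
    (hρb : ∀ x ∈ ball (orb 0) ρ, ∀ k, ‖(fun z : ℂ => z^2+c)^[k] x‖ < ‖c‖+5) :
    ∃ ρ' > 0, ∀ u : ℂ → ℂ, DifferentiableOn ℂ u (ball 0 (‖c‖+10)) →
      (∀ z ∈ ball (0:ℂ) (‖c‖+10), ‖u z‖ ≤ 1/16) → (∀ i, u (orb i) = 0) →
      (∀ i, HasDerivAt u 0 (orb i)) → ∀ x ∈ ball (orb 0) ρ', ∀ k, ‖(FF u c)^[k] x‖ < ‖c‖+5 := by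
  have hc := norm_nonneg c
  refine ⟨min 1 (ρ * (ρ / (2*‖c‖+11))^2), by positivity, ?_⟩
  intro u hu hub hu0 hu1 x hx
  by_contra! hcon
  classical
  set F := FF u c with hF
  obtain ⟨k, hk, hkm⟩ : ∃ k, ‖c‖+5 ≤ ‖F^[k] x‖ ∧ ∀ i < k, ‖F^[i] x‖ < ‖c‖+5 :=
    ⟨Nat.find hcon, Nat.find_spec hcon, fun i hi => not_le.1 (Nat.find_min hcon hi)⟩
  have hxd : ‖x - orb 0‖ < min 1 (ρ * (ρ / (2*‖c‖+11))^2) := by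
    rw [← dist_eq_norm]; exact hx
  have hxd1 := hxd.trans_le (min_le_left _ _)
  have hxd2 := hxd.trans_le (min_le_right _ _)
  have hxn : ‖x‖ < ‖c‖ + 5 := by
    calc ‖x‖ = ‖(x - orb 0) + orb 0‖ := by ring_nf
      _ ≤ ‖x - orb 0‖ + ‖orb 0‖ := norm_add_le _ _
      _ < ‖c‖+5 := by linarith [hA 0]
  set w := F^[k] x with hw
  have hwb : ‖w‖ + ‖c‖ ≤ (‖c‖+6.25)^2 := by
    cases k with
    | zero => have h0 : w = x := rfl
              rw [h0] at hk; linarith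
    | succ k =>
      have h1 := hkm k (by omega)
      have h2 := hub (F^[k] x) (by rw [mem_ball_zero_iff]; linarith)
      rw [hw, iterate_succ_apply', hF, FF]
      have h3 : ‖(FF u c)^[k] x + u ((FF u c)^[k] x)‖ ≤ ‖c‖+5+1/16 := by
        refine (norm_add_le _ _).trans ?_
        linarith
      have h4 : ‖((FF u c)^[k] x + u ((FF u c)^[k] x))^2‖ ≤ (‖c‖+5+1/16)^2 := by
        rw [norm_pow]; gcongr
      have h5 := norm_add_le (((FF u c)^[k] x + u ((FF u c)^[k] x))^2) c
      nlinarith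
  set v : ℂ → ℂ → ℂ := fun t z => 2 * t * u z with hv
  have hvh : v (1/2) = u := by funext z; simp [hv]
  have hvb : ∀ t ∈ ball (0:ℂ) 1, ∀ z ∈ ball (0:ℂ) (‖c‖+10), ‖v t z‖ ≤ 1/8 := by
    intro t ht z hz
    rw [mem_ball_zero_iff] at ht
    have := hub z hz
    simp only [hv, norm_mul, Complex.norm_ofNat]
    nlinarith [norm_nonneg t, norm_nonneg (u z)]
  have hvd : ∀ t, DifferentiableOn ℂ (v t) (ball 0 (‖c‖+10)) := fun t => hu.const_mul _
  have hvo : ∀ t i, FF (v t) c (orb i) = orb (i+1) := by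
    intro t i; simp [FF, hv, hu0, ho]
  have hne : ∀ t ∈ ball (0:ℂ) 1, ∀ j, ‖(FF (v t) c)^[j] c‖ < ‖c‖+5 := by
    intro t ht
    refine nonesc c (v t) (hvd t) (hvb t ht) n hn orb ho hper hdist hA hlam ?_ ?_
    · intro i; simp [hv, hu0]
    · intro i; simpa using (hu1 i).const_mul (2*t)
  have hhalf : (1/2:ℂ) ∈ ball (0:ℂ) 1 := by
    rw [mem_ball_zero_iff]; norm_num
  have hj : ∀ j ≤ k, ∃ y : ℂ → ℂ, DifferentiableOn ℂ y (ball 0 1) ∧ y (1/2) = F^[k-j] x ∧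
      ∀ t ∈ ball (0:ℂ) 1, (FF (v t) c)^[j] (y t) = w ∧ ‖y t‖ + ‖c‖ ≤ (‖c‖+6.25)^2 ∧
        (1 ≤ j → ‖y t‖ ≤ ‖c‖+6.5) := by
    intro j
    induction j with
    | zero =>
      intro _
      exact ⟨fun _ => w, differentiableOn_const _, rfl, fun t _ => ⟨rfl, hwb, by omega⟩⟩
    | succ j ih =>
      intro hjk
      obtain ⟨y, hyd, hy0, hy⟩ := ih (by omega)
      obtain ⟨x', hxd, hx0, hx'⟩ := pullback c 0 1 v
        (fun t ht x hx => (hvb t ht x (ball_subset_ball (by linarith) hx)).trans (by norm_num))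
        (fun t ht x hx y hy => (lip_of_bound (v t) (‖c‖+9) (1/8)
          (by convert hvd t using 2; ring) (by convert hvb t ht using 4; ring) x hx y hy).trans
          (by gcongr; norm_num))
        (fun x hxd hxm => by
          refine DifferentiableOn.mul (by fun_prop) (hu.comp hxd ?_)
          exact fun t ht => ball_subset_ball (by linarith) (hxm ht))
        y hyd (by
          intro t ht hyt
          have h1 := (hy t ht).1
          have h2 := hne t ht j
          rw [hyt] at h1
          rw [h1] at h2
          linarith) (‖c‖+6.25) (by positivity) (by linarith)
        (fun t ht => (hy t ht).2.1) (1/2) hhalf (F^[k-(j+1)] x) (by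
          rw [mem_ball_zero_iff]
          have := hkm (k-(j+1)) (by omega)
          linarith) (by
          rw [hvh, hy0, show k - j = (k-(j+1)) + 1 by omega, iterate_succ_apply']
          rfl)
      refine ⟨x', hxd, hx0, fun t ht => ?_⟩
      obtain ⟨h1, h2⟩ := hx' t ht
      refine ⟨?_, by nlinarith, fun _ => by linarith⟩
      rw [iterate_succ_apply]
      have : FF (v t) c (x' t) = y t := h1
      rw [this]; exact (hy t ht).1
  have hk1 : 1 ≤ k := by
    by_contra! h
    obtain rfl : k = 0 := by omega
    rw [hw] at hk; simp only [iterate_zero, id] at hk; linarith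
  obtain ⟨y, hyd, hy0, hy⟩ := hj k le_rfl
  rw [Nat.sub_self, iterate_zero, id] at hy0
  have hharn := harnack (fun t => y t - orb 0) (hyd.sub_const _) (by
      intro t ht h0
      have h1 := (hy t ht).1
      rw [sub_eq_zero.1 h0, orb_iter _ orb (hvo t)] at h1
      rw [← h1] at hk
      linarith [hA (0+k)]) (2*‖c‖+11) ρ hρ (by
      intro t ht
      have h1 := (hy t ht).2.2 hk1
      have := norm_sub_le (y t) (orb 0)
      linarith [hA 0]) (by
      have h00 : (0:ℂ) ∈ ball (0:ℂ) 1 := mem_ball_self one_pos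
      have h1 := (hy 0 h00).1
      by_contra! h
      have h2 := hρb (y 0) (by rw [mem_ball, dist_eq_norm]; exact h) k
      have h3 : FF (v 0) c = fun z : ℂ => z^2+c := by funext z; simp [FF, hv]
      rw [h3] at h1
      rw [h1] at h2
      linarith) (1/2) (by norm_num)
  simp only [hy0] at hharn
  linarith

lemma orbit_small (c x : ℂ) (M : ℝ) (hM : ∀ k, ‖(fun z : ℂ => z^2+c)^[k] x‖ ≤ M) :
    ∀ k, ‖(fun z : ℂ => z^2+c)^[k] x‖ < ‖c‖+4 := by
  by_contra! hcon
  obtain ⟨k, hk⟩ := hcon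
  have hc := norm_nonneg c
  have key : ∀ j : ℕ, (2:ℝ)^j * (‖c‖+4) ≤ ‖(fun z : ℂ => z^2+c)^[k+j] x‖ := by
    intro j
    induction j with
    | zero => simpa using hk
    | succ j ih =>
      rw [← add_assoc, iterate_succ_apply']
      set y := (fun z : ℂ => z^2+c)^[k+j] x
      have h1 : (1:ℝ) ≤ 2^j := one_le_pow₀ (by norm_num)
      have h2 : ‖c‖+4 ≤ ‖y‖ := by nlinarith
      have h3 : ‖y‖^2 ≤ ‖y^2+c‖ + ‖c‖ := by
        rw [← norm_pow]
        calc ‖y^2‖ = ‖(y^2+c) - c‖ := by ring_nf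
          _ ≤ _ := norm_sub_le _ _
      rw [pow_succ]
      have h4 : 2*‖y‖ ≤ ‖y^2+c‖ := by nlinarith
      linarith
  have ht : Tendsto (fun j : ℕ => (2:ℝ)^j) atTop atTop := tendsto_pow_atTop_atTop_of_one_lt (by norm_num)
  obtain ⟨j, hj⟩ := (ht.eventually (eventually_gt_atTop M)).exists
  have := key j
  have := hM (k+j)
  have h1 : (1:ℝ) ≤ 2^j := one_le_pow₀ (by norm_num)
  nlinarith [norm_nonneg c]

end SQB

namespace SQB
open MeasureTheory Filter Topology

lemma exists_ab (Z : Finset ℂ) (z0 : ℂ) :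
    ∃ a b : ℂ → ℂ, Differentiable ℂ a ∧ Differentiable ℂ b ∧ a z0 = 1 ∧
      (∀ ζ ∈ Z, ζ ≠ z0 → a ζ = 0) ∧ ∀ z, a z ^ 2 - a z = (∏ ζ ∈ Z, (z - ζ)) * b z := by
  classical
  set A : Polynomial ℂ := ∏ ζ ∈ Z.erase z0, (Polynomial.C (z0 - ζ)⁻¹ * (Polynomial.X - Polynomial.C ζ)) with hA
  have h1 : A.eval z0 = 1 := by
    rw [hA, Polynomial.eval_prod]
    apply Finset.prod_eq_one
    intro ζ hζ
    simp only [Polynomial.eval_mul, Polynomial.eval_C, Polynomial.eval_sub, Polynomial.eval_X]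
    rw [inv_mul_cancel₀]; exact sub_ne_zero.2 (Finset.ne_of_mem_erase hζ).symm
  have h2 : ∀ ζ ∈ Z, ζ ≠ z0 → A.eval ζ = 0 := by
    intro ζ hζ hne
    rw [hA, Polynomial.eval_prod]
    exact Finset.prod_eq_zero (Finset.mem_erase.2 ⟨hne, hζ⟩) (by simp)
  have h3 : (∏ ζ ∈ Z, (Polynomial.X - Polynomial.C ζ)) ∣ A^2 - A := by
    refine Finset.prod_dvd_of_coprime ?_ ?_
    · intro x _ y _ hxy
      exact Polynomial.pairwise_coprime_X_sub_C (s := id) injective_id hxy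
    · intro ζ hζ
      rw [Polynomial.dvd_iff_isRoot, Polynomial.IsRoot]
      by_cases h : ζ = z0
      · simp [h, h1]
      · simp [h2 ζ hζ h]
  obtain ⟨B, hB⟩ := h3
  refine ⟨fun z => A.eval z, fun z => B.eval z, A.differentiable, B.differentiable, h1, h2, fun z => ?_⟩
  have := congr_arg (Polynomial.eval z) hB
  simpa [Polynomial.eval_prod] using this

lemma h_deriv_ne (P h : ℂ → ℂ) (lam z0 : ℂ) (hh : AnalyticAt ℂ h 0) (h0 : h 0 = z0)
    (hnc : ¬ ∀ᶠ z in 𝓝 (0:ℂ), h z = z0) (hP : HasDerivAt P lam z0)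
    (hPz : P z0 = z0) (hconj : ∀ᶠ z in 𝓝 (0:ℂ), P (h z) = h (lam * z))
    (hl0 : lam ≠ 0) (hl : ∀ k : ℕ, 1 ≤ k → lam ^ k ≠ 1) : deriv h 0 ≠ 0 := by
  obtain ⟨m, g, hg, hg0, hgm⟩ := (hh.fun_sub (analyticAt_const (v := z0))).exists_eventuallyEq_pow_smul_nonzero_iff.2
    (by intro h; exact hnc (h.mono fun z hz => sub_eq_zero.1 hz))
  simp only [sub_zero, smul_eq_mul] at hgm
  have hm1 : m = 1 := by
    have hm0 : m ≠ 0 := by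
      rintro rfl
      have := hgm.self_of_nhds
      simp [h0] at this
      exact hg0 this.symm
    have hcont : ContinuousAt (dslope P z0) z0 := continuousAt_dslope_same.2 hP.differentiableAt
    have hl1 : Tendsto (fun z => lam * z) (𝓝 (0:ℂ)) (𝓝 0) := by
      have : Continuous fun z : ℂ => lam * z := by fun_prop
      simpa using this.tendsto 0
    have heq : ∀ᶠ z in 𝓝[≠] (0:ℂ), g z * dslope P z0 (h z) = lam^m * g (lam * z) := by
      have e1 := hgm.filter_mono (nhdsWithin_le_nhds (s := {0}ᶜ))
      have e2 := (hl1.eventually hgm).filter_mono (nhdsWithin_le_nhds (s := {0}ᶜ))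
      have e3 := hconj.filter_mono (nhdsWithin_le_nhds (s := {0}ᶜ))
      filter_upwards [e1, e2, e3, self_mem_nhdsWithin] with z h1 h2 h3 hz
      have h4 := sub_smul_dslope P z0 (h z)
      rw [hPz, h3, smul_eq_mul, h1, h2] at h4
      have hz' : z ^ m ≠ 0 := pow_ne_zero _ hz
      apply mul_left_cancel₀ hz'
      rw [← mul_assoc, h4, mul_pow]; ring
    have t1 : Tendsto (fun z => g z * dslope P z0 (h z)) (𝓝[≠] (0:ℂ)) (𝓝 (g 0 * lam)) := by
      have hd : dslope P z0 z0 = lam := by rw [dslope_same, hP.deriv]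
      have := hcont.tendsto
      rw [hd] at this
      have hh' := hh.continuousAt.tendsto
      rw [h0] at hh'
      exact (hg.continuousAt.tendsto.mul (this.comp hh')).mono_left nhdsWithin_le_nhds
    have t2 : Tendsto (fun z => lam^m * g (lam*z)) (𝓝[≠] (0:ℂ)) (𝓝 (lam^m * g 0)) :=
      ((hg.continuousAt.tendsto.comp hl1).const_mul _).mono_left nhdsWithin_le_nhds
    have h5 := tendsto_nhds_unique (t1.congr' heq) t2
    by_contra hne
    obtain ⟨j, rfl⟩ : ∃ j, m = j + 1 := ⟨m-1, by omega⟩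
    refine hl j (by omega) ?_
    rw [pow_succ] at h5
    have : lam ≠ 0 := hl0
    field_simp at h5
    exact h5.symm
  subst hm1
  have hd : HasDerivAt (fun z => z ^ 1 * g z) (g 0) 0 := by
    have := ((hasDerivAt_id (0:ℂ)).fun_pow 1).fun_mul hg.differentiableAt.hasDerivAt
    refine this.congr_deriv ?_
    simp
  have hd2 : HasDerivAt (fun z => h z - z0) (g 0) 0 := hd.congr_of_eventuallyEq hgm
  have hd3 : HasDerivAt h (g 0) 0 := by simpa using hd2.add_const z0
  rw [hd3.deriv]; exact hg0

lemma dslope_twice (χ : ℂ → ℂ) (P0 M : ℝ) (hP : 0 < P0) (hχ : DifferentiableOn ℂ χ (ball 0 P0))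
    (hM : ∀ z ∈ ball (0:ℂ) P0, ‖χ z‖ ≤ M) (h0 : χ 0 = 0) (h1 : deriv χ 0 = 0) :
    ∃ k : ℂ → ℂ, DifferentiableOn ℂ k (ball 0 P0) ∧ (∀ z ∈ ball (0:ℂ) P0, ‖k z‖ ≤ M / P0 / P0) ∧
      ∀ z, χ z = z^2 * k z := by
  have hn : ball (0:ℂ) P0 ∈ 𝓝 (0:ℂ) := isOpen_ball.mem_nhds (mem_ball_self hP)
  have d1 : DifferentiableOn ℂ (dslope χ 0) (ball 0 P0) := (Complex.differentiableOn_dslope hn).2 hχ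
  have d2 : DifferentiableOn ℂ (dslope (dslope χ 0) 0) (ball 0 P0) :=
    (Complex.differentiableOn_dslope hn).2 d1
  have b1 : ∀ z ∈ ball (0:ℂ) P0, ‖dslope χ 0 z‖ ≤ M / P0 := fun z hz =>
    Complex.norm_dslope_le_div_of_mapsTo_ball hχ (by
      intro w hw; rw [h0, mem_closedBall_zero_iff]; exact hM w hw) hz
  have e0 : dslope χ 0 0 = 0 := by rw [dslope_same, h1]
  have b2 : ∀ z ∈ ball (0:ℂ) P0, ‖dslope (dslope χ 0) 0 z‖ ≤ M / P0 / P0 := fun z hz =>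
    Complex.norm_dslope_le_div_of_mapsTo_ball d1 (by
      intro w hw; rw [e0, mem_closedBall_zero_iff]; exact b1 w hw) hz
  refine ⟨_, d2, b2, fun z => ?_⟩
  have s1 := sub_smul_dslope χ 0 z
  have s2 := sub_smul_dslope (dslope χ 0) 0 z
  simp only [sub_zero, smul_eq_mul, h0, e0] at s1 s2
  rw [← s1, ← s2]; ring

lemma kdata (h : ℂ → ℂ) (r0 : ℝ) (hr0 : 0 < r0) (hd : DifferentiableOn ℂ h (ball 0 r0))
    (hh0 : deriv h 0 ≠ 0) (p : ℂ → ℂ) (hp : Differentiable ℂ p) (hp0 : p (h 0) = 0)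
    (hp1 : deriv p (h 0) ≠ 0) (α : ℝ) :
    ∃ P0 > 0, ∃ Mk : ℝ, ∀ G, Cls α G → ∃ k : ℂ → ℂ, DifferentiableOn ℂ k (ball 0 P0) ∧
      (∀ P ∈ ball (0:ℂ) P0, ‖k P‖ ≤ Mk) ∧
      ∀ᶠ ζ in 𝓝 (0:ℂ), (p (h ζ))^2 * k (p (h ζ)) = h ((ee α)⁻¹ * G ζ) - h ζ := by
  have hn0 : ball (0:ℂ) r0 ∈ 𝓝 (0:ℂ) := isOpen_ball.mem_nhds (mem_ball_self hr0)
  have hda : DifferentiableAt ℂ h 0 := hd.differentiableAt hn0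
  obtain ⟨Mh, hMh⟩ := (isCompact_closedBall (0:ℂ) (r0/2)).exists_bound_of_continuousOn
    (hd.continuousOn.mono (closedBall_subset_ball (by linarith)))
  set m : ℂ → ℂ := fun z => p (h z) with hm
  have hman : AnalyticAt ℂ m 0 := by
    have h1 : AnalyticAt ℂ h 0 := hd.analyticAt hn0
    exact (hp.analyticAt (h 0)).comp h1
  have hmd : HasStrictDerivAt m (deriv m 0) 0 := hman.hasStrictDerivAt
  have hm1 : deriv m 0 ≠ 0 := by
    have := ((hp (h 0)).hasDerivAt.comp (0:ℂ) hda.hasDerivAt).deriv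
    have h2 : deriv m 0 = deriv p (h 0) * deriv h 0 := this
    rw [h2]; exact mul_ne_zero hp1 hh0
  have hm0 : m 0 = 0 := hp0
  set θ := hmd.localInverse m _ 0 hm1 with hθ
  have hleft : ∀ᶠ x in 𝓝 (0:ℂ), θ (m x) = x := hmd.eventually_left_inverse hm1
  have hθ0 : θ 0 = 0 := by have := hleft.self_of_nhds; rwa [hm0] at this
  have hθd : ∀ᶠ y in 𝓝 (0:ℂ), DifferentiableAt ℂ θ y := by
    have hopen : ∀ᶠ x in 𝓝 (0:ℂ), DifferentiableAt ℂ θ (m x) := by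
      have h1 : ∀ᶠ x in 𝓝 (0:ℂ), AnalyticAt ℂ m x := hman.eventually_analyticAt
      have h2 : ∀ᶠ x in 𝓝 (0:ℂ), deriv m x ≠ 0 := hman.deriv.continuousAt.eventually_ne hm1
      filter_upwards [h1, h2, hleft.eventually_nhds] with x a1 a2 a3
      exact (a1.hasStrictDerivAt.to_local_left_inverse a2 a3).hasDerivAt.differentiableAt
    have := hmd.map_nhds_eq hm1
    rw [hm0] at this
    rw [← this]
    exact hopen
  have hθc : ContinuousAt θ 0 := hθd.self_of_nhds.continuousAt
  set r2 : ℝ := min (1/2) (r0/1000) with hr2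
  have hr2p : 0 < r2 := by positivity
  obtain ⟨P0, hP0, hP⟩ := Metric.eventually_nhds_iff_ball.1 (hθd.and
    (hθc.tendsto.eventually (by rw [hθ0]; exact isOpen_ball.mem_nhds (mem_ball_self hr2p))))
  refine ⟨P0, hP0, 2 * Mh / P0 / P0, fun G hG => ?_⟩
  have hGs : ∀ z ∈ ball (0:ℂ) 1, ‖G z‖ ≤ 200 * ‖z‖ := by
    intro z hz
    have := Complex.norm_dslope_le_div_of_mapsTo_ball hG.diff (R₂ := 200) (by
      intro w hw; rw [hG.zero, mem_closedBall_zero_iff]; exact hG.bd w hw) hz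
    have s1 := sub_smul_dslope G 0 z
    simp only [sub_zero, smul_eq_mul, hG.zero] at s1
    rw [← s1, norm_mul]
    rw [div_one] at this
    nlinarith [norm_nonneg z]
  have hle : ‖(ee α)⁻¹‖ = 1 := by rw [norm_inv, ee_norm_real, inv_one]
  have hr2a : r2 ≤ 1/2 := min_le_left _ _
  have hr2b : r2 ≤ r0/1000 := min_le_right _ _
  have hin : ∀ P ∈ ball (0:ℂ) P0, ‖θ P‖ < r2 := fun P hPP => by
    have := (hP P hPP).2
    rwa [dist_zero_right] at this
  have hin1 : ∀ x : ℂ, ‖x‖ < r2 → ‖(ee α)⁻¹ * G x‖ ≤ r0/2 := by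
    intro x hx
    rw [norm_mul, hle, one_mul]
    have := hGs x (by rw [mem_ball_zero_iff]; linarith)
    linarith
  have hGd : ∀ x : ℂ, ‖x‖ < r2 → DifferentiableAt ℂ G x := fun x hx =>
    hG.diff.differentiableAt (isOpen_ball.mem_nhds (by rw [mem_ball_zero_iff]; linarith))
  have hhd : ∀ x : ℂ, ‖x‖ ≤ r0/2 → DifferentiableAt ℂ h x := fun x hx =>
    hd.differentiableAt (isOpen_ball.mem_nhds (by rw [mem_ball_zero_iff]; linarith))
  set χ : ℂ → ℂ := fun P => h ((ee α)⁻¹ * G (θ P)) - h (θ P) with hχ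
  have hχ0 : χ 0 = 0 := by simp [hχ, hθ0, hG.zero]
  have hχ1 : HasDerivAt χ 0 0 := by
    have d0 : HasDerivAt G (ee α) 0 := by
      rw [← hG.der]; exact (hGd 0 (by simpa using hr2p)).hasDerivAt
    have d1 : HasDerivAt (fun x => (ee α)⁻¹ * G x) ((ee α)⁻¹ * ee α) 0 := d0.const_mul _
    rw [inv_mul_cancel₀ (ee_ne _)] at d1
    have d2 : HasDerivAt (fun x => h ((ee α)⁻¹ * G x)) (deriv h 0 * 1) 0 := by
      refine HasDerivAt.comp (0:ℂ) ?_ d1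
      simpa [hG.zero] using hda.hasDerivAt
    have d3 : HasDerivAt (fun x => h ((ee α)⁻¹ * G x) - h x) 0 0 := by
      simpa using d2.fun_sub hda.hasDerivAt
    have d4 : HasDerivAt θ (deriv θ 0) 0 := hθd.self_of_nhds.hasDerivAt
    have d5 := HasDerivAt.comp (0:ℂ) (h₂ := fun x => h ((ee α)⁻¹ * G x) - h x) (h₂' := 0)
      (by rw [hθ0]; exact d3) d4
    rw [zero_mul] at d5
    exact d5
  obtain ⟨k, hk1, hk2, hk3⟩ := dslope_twice χ P0 (2*Mh) hP0 (by
      intro P hPP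
      have a1 := (hP P hPP).1
      have a2 := hin P hPP
      apply DifferentiableAt.differentiableWithinAt
      refine DifferentiableAt.fun_sub ?_ ?_
      · exact DifferentiableAt.comp P (hhd _ (hin1 _ a2))
          (((hGd _ a2).comp P a1).const_mul _)
      · exact DifferentiableAt.comp P (hhd _ (by linarith)) a1) (by
      intro P hPP
      have a2 := hin P hPP
      have b1 := hMh ((ee α)⁻¹ * G (θ P)) (by rw [mem_closedBall_zero_iff]; exact hin1 _ a2)
      have b2 := hMh (θ P) (by rw [mem_closedBall_zero_iff]; linarith)
      have := norm_sub_le (h ((ee α)⁻¹ * G (θ P))) (h (θ P))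
      simp only [hχ]; linarith) hχ0 hχ1.deriv
  refine ⟨k, hk1, hk2, ?_⟩
  filter_upwards [hleft] with ζ hζ
  change m ζ ^ 2 * k (m ζ) = _
  rw [← hk3, hχ]
  simp only [hζ]

end SQB

namespace SQB
open MeasureTheory Filter Topology

/-- `(1+x)^(-1/2)` -/
noncomputable def rt (x : ℂ) : ℂ := Complex.exp (-(Complex.log (1 + x)) / 2)

lemma rt_zero : rt 0 = 1 := by simp [rt]

lemma one_add_ne (x : ℂ) (hx : ‖x‖ < 1) : 1 + x ≠ 0 := by
  intro h
  have : x = -1 := by linear_combination h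
  rw [this] at hx; norm_num at hx

lemma rt_sq (x : ℂ) (hx : ‖x‖ < 1) : rt x ^ 2 * (1 + x) = 1 := by
  have h1 : rt x ^ 2 = Complex.exp (-(Complex.log (1+x))) := by
    rw [rt, ← Complex.exp_nat_mul]; congr 1; push_cast; ring
  rw [h1, Complex.exp_neg, Complex.exp_log (one_add_ne x hx), inv_mul_cancel₀ (one_add_ne x hx)]

lemma rt_norm (x : ℂ) (hx : ‖x‖ ≤ 1/2) : ‖rt x‖ ≤ 2 := by
  have h1 := congr_arg norm (rt_sq x (by linarith))
  rw [norm_mul, norm_pow, norm_one] at h1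
  have h2 : 1/2 ≤ ‖1 + x‖ := by
    have := norm_sub_le (1 + x) x
    simp at this
    linarith
  nlinarith [norm_nonneg (rt x)]

lemma rt_an (x : ℂ) (hx : ‖x‖ < 1) : AnalyticAt ℂ rt x := by
  have h1 : AnalyticAt ℂ (fun x : ℂ => Complex.log (1 + x)) x :=
    (analyticAt_const.add analyticAt_id).clog (Complex.mem_slitPlane_of_norm_lt_one hx)
  unfold rt
  exact ((h1.fun_neg).fun_div analyticAt_const (by norm_num)).cexp

/-- the correction factor -/
noncomputable def KK (a b k : ℂ → ℂ) (P z : ℂ) : ℂ :=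
  k P * (1/2 + (2 * a z - 1)/2 * rt (4 * P * b z))

/-- the perturbation -/
noncomputable def UUp (a b k p : ℂ → ℂ) (τ z : ℂ) : ℂ := τ * p z ^ 2 * KK a b k (τ * p z) z

/-- scaled `P` -/
noncomputable def PPm (Z : Finset ℂ) (o σ s : ℂ) : ℂ := s * ∏ ζ ∈ Z.erase o, (o + σ * s - ζ)

/-- one scaled step -/
noncomputable def stp (Z : Finset ℂ) (a b k : ℂ → ℂ) (o σ s : ℂ) : ℂ :=
  2 * o * (s + PPm Z o σ s ^ 2 * KK a b k (PPm Z o σ s) (o + σ * s)) +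
    σ * (s + PPm Z o σ s ^ 2 * KK a b k (PPm Z o σ s) (o + σ * s)) ^ 2

/-- scaled iterates -/
noncomputable def SSm (Z : Finset ℂ) (orb : ℕ → ℂ) (a b k : ℂ → ℂ) : ℕ → ℂ × ℂ → ℂ
  | 0, x => x.2
  | m+1, x => stp Z a b k (orb m) x.1 (SSm Z orb a b k m x)

lemma SSm_eq (Z : Finset ℂ) (orb : ℕ → ℂ) (a b k : ℂ → ℂ) (c : ℂ) (ho : ∀ i, orb i ^ 2 + c = orb (i+1))
    (hZ : ∀ i, orb i ∈ Z) (τ σ : ℂ) (hτ : τ * σ = 1) (w : ℂ) (m : ℕ) :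
    (FF (UUp a b k (fun z => ∏ ζ ∈ Z, (z - ζ)) τ) c)^[m] (orb 0 + σ * w) =
      orb m + σ * SSm Z orb a b k m (σ, w) := by
  induction m with
  | zero => simp [SSm]
  | succ m ih =>
    rw [iterate_succ_apply', ih]
    set s := SSm Z orb a b k m (σ, w) with hs
    have hp : (∏ ζ ∈ Z, (orb m + σ * s - ζ)) = σ * PPm Z (orb m) σ s := by
      rw [← Finset.mul_prod_erase Z _ (hZ m), PPm]; ring
    have hp2 : τ * (σ * PPm Z (orb m) σ s) = PPm Z (orb m) σ s := by
      rw [← mul_assoc, hτ, one_mul]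
    have hS : SSm Z orb a b k (m+1) (σ, w) = stp Z a b k (orb m) σ s := rfl
    rw [hS, FF, UUp, stp, hp, hp2, ← ho m]
    generalize KK a b k (PPm Z (orb m) σ s) (orb m + σ * s) = K
    generalize PPm Z (orb m) σ s = P
    linear_combination (2 * orb m * σ * P^2 * K + 2 * σ^2 * s * P^2 * K + (σ * P^2 * K) ^2 * (τ * σ + 1)) * hτ

lemma SSm_an (Z : Finset ℂ) (orb : ℕ → ℂ) (a b k : ℂ → ℂ) (ha : Differentiable ℂ a)
    (hb : Differentiable ℂ b) (hk : AnalyticAt ℂ k 0) (σ : ℂ) (m : ℕ) :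
    AnalyticAt ℂ (SSm Z orb a b k m) (σ, 0) ∧ SSm Z orb a b k m (σ, 0) = 0 := by
  induction m with
  | zero => exact ⟨analyticAt_snd, rfl⟩
  | succ m ih =>
    obtain ⟨hS, hS0⟩ := ih
    have hfst : AnalyticAt ℂ (fun x : ℂ × ℂ => x.1) (σ, 0) := analyticAt_fst
    have hz : AnalyticAt ℂ (fun x : ℂ × ℂ => orb m + x.1 * SSm Z orb a b k m x) (σ, 0) :=
      analyticAt_const.fun_add (hfst.fun_mul hS)
    have hP : AnalyticAt ℂ (fun x : ℂ × ℂ => PPm Z (orb m) x.1 (SSm Z orb a b k m x)) (σ, 0) := by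
      unfold PPm
      refine hS.fun_mul (Finset.analyticAt_fun_prod _ fun ζ _ => ?_)
      exact hz.fun_sub analyticAt_const
    have hP0 : PPm Z (orb m) σ (SSm Z orb a b k m (σ, 0)) = 0 := by rw [hS0, PPm, zero_mul]
    have hK : AnalyticAt ℂ (fun x : ℂ × ℂ => KK a b k (PPm Z (orb m) x.1 (SSm Z orb a b k m x))
        (orb m + x.1 * SSm Z orb a b k m x)) (σ, 0) := by
      unfold KK
      have h1 : AnalyticAt ℂ (fun x : ℂ × ℂ => k (PPm Z (orb m) x.1 (SSm Z orb a b k m x))) (σ, 0) :=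
        AnalyticAt.fun_comp (by simpa only [hP0] using hk) hP
      have h2 : AnalyticAt ℂ (fun x : ℂ × ℂ => a (orb m + x.1 * SSm Z orb a b k m x)) (σ, 0) :=
        AnalyticAt.fun_comp (ha.analyticAt _) hz
      have h3 : AnalyticAt ℂ (fun x : ℂ × ℂ => b (orb m + x.1 * SSm Z orb a b k m x)) (σ, 0) :=
        AnalyticAt.fun_comp (hb.analyticAt _) hz
      have h4 : AnalyticAt ℂ (fun x : ℂ × ℂ => rt (4 * PPm Z (orb m) x.1 (SSm Z orb a b k m x) *
          b (orb m + x.1 * SSm Z orb a b k m x))) (σ, 0) :=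
        AnalyticAt.fun_comp (g := rt) (rt_an _ (by simp [hP0]))
          ((analyticAt_const.fun_mul hP).fun_mul h3)
      exact h1.fun_mul (analyticAt_const.fun_add
        ((((analyticAt_const.fun_mul h2).fun_sub analyticAt_const).fun_div analyticAt_const
          (by norm_num)).fun_mul h4))
    have hw : AnalyticAt ℂ (fun x : ℂ × ℂ => SSm Z orb a b k m x +
        PPm Z (orb m) x.1 (SSm Z orb a b k m x) ^ 2 *
        KK a b k (PPm Z (orb m) x.1 (SSm Z orb a b k m x))
        (orb m + x.1 * SSm Z orb a b k m x)) (σ, 0) := hS.fun_add ((hP.fun_pow 2).fun_mul hK)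
    constructor
    · exact (analyticAt_const.fun_mul hw).fun_add (hfst.fun_mul (hw.fun_pow 2))
    · change stp Z a b k (orb m) σ (SSm Z orb a b k m (σ, 0)) = 0
      rw [stp, hP0, hS0]; ring

/-- iterated partial derivative in the second variable -/
noncomputable def DD (S : ℂ × ℂ → ℂ) : ℕ → ℂ × ℂ → ℂ
  | 0 => S
  | j+1 => fun x => fderiv ℂ (DD S j) x (0, 1)

lemma DD_an (S : ℂ × ℂ → ℂ) (σ : ℂ) (hS : AnalyticAt ℂ S (σ, 0)) (j : ℕ) :
    AnalyticAt ℂ (DD S j) (σ, 0) := by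
  induction j with
  | zero => exact hS
  | succ j ih =>
    exact ((ContinuousLinearMap.apply ℂ ℂ ((0:ℂ),(1:ℂ))).analyticAt _).comp ih.fderiv

lemma DD_eq (S : ℂ × ℂ → ℂ) (σ : ℂ) (hS : AnalyticAt ℂ S (σ, 0)) (j : ℕ) :
    iteratedDeriv j (fun w => S (σ, w)) =ᶠ[𝓝 0] fun w => DD S j (σ, w) := by
  induction j with
  | zero => simp [DD]
  | succ j ih =>
    rw [iteratedDeriv_succ]
    have hc : Tendsto (fun w : ℂ => (σ, w)) (𝓝 0) (𝓝 (σ, 0)) := by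
      have : Continuous fun w : ℂ => (σ, w) := by fun_prop
      exact this.tendsto 0
    have h1 : ∀ᶠ w in 𝓝 (0:ℂ), AnalyticAt ℂ (DD S j) (σ, w) :=
      hc.eventually (DD_an S σ hS j).eventually_analyticAt
    filter_upwards [ih.eventually_nhds, h1] with w h2 h3
    rw [Filter.EventuallyEq.deriv_eq h2]
    have h4 : HasDerivAt (fun w : ℂ => (σ, w)) ((0:ℂ), (1:ℂ)) w :=
      (hasDerivAt_const w σ).prodMk (hasDerivAt_id w)
    have h5 := h3.differentiableAt.hasFDerivAt.comp_hasDerivAt w h4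
    exact h5.deriv

lemma coeff_max (S : ℂ × ℂ → ℂ) (hS : ∀ σ, AnalyticAt ℂ S (σ, 0)) (j : ℕ) (C σ0 : ℝ) (hσ0 : 1 ≤ σ0)
    (hC : ∀ σ : ℂ, ‖σ‖ = σ0 → ‖iteratedDeriv j (fun w => S (σ, w)) 0‖ ≤ C) :
    ‖iteratedDeriv j (fun w => S (1, w)) 0‖ ≤ C := by
  have heq : ∀ σ, iteratedDeriv j (fun w => S (σ, w)) 0 = DD S j (σ, 0) :=
    fun σ => (DD_eq S σ (hS σ) j).self_of_nhds
  have hd : Differentiable ℂ (fun σ : ℂ => DD S j (σ, 0)) := by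
    intro σ
    have : DifferentiableAt ℂ (fun σ : ℂ => (σ, (0:ℂ))) σ := by fun_prop
    exact (DD_an S σ (hS σ) j).differentiableAt.comp σ this
  rw [heq]
  refine Complex.norm_le_of_forall_mem_frontier_norm_le (U := ball (0:ℂ) σ0) isBounded_ball
    (f := fun σ : ℂ => DD S j (σ, 0)) hd.diffContOnCl ?_ ?_
  · intro σ hσ
    rw [frontier_ball _ (by linarith), mem_sphere_zero_iff_norm] at hσ
    rw [← heq]; exact hC σ hσ
  · rw [closure_ball _ (by linarith), mem_closedBall_zero_iff]; simpa using hσ0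

end SQB

namespace SQB
open MeasureTheory Filter Topology

lemma bdd_ball (g : ℂ → ℂ) (hg : Differentiable ℂ g) (A : ℝ) : ∃ B, ∀ z ∈ ball (0:ℂ) A, ‖g z‖ ≤ B := by
  obtain ⟨B, hB⟩ := (isCompact_closedBall (0:ℂ) A).exists_bound_of_continuousOn hg.continuous.continuousOn
  exact ⟨B, fun z hz => hB z (ball_subset_closedBall hz)⟩

lemma tau_choice (B P0 Mk : ℝ) (hB : 1 ≤ B) (hP0 : 0 < P0) (hMk : 0 ≤ Mk) : ∃ t : ℝ, 0 < t ∧ t ≤ 1 ∧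
    t * B < P0 ∧ 4 * (t * B) * B ≤ 1/2 ∧ t * B^2 * (Mk * (1/2 + (2*B+1))) ≤ 1/16 := by
  have hN : 0 ≤ B^2 * (Mk * (1/2 + (2*B+1))) := by positivity
  set N := B^2 * (Mk * (1/2 + (2*B+1)))
  refine ⟨min (min 1 (P0/(2*B))) (min (1/(8*B^2)) (1/(16*(N+1)))), ?_, ?_, ?_, ?_, ?_⟩
  · positivity
  · exact (min_le_left _ _).trans (min_le_left _ _)
  · have : min (min 1 (P0/(2*B))) (min (1/(8*B^2)) (1/(16*(N+1)))) ≤ P0/(2*B) :=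
      (min_le_left _ _).trans (min_le_right _ _)
    calc _ ≤ P0/(2*B)*B := by gcongr
      _ = P0/2 := by field_simp
      _ < P0 := by linarith
  · have : min (min 1 (P0/(2*B))) (min (1/(8*B^2)) (1/(16*(N+1)))) ≤ 1/(8*B^2) :=
      (min_le_right _ _).trans (min_le_left _ _)
    calc _ ≤ 4*(1/(8*B^2)*B)*B := by gcongr
      _ = 1/2 := by field_simp; norm_num
      _ ≤ _ := le_rfl
  · have : min (min 1 (P0/(2*B))) (min (1/(8*B^2)) (1/(16*(N+1)))) ≤ 1/(16*(N+1)) :=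
      (min_le_right _ _).trans (min_le_right _ _)
    rw [mul_assoc]
    calc _ ≤ 1/(16*(N+1)) * N := by gcongr
      _ ≤ 1/16 := by
        rw [one_div_mul_eq_div, div_le_div_iff₀ (by positivity) (by norm_num)]; nlinarith

lemma flat_deriv (g K : ℂ → ℂ) (x τ : ℂ) (hg : DifferentiableAt ℂ g x) (hK : DifferentiableAt ℂ K x)
    (h0 : g x = 0) : HasDerivAt (fun z => τ * g z ^ 2 * K z) 0 x := by
  have h1 := ((hg.hasDerivAt.fun_pow 2).const_mul τ).fun_mul hK.hasDerivAt
  refine h1.congr_deriv ?_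
  rw [h0]; ring

lemma UU_diff (a b k p : ℂ → ℂ) (ha : Differentiable ℂ a) (hb : Differentiable ℂ b)
    (hp : Differentiable ℂ p) (P0 : ℝ) (hk : DifferentiableOn ℂ k (ball 0 P0)) (τ z : ℂ)
    (h1 : ‖τ * p z‖ < P0) (h2 : ‖4 * (τ * p z) * b z‖ < 1) :
    DifferentiableAt ℂ (fun z => KK a b k (τ * p z) z) z := by
  have hkz : DifferentiableAt ℂ k (τ * p z) :=
    hk.differentiableAt (isOpen_ball.mem_nhds (by simpa using h1))
  have e1 : DifferentiableAt ℂ (fun z => k (τ * p z)) z :=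
    hkz.fun_comp' z ((hp z).const_mul τ)
  have e2 : DifferentiableAt ℂ (fun z => rt (4 * (τ * p z) * b z)) z :=
    DifferentiableAt.fun_comp' z (rt_an _ h2).differentiableAt
      ((((hp z).const_mul τ).const_mul 4).fun_mul (hb z))
  unfold KK
  exact e1.fun_mul ((differentiableAt_const _).fun_add
    (((((ha z).const_mul 2).sub_const 1).div_const 2).fun_mul e2))

lemma iter_diff (V : ℂ → ℂ) (c x0 : ℂ) (A B ρ : ℝ) (hAB : A ≤ B) (hV : DifferentiableOn ℂ V (ball 0 B))
    (hb : ∀ x ∈ ball x0 ρ, ∀ k, ‖(FF V c)^[k] x‖ < A) (m : ℕ) :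
    DifferentiableOn ℂ ((FF V c)^[m]) (ball x0 ρ) := by
  induction m with
  | zero => exact differentiableOn_id
  | succ m ih =>
    rw [iterate_succ']
    have hF : DifferentiableOn ℂ (FF V c) (ball 0 B) := by
      unfold FF
      exact ((differentiableOn_id.fun_add hV).fun_pow 2).add_const c
    exact hF.comp ih fun x hx => by simpa using (hb x hx m).trans_le hAB

lemma coef_bound (c : ℂ) (n : ℕ) (hn : 0 < n) (orb : ℕ → ℂ) (ho : ∀ i, orb i ^ 2 + c = orb (i+1))
    (hper : ∀ i, orb (i+n) = orb i) (hdist : ∀ i, 0 < i → i < n → orb i ≠ orb 0)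
    (hA : ∀ i, ‖orb i‖ < ‖c‖+4) (hlam : ‖∏ i ∈ Finset.range n, (2 * orb i)‖ ≤ 1) (ρ : ℝ) (hρ : 0 < ρ)
    (hρb : ∀ x ∈ ball (orb 0) ρ, ∀ k, ‖(fun z : ℂ => z^2 + c)^[k] x‖ < ‖c‖+5)
    (Z : Finset ℂ) (hZ : ∀ i, orb i ∈ Z) (a b : ℂ → ℂ) (ha : Differentiable ℂ a)
    (hb : Differentiable ℂ b) (P0 : ℝ) (hP0 : 0 < P0) (Mk : ℝ) (hMk : 0 ≤ Mk) :
    ∃ M > (0:ℝ), ∃ R > (0:ℝ), ∀ k : ℂ → ℂ, DifferentiableOn ℂ k (ball 0 P0) →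
      (∀ P ∈ ball (0:ℂ) P0, ‖k P‖ ≤ Mk) → ∀ m j,
      ‖iteratedDeriv j (fun w => SSm Z orb a b k m (1, w)) 0‖ ≤ j.factorial * M / R^j := by
  set p : ℂ → ℂ := fun z => ∏ ζ ∈ Z, (z - ζ) with hpdef
  have hp : Differentiable ℂ p := by
    rw [hpdef]
    exact Differentiable.fun_finsetProd fun ζ _ => differentiable_id.sub_const ζ
  have hp0 : ∀ i, p (orb i) = 0 := fun i =>
    Finset.prod_eq_zero (hZ i) (sub_self _)
  obtain ⟨B1, hB1⟩ := bdd_ball p hp (‖c‖+10)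
  obtain ⟨B2, hB2⟩ := bdd_ball a ha (‖c‖+10)
  obtain ⟨B3, hB3⟩ := bdd_ball b hb (‖c‖+10)
  obtain ⟨B, hB, b1, b2, b3⟩ : ∃ B : ℝ, 1 ≤ B ∧ B1 ≤ B ∧ B2 ≤ B ∧ B3 ≤ B :=
    ⟨max (max 1 B1) (max B2 B3), by simp, by simp, by simp, by simp⟩
  obtain ⟨t, ht0, ht1, htP, htb, htu⟩ := tau_choice B P0 Mk hB hP0 hMk
  obtain ⟨ρ', hρ', hun⟩ := unif c n hn orb ho hper hdist hA hlam ρ hρ hρb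
  refine ⟨(2*‖c‖+9) * t, by positivity, ρ' * t / 2, by positivity, fun k hk hkM m j => ?_⟩
  have hk0 : AnalyticAt ℂ k 0 := hk.analyticAt (ball_mem_nhds _ hP0)
  refine coeff_max (SSm Z orb a b k m) (fun σ => (SSm_an Z orb a b k ha hb hk0 σ m).1) j _ (1/t)
    (by rw [le_div_iff₀ ht0]; linarith) fun σ hσ => ?_
  have hσ0 : σ ≠ 0 := by
    rw [← norm_pos_iff, hσ]; positivity
  set τ : ℂ := σ⁻¹ with hτ
  have hτn : ‖τ‖ = t := by rw [hτ, norm_inv, hσ]; simp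
  have hτσ : τ * σ = 1 := inv_mul_cancel₀ hσ0
  set u : ℂ → ℂ := UUp a b k p τ with hu
  have n1 : ∀ z ∈ ball (0:ℂ) (‖c‖+10), ‖τ * p z‖ ≤ t * B := fun z hz => by
    rw [norm_mul, hτn]; gcongr; exact (hB1 z hz).trans b1
  have n2 : ∀ z ∈ ball (0:ℂ) (‖c‖+10), ‖4 * (τ * p z) * b z‖ ≤ 1/2 := fun z hz => by
    rw [norm_mul, norm_mul]
    calc _ ≤ 4 * (t * B) * B := by
          gcongr
          · simp
          · exact n1 z hz
          · exact (hB3 z hz).trans b3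
      _ ≤ 1/2 := htb
  have n3 : ∀ z ∈ ball (0:ℂ) (‖c‖+10), DifferentiableAt ℂ (fun z => KK a b k (τ * p z) z) z :=
    fun z hz => UU_diff a b k p ha hb hp P0 hk τ z ((n1 z hz).trans_lt htP) ((n2 z hz).trans_lt (by norm_num))
  have hud : DifferentiableOn ℂ u (ball 0 (‖c‖+10)) := fun z hz =>
    ((((hp z).fun_pow 2).const_mul τ).fun_mul (n3 z hz)).differentiableWithinAt
  have hub : ∀ z ∈ ball (0:ℂ) (‖c‖+10), ‖u z‖ ≤ 1/16 := fun z hz => by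
    rw [hu, UUp, KK]
    refine le_trans ?_ htu
    rw [norm_mul, norm_mul, norm_pow, hτn, norm_mul]
    have q1 : ‖p z‖ ≤ B := (hB1 z hz).trans b1
    have q2 : ‖k (τ * p z)‖ ≤ Mk := hkM _ (by simpa using (n1 z hz).trans_lt htP)
    have q3 : ‖1/2 + (2 * a z - 1)/2 * rt (4 * (τ * p z) * b z)‖ ≤ 1/2 + (2*B+1) := by
      refine (norm_add_le _ _).trans ?_
      have : ‖(2 * a z - 1)/2‖ ≤ (2*B+1)/2 := by
        rw [norm_div]
        have h1 : ‖2 * a z - 1‖ ≤ 2*B+1 := by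
          refine (norm_sub_le _ _).trans ?_
          rw [norm_mul]; simp
          exact (hB2 z hz).trans b2
        simpa using div_le_div_of_nonneg_right h1 (by norm_num : (0:ℝ) ≤ 2)
      have h3 := rt_norm _ (n2 z hz)
      have h4 : ‖(2 * a z - 1)/2 * rt (4 * (τ * p z) * b z)‖ ≤ (2*B+1)/2*2 := by
        rw [norm_mul]; gcongr
      have h5 : ‖(1/2:ℂ)‖ = 1/2 := by simp
      rw [h5]; linarith
    gcongr
  have hu0 : ∀ i, u (orb i) = 0 := fun i => by rw [hu, UUp, hp0 i]; ring
  have hin : ∀ i, orb i ∈ ball (0:ℂ) (‖c‖+10) := fun i => by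
    rw [mem_ball_zero_iff]; linarith [hA i]
  have hu1 : ∀ i, HasDerivAt u 0 (orb i) := fun i =>
    flat_deriv p _ (orb i) τ (hp _) (n3 _ (hin i)) (hp0 i)
  have hbd := hun u hud hub hu0 hu1
  have hitd := iter_diff u c (orb 0) (‖c‖+5) (‖c‖+10) ρ' (by linarith) hud hbd m
  have hSS : ∀ w, SSm Z orb a b k m (σ, w) = τ * ((FF u c)^[m] (orb 0 + σ * w) - orb m) := fun w => by
    rw [hu, SSm_eq Z orb a b k c ho hZ τ σ hτσ w m]
    rw [add_sub_cancel_left, ← mul_assoc, hτσ, one_mul]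
  have hmaps : ∀ w ∈ ball (0:ℂ) (ρ' * t), orb 0 + σ * w ∈ ball (orb 0) ρ' := fun w hw => by
    rw [mem_ball_zero_iff] at hw
    rw [mem_ball_iff_norm, add_sub_cancel_left, norm_mul, hσ]
    rw [one_div_mul_eq_div, div_lt_iff₀ ht0]; exact hw
  have hSd : DifferentiableOn ℂ (fun w => SSm Z orb a b k m (σ, w)) (ball 0 (ρ' * t)) := by
    have e : (fun w => SSm Z orb a b k m (σ, w)) = fun w => τ * ((FF u c)^[m] (orb 0 + σ * w) - orb m) :=
      funext hSS
    rw [e]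
    have hg : DifferentiableOn ℂ (fun w : ℂ => orb 0 + σ * w) (ball 0 (ρ' * t)) := by fun_prop
    exact ((hitd.comp hg hmaps).sub_const _).const_mul τ
  have hSb : ∀ w ∈ ball (0:ℂ) (ρ' * t), ‖SSm Z orb a b k m (σ, w)‖ ≤ (2*‖c‖+9) * t := fun w hw => by
    rw [hSS, norm_mul, hτn, mul_comm]
    gcongr
    have h1 := hbd _ (hmaps w hw) m
    have h2 := hA m
    refine (norm_sub_le _ _).trans ?_
    linarith
  have hlt : ρ' * t / 2 < ρ' * t := by
    have : 0 < ρ' * t := by positivity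
    linarith
  have hsub : closedBall (0:ℂ) (ρ' * t / 2) ⊆ ball 0 (ρ' * t) := closedBall_subset_ball hlt
  exact Complex.norm_iteratedDeriv_le_of_forall_mem_sphere_norm_le j (by positivity)
    ((hSd.mono hsub).diffContOnCl_ball subset_rfl) fun w hw => hSb w (hsub (sphere_subset_closedBall hw))

end SQB

namespace SQB
open MeasureTheory Filter Topology

lemma orbit_bdd (c : ℂ) (n : ℕ) (hn : 0 < n) (h : ℂ → ℂ) (r0 : ℝ)
    (hd : DifferentiableOn ℂ h (ball 0 r0)) (lam : ℂ) (hl : ‖lam‖ = 1)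
    (hconj : ∀ z ∈ ball (0:ℂ) r0, (fun z : ℂ => z^2 + c)^[n] (h z) = h (lam * z))
    (z : ℂ) (hz : z ∈ ball (0:ℂ) r0) (k : ℕ) : ‖(fun z : ℂ => z^2 + c)^[k] (h z)‖ < ‖c‖ + 4 := by
  set f : ℂ → ℂ := fun z : ℂ => z^2 + c with hf
  have hfc : Continuous f := by rw [hf]; fun_prop
  have hz' : ‖z‖ < r0 := by simpa using hz
  have hq : ∀ q : ℕ, (f^[n])^[q] (h z) = h (lam^q * z) := by
    intro q
    induction q with
    | zero => simp
    | succ q ih =>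
      rw [iterate_succ_apply', ih, hconj _ (by rw [mem_ball_zero_iff, norm_mul, norm_pow, hl]; simpa using hz')]
      congr 1; ring
  have hcomp : ∀ r, IsCompact ((fun y => f^[r] (h y)) '' closedBall (0:ℂ) ‖z‖) := fun r =>
    (isCompact_closedBall _ _).image_of_continuousOn
      ((hfc.iterate r).comp_continuousOn (hd.continuousOn.mono (closedBall_subset_ball hz')))
  have hb : Bornology.IsBounded (⋃ r ∈ Finset.range n, (fun y => f^[r] (h y)) '' closedBall (0:ℂ) ‖z‖) :=
    (Bornology.isBounded_biUnion_finset _).2 fun r _ => (hcomp r).isBounded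
  obtain ⟨M, hM⟩ := hb.exists_norm_le
  refine orbit_small c (h z) M (fun k => ?_) k
  refine hM _ ?_
  simp only [mem_iUnion]
  refine ⟨k % n, Finset.mem_range.2 (Nat.mod_lt _ hn), lam^(k/n) * z, ?_, ?_⟩
  · rw [mem_closedBall_zero_iff, norm_mul, norm_pow, hl]; simp
  · change f^[k % n] (h (lam^(k/n) * z)) = f^[k] (h z)
    rw [← hq, ← iterate_mul, ← iterate_add_apply, Nat.mod_add_div]

lemma near_fac (a b : ℂ → ℂ) (p : ℂ → ℂ) (ha : Differentiable ℂ a) (hb : Differentiable ℂ b)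
    (hp : Differentiable ℂ p) (hab : ∀ z, a z ^2 - a z = p z * b z) (x : ℂ) (hpx : p x = 0) (s : ℂ)
    (hs : s^2 = 1) (hax : 2 * a x - 1 = s) :
    ∀ᶠ z in 𝓝 x, (2 * a z - 1) * rt (4 * (1 * p z) * b z) = s := by
  have hc0 : ContinuousAt (fun z => 4 * (1 * p z) * b z) x := by
    have h1 := hp.continuous; have h2 := hb.continuous
    exact (by fun_prop : Continuous fun z => 4 * (1 * p z) * b z).continuousAt
  have hr : ContinuousAt (fun z => rt (4 * (1 * p z) * b z)) x :=
    ContinuousAt.comp (f := fun z => 4 * (1 * p z) * b z) (rt_an _ (by simp [hpx])).continuousAt hc0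
  have hc : ContinuousAt (fun z => (2 * a z - 1) * rt (4 * (1 * p z) * b z)) x :=
    ((continuousAt_const.mul ha.continuous.continuousAt).sub continuousAt_const).mul hr
  have hx : (2 * a x - 1) * rt (4 * (1 * p x) * b x) = s := by
    rw [hpx, hax]; simp [rt_zero]
  have hs0 : s ≠ 0 := by intro h; rw [h] at hs; norm_num at hs
  have e1 : ∀ᶠ z in 𝓝 x, (2 * a z - 1) * rt (4 * (1 * p z) * b z) ≠ -s := by
    refine hc.eventually_ne ?_
    rw [hx]; intro h
    exact hs0 (self_eq_neg.1 h)
  have e2 : ∀ᶠ z in 𝓝 x, ‖4 * (1 * p z) * b z‖ < 1 := by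
    refine hc0.norm.eventually_lt_const ?_
    simp [hpx]
  filter_upwards [e1, e2] with z h1 h2
  have h3 := rt_sq _ h2
  have h4 : ((2 * a z - 1) * rt (4 * (1 * p z) * b z))^2 = s^2 := by
    rw [hs]
    have := hab z
    linear_combination 4 * rt (4 * (1 * p z) * b z)^2 * this + h3
  rcases sq_eq_sq_iff_eq_or_eq_neg.1 h4 with h | h
  · exact h
  · exact absurd h h1

lemma deliver (c : ℂ) (n : ℕ) (hn : 0 < n) (orb : ℕ → ℂ) (ho : ∀ i, orb i ^ 2 + c = orb (i+1))
    (hper : ∀ i, orb (i+n) = orb i) (hdist : ∀ i, 0 < i → i < n → orb i ≠ orb 0)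
    (α : ℝ) (hlam : ∏ i ∈ Finset.range n, (2 * orb i) = ee α)
    (h : ℂ → ℂ) (r0 : ℝ) (hr0 : 0 < r0) (hd : DifferentiableOn ℂ h (ball 0 r0)) (hh0 : deriv h 0 ≠ 0)
    (h0 : h 0 = orb 0)
    (hconj : ∀ z ∈ ball (0:ℂ) r0, (fun z : ℂ => z^2 + c)^[n] (h z) = h (ee α * z)) :
    ∃ M > (0:ℝ), ∃ R > (0:ℝ), ∀ G, Cls α G → ∃ Φ : ℂ → ℂ, AnalyticAt ℂ Φ 0 ∧ Φ 0 = 0 ∧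
      (∀ m j, AnalyticAt ℂ (Φ^[m]) 0 ∧ ‖iteratedDeriv j (Φ^[m]) 0‖ ≤ j.factorial * M / R^j) ∧
      ∀ᶠ ζ in 𝓝 (0:ℂ), Φ (h ζ - orb 0) = h (G ζ) - orb 0 := by
  classical
  have hl1 : ‖ee α‖ = 1 := ee_norm_real α
  have hl0 : ee α ≠ 0 := ee_ne _
  have hn0 : ball (0:ℂ) r0 ∈ 𝓝 (0:ℂ) := isOpen_ball.mem_nhds (mem_ball_self hr0)
  have hob := orbit_bdd c n hn h r0 hd (ee α) hl1 hconj
  have horb : ∀ i, (fun z : ℂ => z^2 + c)^[i] (orb 0) = orb i := fun i => by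
    have := orb_iter (fun z : ℂ => z^2 + c) orb ho i 0
    simpa using this
  have hA : ∀ i, ‖orb i‖ < ‖c‖ + 4 := fun i => by
    have := hob 0 (mem_ball_self hr0) i
    rwa [h0, horb] at this
  have han : AnalyticAt ℂ h 0 := hd.analyticAt hn0
  obtain ⟨ρ, hρ, hρb⟩ : ∃ ρ > 0, ∀ x ∈ ball (orb 0) ρ, ∀ k, ‖(fun z : ℂ => z^2 + c)^[k] x‖ < ‖c‖+5 := by
    have hm := han.hasStrictDerivAt.map_nhds_eq hh0
    have hi : h '' ball 0 r0 ∈ 𝓝 (orb 0) := by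
      rw [← h0, ← hm]; exact image_mem_map hn0
    obtain ⟨ρ, hρ, hs⟩ := Metric.mem_nhds_iff.1 hi
    refine ⟨ρ, hρ, fun x hx k => ?_⟩
    obtain ⟨z, hz, rfl⟩ := hs hx
    linarith [hob z hz k]
  set Z : Finset ℂ := (Finset.range n).image orb with hZd
  have hmod : ∀ i q, orb (i + n * q) = orb i := by
    intro i q
    induction q with
    | zero => simp
    | succ q ih => rw [Nat.mul_succ, ← add_assoc, hper, ih]
  have hZ : ∀ i, orb i ∈ Z := fun i => by
    refine Finset.mem_image.2 ⟨i % n, Finset.mem_range.2 (Nat.mod_lt _ hn), ?_⟩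
    rw [← hmod (i % n) (i / n), Nat.mod_add_div]
  obtain ⟨a, b, ha, hb, ha1, ha0, hab⟩ := exists_ab Z (orb 0)
  set p : ℂ → ℂ := fun z => ∏ ζ ∈ Z, (z - ζ) with hpdef
  have hp : Differentiable ℂ p := by
    rw [hpdef]
    exact Differentiable.fun_finsetProd fun ζ _ => differentiable_id.sub_const ζ
  have hp0 : ∀ i, p (orb i) = 0 := fun i =>
    Finset.prod_eq_zero (hZ i) (sub_self _)
  have hp1 : deriv p (h 0) ≠ 0 := by
    have e : p = fun z => (z - orb 0) * ∏ ζ ∈ Z.erase (orb 0), (z - ζ) := by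
      funext z; rw [hpdef]; exact (Finset.mul_prod_erase Z (fun ζ => z - ζ) (hZ 0)).symm
    have hq : Differentiable ℂ fun z : ℂ => ∏ ζ ∈ Z.erase (orb 0), (z - ζ) :=
      Differentiable.fun_finsetProd fun ζ _ => differentiable_id.sub_const ζ
    have hder := ((hasDerivAt_id (orb 0)).sub_const (orb 0)).fun_mul (hq (orb 0)).hasDerivAt
    have hder2 := hder.deriv
    simp only [id, sub_self, one_mul, zero_mul, add_zero] at hder2
    rw [h0, e, hder2]
    refine Finset.prod_ne_zero_iff.2 fun ζ hζ => sub_ne_zero.2 (Finset.ne_of_mem_erase hζ).symm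
  obtain ⟨P0, hP0, Mk, hK⟩ := kdata h r0 hr0 hd hh0 p hp (by rw [h0]; exact hp0 0) hp1 α
  obtain ⟨M, hM, R, hR, hbound⟩ := coef_bound c n hn orb ho hper hdist hA (by rw [hlam, hl1]) ρ hρ hρb Z hZ
    a b ha hb P0 hP0 (max Mk 0) (le_max_right _ _)
  refine ⟨M, hM, R, hR, fun G hG => ?_⟩
  obtain ⟨k, hk, hkb, hkeq⟩ := hK G hG
  have hk0 : AnalyticAt ℂ k 0 := hk.analyticAt (ball_mem_nhds _ hP0)
  have hbd := hbound k hk fun P hP => (hkb P hP).trans (le_max_left _ _)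
  set F : ℂ → ℂ := FF (UUp a b k p 1) c with hF
  have hS : ∀ m w, F^[m] (orb 0 + w) = orb m + SSm Z orb a b k m (1, w) := fun m w => by
    have := SSm_eq Z orb a b k c ho hZ 1 1 (one_mul 1) w m
    simpa using this
  have hcpair : AnalyticAt ℂ (fun w : ℂ => ((1:ℂ), w)) 0 := analyticAt_const.prod analyticAt_id
  have hSan : ∀ m, AnalyticAt ℂ (fun w => SSm Z orb a b k m (1, w)) 0 := fun m =>
    AnalyticAt.fun_comp (f := fun w : ℂ => ((1:ℂ), w)) (SSm_an Z orb a b k ha hb hk0 1 m).1 hcpair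
  have hit : ∀ m, (fun w => SSm Z orb a b k n (1, w))^[m] = fun w => SSm Z orb a b k (n*m) (1, w) := by
    have horb0 : ∀ m, orb (n * m) = orb 0 := fun m => by simpa using hmod 0 m
    intro m
    induction m with
    | zero => funext w; simp [SSm]
    | succ m ih =>
      funext w
      rw [iterate_succ_apply', ih]
      have e1 := hS n (SSm Z orb a b k (n*m) (1, w))
      have e2 := hS (n*m) w
      rw [horb0] at e2
      rw [← e2, ← iterate_add_apply] at e1
      have e3 := hS (n*(m+1)) w
      rw [show n*(m+1) = n + n*m by ring] at e3 ⊢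
      rw [e3] at e1
      have e4 : orb (n + n*m) = orb 0 := by rw [hmod]; simpa using horb0 1
      have e5 : orb n = orb 0 := by simpa using horb0 1
      rw [e4, e5] at e1
      exact (add_left_cancel e1).symm
  refine ⟨fun w => SSm Z orb a b k n (1, w), hSan n, (SSm_an Z orb a b k ha hb hk0 1 n).2, ?_, ?_⟩
  · intro m j
    rw [hit m]
    exact ⟨hSan _, hbd _ _⟩
  -- functional equation
  have hFS : ∀ᶠ z in 𝓝 (orb 0), F z = (z + p z ^2 * k (p z))^2 + c := by
    filter_upwards [near_fac a b p ha hb hp hab (orb 0) (hp0 0) 1 (by norm_num) (by rw [ha1]; norm_num)]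
      with z hz
    have : UUp a b k p 1 z = p z ^2 * k (p z) := by
      rw [UUp, KK]
      linear_combination p z^2 * k (1 * p z) / 2 * hz + p z ^2 * (congr_arg k (one_mul (p z)))
    rw [hF, FF, this]
  have hFo : ∀ i, 0 < i → i < n → ∀ᶠ z in 𝓝 (orb i), F z = z^2 + c := by
    intro i hi hin
    filter_upwards [near_fac a b p ha hb hp hab (orb i) (hp0 i) (-1) (by norm_num)
      (by rw [ha0 _ (hZ i) (hdist i hi hin)]; norm_num)] with z hz
    have : UUp a b k p 1 z = 0 := by
      rw [UUp, KK]
      linear_combination p z^2 * k (1 * p z) / 2 * hz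
    rw [hF, FF, this]; ring
  have hGc : Tendsto (fun ζ => (ee α)⁻¹ * G ζ) (𝓝 0) (𝓝 0) := by
    have h1 : ContinuousAt G 0 := (hG.diff.differentiableAt (ball_mem_nhds _ one_pos)).continuousAt
    have h2 : Tendsto (fun ζ => (ee α)⁻¹ * G ζ) (𝓝 0) (𝓝 ((ee α)⁻¹ * G 0)) :=
      (continuousAt_const.mul h1 : ContinuousAt (fun ζ => (ee α)⁻¹ * G ζ) 0)
    rwa [hG.zero, mul_zero] at h2
  have hhc : Tendsto h (𝓝 0) (𝓝 (orb 0)) := by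
    rw [← h0]; exact han.continuousAt
  have hstep : ∀ m, 0 < m → m ≤ n → ∀ᶠ ζ in 𝓝 (0:ℂ),
      F^[m] (h ζ) = (fun z : ℂ => z^2+c)^[m] (h ((ee α)⁻¹ * G ζ)) := by
    intro m hm
    induction m, hm using Nat.le_induction with
    | base =>
      intro _
      filter_upwards [hhc.eventually hFS, hkeq] with ζ h1 h2
      simp only [iterate_one]
      rw [h1, h2]; ring
    | succ m hm ih =>
      intro hmn
      have hc : Tendsto (fun ζ => (fun z : ℂ => z^2+c)^[m] (h ((ee α)⁻¹ * G ζ))) (𝓝 0) (𝓝 (orb m)) := by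
        have hfc : Continuous (fun z : ℂ => z^2+c) := by fun_prop
        have := ((hfc.iterate m).tendsto (orb 0)).comp (hhc.comp hGc)
        rwa [horb] at this
      filter_upwards [ih (by omega), hc.eventually (hFo m hm (by omega))] with ζ h1 h2
      rw [iterate_succ_apply', iterate_succ_apply', h1, h2]
  filter_upwards [hstep n hn le_rfl, hGc.eventually hn0] with ζ h1 h2
  have e := hS n (h ζ - orb 0)
  rw [add_sub_cancel, h1, hconj _ h2, mul_inv_cancel_left₀ hl0] at e
  have e5 : orb n = orb 0 := by simpa using hper 0
  rw [e5] at e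
  rw [e]; ring

end SQB

namespace SQB
open MeasureTheory Filter Topology

lemma ps_term (d : ℕ → ℂ) (M R : ℝ) (hR : 0 < R) (hd : ∀ j, ‖d j‖ ≤ M / R^j) (w : ℂ)
    (hw : w ∈ ball (0:ℂ) (R/2)) (j : ℕ) : ‖d j * w^j‖ ≤ M * (1/2)^j := by
  rw [mem_ball_zero_iff] at hw
  have hM : 0 ≤ M / R^j := (norm_nonneg _).trans (hd j)
  rw [norm_mul, norm_pow]
  calc ‖d j‖ * ‖w‖^j ≤ M / R^j * (R/2)^j := by gcongr; exact hd j
    _ = M * (1/2)^j := by rw [div_pow, one_div, inv_pow]; field_simp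

lemma ps_sum (M : ℝ) : HasSum (fun j : ℕ => M * (1/2:ℝ)^j) (M * 2) :=
  hasSum_geometric_two.mul_left M

lemma ps_diff (d : ℕ → ℂ) (M R : ℝ) (hR : 0 < R) (hd : ∀ j, ‖d j‖ ≤ M / R^j) :
    DifferentiableOn ℂ (fun w => ∑' j, d j * w^j) (ball 0 (R/2)) :=
  Complex.differentiableOn_tsum_of_summable_norm (ps_sum M).summable
    (fun j => by fun_prop) isOpen_ball
    (fun j w hw => ps_term d M R hR hd w hw j)

lemma ps_bd (d : ℕ → ℂ) (M R : ℝ) (hR : 0 < R) (hd : ∀ j, ‖d j‖ ≤ M / R^j) (w : ℂ)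
    (hw : w ∈ ball (0:ℂ) (R/2)) : ‖∑' j, d j * w^j‖ ≤ M * 2 :=
  tsum_of_norm_bounded (ps_sum M) fun j => ps_term d M R hR hd w hw j

lemma ps_deriv (d : ℕ → ℂ) (M R : ℝ) (hR : 0 < R) (hd : ∀ j, ‖d j‖ ≤ M / R^j) :
    HasDerivAt (fun w => ∑' j, d j * w^j) (d 1) 0 := by
  have hn : ball (0:ℂ) (R/2) ∈ 𝓝 (0:ℂ) := ball_mem_nhds _ (by positivity)
  have hd2 : ∀ j, ‖d (j+1)‖ ≤ (M/R) / R^j := fun j => by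
    refine (hd (j+1)).trans (le_of_eq ?_)
    rw [pow_succ]; field_simp
  have h1 := ((ps_diff (fun j => d (j+1)) (M/R) R hR hd2).differentiableAt hn).hasDerivAt
  have h2 := ((hasDerivAt_id (0:ℂ)).fun_mul h1).const_add (d 0)
  have h3 : (fun w => ∑' j, d j * w^j) =ᶠ[𝓝 0] fun w => d 0 + id w * ∑' j, d (j+1) * w^j := by
    filter_upwards [hn] with w hw
    have hs : Summable fun j => d j * w^j :=
      Summable.of_norm_bounded (ps_sum M).summable fun j => ps_term d M R hR hd w hw j
    rw [hs.tsum_eq_zero_add, ← tsum_mul_left]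
    simp only [pow_zero, mul_one, id]
    congr 1
    refine tsum_congr fun j => ?_
    ring
  refine (h2.congr_of_eventuallyEq h3).congr_deriv ?_
  rw [tsum_eq_single 0 (fun j hj => by simp [hj])]
  simp

lemma ps_eq (g : ℂ → ℂ) (hg : AnalyticAt ℂ g 0) :
    ∀ᶠ w in 𝓝 (0:ℂ), g w = ∑' j, (iteratedDeriv j g 0 / j.factorial) * w^j := by
  filter_upwards [hg.hasFPowerSeriesAt.eventually_hasSum] with w hw
  rw [zero_add] at hw
  rw [← hw.tsum_eq]
  refine tsum_congr fun j => ?_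
  simp [FormalMultilinearSeries.ofScalars]

lemma cesaro (lam : ℂ) (hl : ‖lam‖ = 1) (M R : ℝ) (hM : 0 < M) (hR : 0 < R) (Φ : ℂ → ℂ)
    (hΦ : AnalyticAt ℂ Φ 0) (hΦ0 : Φ 0 = 0) (hΦ1 : HasDerivAt Φ lam 0)
    (hb : ∀ m j, AnalyticAt ℂ (Φ^[m]) 0 ∧ ‖iteratedDeriv j (Φ^[m]) 0‖ ≤ j.factorial * M / R^j) :
    ∃ φ : ℂ → ℂ, DifferentiableOn ℂ φ (ball 0 (R/2)) ∧ (∀ w ∈ ball (0:ℂ) (R/2), ‖φ w‖ ≤ M * 2) ∧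
      φ 0 = 0 ∧ HasDerivAt φ 1 0 ∧ ∀ᶠ w in 𝓝 (0:ℂ), φ (Φ w) = lam * φ w := by
  have hl0 : lam ≠ 0 := by rw [← norm_pos_iff, hl]; norm_num
  set cf : ℕ → ℕ → ℂ := fun m j => iteratedDeriv j (Φ^[m]) 0 / j.factorial with hcf
  have hcfb : ∀ m j, ‖cf m j‖ ≤ M / R^j := fun m j => by
    rw [hcf]
    simp only [norm_div, Complex.norm_natCast]
    rw [div_le_iff₀ (by positivity)]
    refine (hb m j).2.trans (le_of_eq (by ring))
  set g : ℕ → ℂ → ℂ := fun m w => ∑' j, cf m j * w^j with hg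
  set av : (ℕ → ℂ) → ℕ → ℂ := fun x N => ((N:ℂ)+1)⁻¹ * ∑ m ∈ Finset.range (N+1), (lam⁻¹)^m * x m with hav
  have hlm : ∀ m : ℕ, ‖(lam⁻¹)^m‖ = 1 := fun m => by rw [norm_pow, norm_inv, hl]; simp
  have havb : ∀ x K N, (∀ m, ‖x m‖ ≤ K) → ‖av x N‖ ≤ K := by
    intro x K N hx
    rw [hav]
    have h1 : ‖∑ m ∈ Finset.range (N+1), (lam⁻¹)^m * x m‖ ≤ ((N:ℝ)+1) * K := by
      have h0 : ∀ m ∈ Finset.range (N+1), ‖(lam⁻¹)^m * x m‖ ≤ K := fun m _ => by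
        rw [norm_mul, hlm, one_mul]; exact hx m
      refine (norm_sum_le_of_le _ h0).trans (le_of_eq ?_)
      simp
    have h2 : ‖((N:ℂ)+1)‖ = (N:ℝ)+1 := by
      rw [show ((N:ℂ)+1) = ((N+1:ℕ):ℂ) by push_cast; rfl, Complex.norm_natCast]; push_cast; rfl
    simp only [norm_mul, norm_inv, h2]
    rw [inv_mul_le_iff₀ (by positivity)]; exact h1
  set U : Filter ℕ := ((hyperfilter ℕ : Ultrafilter ℕ) : Filter ℕ) with hU
  have hUle : U ≤ atTop := Nat.hyperfilter_le_atTop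
  have hlim : ∀ j, ∃ d : ℂ, ‖d‖ ≤ M / R^j ∧ Tendsto (av fun m => cf m j) U (𝓝 d) := by
    intro j
    obtain ⟨d, hd1, hd2⟩ := (isCompact_closedBall (0:ℂ) (M/R^j)).ultrafilter_le_nhds
      ((hyperfilter ℕ).map (av fun m => cf m j)) (by
        rw [le_principal_iff]
        refine Filter.mem_map.2 (Filter.mem_of_superset Filter.univ_mem fun N _ => ?_)
        rw [mem_preimage, mem_closedBall_zero_iff]
        exact havb _ _ N fun m => hcfb m j)
    exact ⟨d, by simpa using hd1, hd2⟩
  choose d hdb hdl using hlim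
  have hUne : U.NeBot := Ultrafilter.neBot _
  -- pointwise convergence
  have hpt : ∀ w ∈ ball (0:ℂ) (R/2), Tendsto (av fun m => g m w) U (𝓝 (∑' j, d j * w^j)) := by
    intro w hw
    have hsm : ∀ m, Summable fun j => cf m j * w^j := fun m =>
      Summable.of_norm_bounded (ps_sum M).summable fun j => ps_term (cf m) M R hR (hcfb m) w hw j
    have e : (av fun m => g m w) = fun N => ∑' j, (av (fun m => cf m j) N) * w^j := by
      funext N
      simp only [hav, hg]
      simp_rw [← tsum_mul_left]
      rw [← Summable.tsum_finsetSum fun m _ => (hsm m).mul_left _, ← tsum_mul_left]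
      refine tsum_congr fun j => ?_
      rw [mul_assoc, Finset.sum_mul]
      congr 1
      exact Finset.sum_congr rfl fun m _ => by ring
    rw [e]
    refine tendsto_tsum_of_dominated_convergence (bound := fun j => M * (1/2:ℝ)^j) (ps_sum M).summable ?_ ?_
    · intro j; exact (hdl j).mul_const _
    · exact Eventually.of_forall fun N j =>
        ps_term (fun j => av (fun m => cf m j) N) M R hR (fun j => havb _ _ N fun m => hcfb m j) w hw j
  have hg1 : ∀ m, HasDerivAt (Φ^[m]) (lam^m) 0 := fun m => HasDerivAt.iterate 0 hΦ1 hΦ0 m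
  have hd1 : d 1 = 1 := by
    refine tendsto_nhds_unique (hdl 1) ?_
    have : (av fun m => cf m 1) = fun _ => (1:ℂ) := by
      funext N
      simp only [hav, hcf]
      have : ∀ m ∈ Finset.range (N+1), (lam⁻¹)^m * (iteratedDeriv 1 (Φ^[m]) 0 / (Nat.factorial 1 : ℂ)) = 1 := by
        intro m _
        rw [iteratedDeriv_one, (hg1 m).deriv, inv_pow]
        simp [hl0]
      rw [Finset.sum_congr rfl this]
      simp
      exact inv_mul_cancel₀ (by exact_mod_cast Nat.succ_ne_zero N)
    rw [this]; exact tendsto_const_nhds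
  have hd0 : d 0 = 0 := by
    refine tendsto_nhds_unique (hdl 0) ?_
    have : (av fun m => cf m 0) = fun _ => (0:ℂ) := by
      funext N
      simp only [hav, hcf]
      rw [Finset.sum_eq_zero, mul_zero]
      intro m _
      rw [iteratedDeriv_zero, iterate_fixed hΦ0 m]; simp
    rw [this]; exact tendsto_const_nhds
  refine ⟨fun w => ∑' j, d j * w^j, ps_diff d M R hR hdb, ps_bd d M R hR hdb, ?_, ?_, ?_⟩
  · change ∑' j, d j * 0^j = 0
    rw [tsum_eq_single 0 (fun j hj => by simp [hj])]; simp [hd0]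
  · have := ps_deriv d M R hR hdb
    rwa [hd1] at this
  -- functional equation
  obtain ⟨δ, hδ, hδs⟩ : ∃ δ > 0, ∀ w ∈ ball (0:ℂ) δ, AnalyticAt ℂ Φ w ∧ Φ w ∈ ball (0:ℂ) (R/2) ∧
      w ∈ ball (0:ℂ) (R/2) := by
    have h1 := hΦ.eventually_analyticAt
    have h2 : ∀ᶠ w in 𝓝 (0:ℂ), Φ w ∈ ball (0:ℂ) (R/2) := by
      refine hΦ.continuousAt.eventually_mem ?_
      rw [hΦ0]; exact ball_mem_nhds _ (by positivity)
    have h3 : ∀ᶠ w in 𝓝 (0:ℂ), w ∈ ball (0:ℂ) (R/2) := ball_mem_nhds _ (by positivity)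
    obtain ⟨δ, hδ, hs⟩ := Metric.eventually_nhds_iff_ball.1 (h1.and (h2.and h3))
    exact ⟨δ, hδ, hs⟩
  have hgd : ∀ m, DifferentiableOn ℂ (g m) (ball 0 (R/2)) := fun m => ps_diff (cf m) M R hR (hcfb m)
  have hgn : ∀ m, ∀ᶠ w in 𝓝 (0:ℂ), Φ^[m] w = g m w := fun m => ps_eq (Φ^[m]) (hb m 0).1
  have hrec : ∀ m, ∀ w ∈ ball (0:ℂ) δ, g m (Φ w) = g (m+1) w := by
    intro m
    have d1 : DifferentiableOn ℂ (fun w => g m (Φ w)) (ball 0 δ) :=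
      (hgd m).comp (fun w hw => (hδs w hw).1.differentiableAt.differentiableWithinAt)
        (fun w hw => (hδs w hw).2.1)
    have d2 : DifferentiableOn ℂ (g (m+1)) (ball 0 δ) := (hgd (m+1)).mono fun w hw => (hδs w hw).2.2
    refine (d1.analyticOnNhd isOpen_ball).eqOn_of_preconnected_of_eventuallyEq
      (d2.analyticOnNhd isOpen_ball) (convex_ball _ _).isPreconnected (mem_ball_self hδ) ?_
    have ht : Tendsto Φ (𝓝 0) (𝓝 0) := by
      have := hΦ.continuousAt.tendsto
      rwa [hΦ0] at this
    filter_upwards [hgn (m+1), ht.eventually (hgn m)] with w h1 h2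
    rw [← h1, ← h2, iterate_succ_apply]
  filter_upwards [ball_mem_nhds (0:ℂ) hδ] with w hw
  obtain ⟨-, hw1, hw2⟩ := hδs w hw
  have t1 := hpt _ hw1
  have t2 := (hpt _ hw2).const_mul lam
  have t3 := t1.sub t2
  refine sub_eq_zero.1 (tendsto_nhds_unique t3 ?_)
  have e : ∀ N, av (fun m => g m (Φ w)) N - lam * av (fun m => g m w) N =
      ((N:ℂ)+1)⁻¹ * (lam * ((lam⁻¹)^(N+1) * g (N+1) w - g 0 w)) := by
    intro N
    simp only [hav]
    rw [mul_left_comm lam, ← mul_sub]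
    congr 1
    have h1 : ∀ N : ℕ, ∑ m ∈ Finset.range (N+1), (lam⁻¹)^m * g m (Φ w) -
        lam * ∑ m ∈ Finset.range (N+1), (lam⁻¹)^m * g m w =
        lam * ∑ m ∈ Finset.range (N+1), ((lam⁻¹)^(m+1) * g (m+1) w - (lam⁻¹)^m * g m w) := by
      intro N
      rw [Finset.mul_sum, Finset.mul_sum, ← Finset.sum_sub_distrib]
      refine Finset.sum_congr rfl fun m _ => ?_
      rw [hrec m w hw, pow_succ]
      field_simp
    rw [h1, Finset.sum_range_sub (fun m => (lam⁻¹)^m * g m w)]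
    simp
  have hz : Tendsto (fun N : ℕ => ((N:ℝ)+1)⁻¹ * (4*M)) U (𝓝 0) := by
    have := (tendsto_one_div_add_atTop_nhds_zero_nat (𝕜 := ℝ)).mul_const (4*M)
    simp only [one_div, zero_mul] at this
    exact this.mono_left hUle
  refine squeeze_zero_norm (fun N => ?_) hz
  rw [e N, norm_mul, norm_inv, norm_mul, hl, one_mul]
  have h2 : ‖((N:ℂ)+1)‖ = (N:ℝ)+1 := by
    rw [show ((N:ℂ)+1) = ((N+1:ℕ):ℂ) by push_cast; rfl, Complex.norm_natCast]; push_cast; rfl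
  rw [h2]
  gcongr
  refine (norm_sub_le _ _).trans ?_
  rw [norm_mul, hlm, one_mul]
  have b1 := ps_bd (cf (N+1)) M R hR (hcfb _) w hw2
  have b2 := ps_bd (cf 0) M R hR (hcfb _) w hw2
  have : ‖g (N+1) w‖ + ‖g 0 w‖ ≤ M*2 + M*2 := add_le_add b1 b2
  linarith

end SQB

namespace SQB
open MeasureTheory Filter Topology

lemma exists_lin (c : ℂ) (n : ℕ) (hn : 0 < n) (orb : ℕ → ℂ) (ho : ∀ i, orb i ^ 2 + c = orb (i+1))
    (hper : ∀ i, orb (i+n) = orb i) (hdist : ∀ i, 0 < i → i < n → orb i ≠ orb 0)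
    (α : ℝ) (hlam : ∏ i ∈ Finset.range n, (2 * orb i) = ee α)
    (h : ℂ → ℂ) (r0 : ℝ) (hr0 : 0 < r0) (hd : DifferentiableOn ℂ h (ball 0 r0)) (hh0 : deriv h 0 ≠ 0)
    (h0 : h 0 = orb 0)
    (hconj : ∀ z ∈ ball (0:ℂ) r0, (fun z : ℂ => z^2 + c)^[n] (h z) = h (ee α * z)) :
    ∃ r > 0, Lin α r := by
  obtain ⟨M, hM, R, hR, hdel⟩ := deliver c n hn orb ho hper hdist α hlam h r0 hr0 hd hh0 h0 hconj
  have hn0 : ball (0:ℂ) r0 ∈ 𝓝 (0:ℂ) := isOpen_ball.mem_nhds (mem_ball_self hr0)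
  have hda : HasDerivAt h (deriv h 0) 0 := (hd.differentiableAt hn0).hasDerivAt
  have hhc : Tendsto (fun ζ => h ζ - orb 0) (𝓝 0) (𝓝 0) := by
    have := hda.continuousAt.tendsto.sub_const (orb 0)
    rwa [h0, sub_self] at this
  obtain ⟨r1, hr1, hr1s⟩ : ∃ r1 > 0, ∀ z ∈ ball (0:ℂ) r1, z ∈ ball (0:ℂ) r0 ∧ h z - orb 0 ∈ ball (0:ℂ) (R/2) := by
    have e1 : ∀ᶠ z in 𝓝 (0:ℂ), z ∈ ball (0:ℂ) r0 := hn0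
    have e2 : ∀ᶠ z in 𝓝 (0:ℂ), h z - orb 0 ∈ ball (0:ℂ) (R/2) :=
      hhc.eventually (ball_mem_nhds _ (by positivity))
    exact Metric.eventually_nhds_iff_ball.1 (e1.and e2)
  have hnh : 0 < ‖deriv h 0‖ := norm_pos_iff.2 hh0
  set M1 : ℝ := M * 2 / ‖deriv h 0‖ + r1 with hM1
  have hM1p : 0 < M1 := by positivity
  set K : ℝ := M1 / r1 / r1 with hK
  have hKp : 0 < K := by positivity
  refine ⟨min r1 (1/(2*K)), by positivity, fun G hG => ?_⟩
  obtain ⟨Φ, hΦ, hΦ0, hb, heq⟩ := hdel G hG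
  have hGd : HasDerivAt G (ee α) 0 := by
    rw [← hG.der]; exact (hG.diff.differentiableAt (ball_mem_nhds _ one_pos)).hasDerivAt
  have hdsub : HasDerivAt (fun ζ => h ζ - orb 0) (deriv h 0) 0 := hda.sub_const _
  have hΦd : HasDerivAt Φ (ee α) 0 := by
    have h1 : HasDerivAt Φ (deriv Φ 0) 0 := hΦ.differentiableAt.hasDerivAt
    have h2 : HasDerivAt (fun ζ => Φ (h ζ - orb 0)) (deriv Φ 0 * deriv h 0) 0 :=
      HasDerivAt.comp (h₂ := Φ) 0 (by simpa [h0] using h1) hdsub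
    have h3 : HasDerivAt (fun ζ => h (G ζ) - orb 0) (deriv h 0 * ee α) 0 :=
      (HasDerivAt.comp (h₂ := h) 0 (by simpa [hG.zero] using hda) hGd).sub_const _
    have h4 := h2.unique (h3.congr_of_eventuallyEq heq)
    rw [mul_comm] at h4
    rw [← mul_left_cancel₀ hh0 h4]; exact h1
  obtain ⟨φ, hφd, hφb, hφ0, hφ1, hφe⟩ := cesaro (ee α) (ee_norm_real α) M R hM hR Φ hΦ hΦ0 hΦd hb
  set ψ : ℂ → ℂ := fun ζ => φ (h ζ - orb 0) / deriv h 0 with hψ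
  have hψd : DifferentiableOn ℂ ψ (ball 0 r1) := by
    refine DifferentiableOn.div_const ?_ _
    exact hφd.comp ((hd.mono fun z hz => (hr1s z hz).1).sub_const _) fun z hz => (hr1s z hz).2
  have hψ0 : ψ 0 = 0 := by simp [hψ, h0, hφ0]
  have hψ1 : HasDerivAt ψ 1 0 := by
    have h2 : HasDerivAt (fun ζ => φ (h ζ - orb 0)) (1 * deriv h 0) 0 :=
      HasDerivAt.comp (h₂ := φ) 0 (by simpa [h0] using hφ1) hdsub
    refine (h2.div_const (deriv h 0)).congr_deriv ?_
    rw [one_mul, div_self hh0]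
  obtain ⟨k, -, hkb, hke⟩ := dslope_twice (fun z => ψ z - z) r1 M1 hr1 (hψd.sub differentiableOn_id)
    (fun z hz => by
      refine (norm_sub_le _ _).trans ?_
      refine add_le_add ?_ (by simpa using (mem_ball_zero_iff.1 hz).le)
      rw [hψ]; simp only [norm_div]
      gcongr
      exact hφb _ (hr1s z hz).2) (by simp [hψ0]) (by
        have := (hψ1.fun_sub (hasDerivAt_id (0:ℂ))).deriv
        simpa using this)
  refine ⟨ψ, hψd.mono (ball_subset_ball (min_le_left _ _)), hψ0, hψ1.deriv, ?_, ?_⟩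
  · intro z hz
    rw [mem_ball_zero_iff, lt_min_iff] at hz
    have h1 := hke z
    have h2 := hkb z (by simpa using hz.1)
    rw [show ψ z - z = z^2 * k z from h1, norm_mul, norm_pow]
    have h3 : ‖z‖ * K ≤ 1/2 := by
      have := hz.2.le
      rw [le_div_iff₀ (by positivity)] at this
      linarith
    calc ‖z‖^2 * ‖k z‖ ≤ ‖z‖^2 * K := by gcongr
      _ = ‖z‖ * (‖z‖ * K) := by ring
      _ ≤ ‖z‖ * (1/2) := by gcongr
      _ = ‖z‖/2 := by ring
  · filter_upwards [heq, hhc.eventually hφe] with ζ h1 h2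
    rw [hψ]; simp only
    rw [← h1, h2, mul_div_assoc]

lemma ee_pow_ne (α : ℝ) (hα : Irrational α) (k : ℕ) (hk : 1 ≤ k) : (ee α)^k ≠ 1 := by
  intro h
  have h1 : ee ((k:ℂ) * α) = 1 := by
    rw [← h]; unfold ee; rw [← Complex.exp_nat_mul]; congr 1; ring
  obtain ⟨m, hm⟩ := ee_eq_one h1
  have h2 : (k:ℝ) * α = m := by exact_mod_cast hm
  have h3 : Irrational ((k:ℝ) * α) := hα.natCast_mul (by omega)
  rw [h2] at h3
  exact Int.not_irrational m h3

lemma siegel_main (a b c : ℂ) (ha : a ≠ 0)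
    (f : ℂ → ℂ) (hf : f = fun z => a * z ^ 2 + b * z + c)
    (n : ℕ) (hn : 1 ≤ n) (z₀ : ℂ)
    (hper : f^[n] z₀ = z₀) (hexact : ∀ k, 1 ≤ k → k < n → f^[k] z₀ ≠ z₀)
    (α : ℝ) (hα : Irrational α)
    (hmult : deriv (f^[n]) z₀ = Complex.exp (2 * Real.pi * Complex.I * α))
    (hlin : LinearizableAt (f^[n]) z₀ (Complex.exp (2 * Real.pi * Complex.I * α))) :
    BrjunoCondition α := by
  have hee : Complex.exp (2 * Real.pi * Complex.I * α) = ee α := by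
    unfold ee; congr 1
  rw [hee] at hmult hlin
  obtain ⟨r0, hr0, h, hd, hinj, h0, hconj⟩ := hlin
  set L : ℂ → ℂ := fun z => a * z + b / 2 with hL
  set c' : ℂ := a * c + b/2 - b^2/4 with hc'
  set fc : ℂ → ℂ := fun z => z^2 + c' with hfc
  have hsemi : Semiconj L f fc := fun z => by
    simp only [hL, hfc, hc', hf]; ring
  have hLinj : Injective L := fun x y hxy => by
    have : a * x = a * y := add_right_cancel hxy
    exact mul_left_cancel₀ ha this
  set orb : ℕ → ℂ := fun i => L (f^[i] z₀) with horb
  have ho : ∀ i, orb i ^ 2 + c' = orb (i+1) := fun i => by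
    simp only [horb]; rw [iterate_succ_apply', hsemi]
  have hperi : ∀ i, orb (i+n) = orb i := fun i => by
    simp only [horb]; rw [iterate_add_apply, hper]
  have hdist : ∀ i, 0 < i → i < n → orb i ≠ orb 0 := fun i hi hin h => hexact i hi hin (hLinj h)
  have hfd : ∀ z, HasDerivAt f (2 * L z) z := fun z => by
    rw [hf]
    have := ((((hasDerivAt_id z).fun_pow 2).const_mul a).fun_add ((hasDerivAt_id z).const_mul b)).add_const c
    refine this.congr_deriv ?_
    simp only [hL, id]; norm_num; ring
  have hfk : ∀ k, HasDerivAt (f^[k]) (∏ i ∈ Finset.range k, (2 * orb i)) z₀ := fun k => by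
    induction k with
    | zero => simpa using hasDerivAt_id z₀
    | succ k ih =>
      rw [iterate_succ', Finset.prod_range_succ, mul_comm]
      exact (hfd (f^[k] z₀)).comp z₀ ih
  have hlam : ∏ i ∈ Finset.range n, (2 * orb i) = ee α := by rw [← hmult, (hfk n).deriv]
  have hn0 : ball (0:ℂ) r0 ∈ 𝓝 (0:ℂ) := isOpen_ball.mem_nhds (mem_ball_self hr0)
  have hh0 : deriv h 0 ≠ 0 := by
    refine h_deriv_ne (f^[n]) h (ee α) z₀ (hd.analyticAt hn0) h0 ?_ (by rw [← hlam]; exact hfk n) hper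
      (by filter_upwards [hn0] with z hz using hconj z hz) (ee_ne _) (ee_pow_ne α hα)
    intro hev
    obtain ⟨δ, hδ, hs⟩ := Metric.eventually_nhds_iff_ball.1
      (hev.and (show ∀ᶠ z in 𝓝 (0:ℂ), z ∈ ball (0:ℂ) r0 from hn0))
    have hmem : ((δ/2 : ℝ) : ℂ) ∈ ball (0:ℂ) δ := by
      rw [mem_ball_zero_iff, Complex.norm_real, Real.norm_of_nonneg (by positivity)]; linarith
    obtain ⟨e1, e2⟩ := hs _ hmem
    have := hinj e2 (mem_ball_self hr0) (by rw [e1, h0])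
    have h3 : δ/2 = 0 := by exact_mod_cast this
    linarith
  have hLd : ∀ z, HasDerivAt L a z := fun z => by
    exact (((hasDerivAt_id z).const_mul a).add_const (b/2)).congr_deriv (mul_one a)
  have hda : HasDerivAt h (deriv h 0) 0 := (hd.differentiableAt hn0).hasDerivAt
  obtain ⟨r, hr, hLin⟩ := exists_lin c' n hn orb ho hperi hdist α hlam (fun z => L (h z)) r0 hr0
    (fun z hz => ((hLd (h z)).differentiableAt.comp_differentiableWithinAt z (hd z hz)))
    (by
      have : HasDerivAt (fun z => L (h z)) (a * deriv h 0) 0 := (hLd (h 0)).comp 0 hda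
      rw [this.deriv]; exact mul_ne_zero ha hh0)
    (by simp [horb, h0])
    (fun z hz => by
      have := (hsemi.iterate_right n) (h z)
      rw [hconj z hz] at this
      exact this.symm)
  exact brjuno_of_lin α hα r hr hLin

end SQB

/-- If an irrationally indifferent cycle of a quadratic polynomial with multiplier
`e^{2πiα}` is a Siegel cycle, then `α` satisfies the Brjuno condition. -/
theorem siegel_quadratic_brjuno (a b c : ℂ) (ha : a ≠ 0)
    (f : ℂ → ℂ) (hf : f = fun z => a * z ^ 2 + b * z + c)
    (n : ℕ) (hn : 1 ≤ n) (z₀ : ℂ)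
    (hper : f^[n] z₀ = z₀) (hexact : ∀ k, 1 ≤ k → k < n → f^[k] z₀ ≠ z₀)
    (α : ℝ) (hα : Irrational α)
    (hmult : deriv (f^[n]) z₀ = Complex.exp (2 * Real.pi * Complex.I * α))
    (hlin : LinearizableAt (f^[n]) z₀ (Complex.exp (2 * Real.pi * Complex.I * α))) :
    BrjunoCondition α := by
  exact SQB.siegel_main a b c ha f hf n hn z₀ hper hexact α hα hmult hlin
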